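/- arXiv:2010.08129 — 7 statements merged into one kernel-verified Lean document; each statement's English description precedes it below -/
import Mathlib

section
/- Let A and B be C*-algebras and let T : A → B be a bounded linear map. The following are equivalent: (a) T is orthogonality preserving; (b) T preserves orthogonality on self-adjoint elements, i.e., for all self-adjoint a, b ∈ A with a b = 0 one has T(a) ⊥ T(b); (c) T preserves orthogonality on positive elements, i.e., for all positive a, b ∈ A with a b = 0 one has T(a) ⊥ T(b). -/
noncomputable section

/-- Two elements of a C*-algebra are *orthogonal* if `a * b* = 0` and `b* * a = 0`. -/
def CStar.orth {A : Type*} [NonUnitalCStarAlgebra A] (a b : A) : Prop :=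
  a * star b = 0 ∧ star b * a = 0

/-- The triple product `{x,y,z} = (1/2)(x y* z + z y* x)` on a C*-algebra. -/
def CStar.tp {A : Type*} [NonUnitalCStarAlgebra A] (x y z : A) : A :=
  (2 : ℂ)⁻¹ • (x * star y * z + z * star y * x)

open CStar

open Filter Topology
open scoped ComplexStarModule

lemma ContinuousMap.exists_tent_partition {X : Type*} [TopologicalSpace X] [CompactSpace X]
    {u : C(X, ℝ)} (hu : 0 ≤ u) {δ : ℝ} (hδ : 0 < δ) :
    ∃ (n : ℕ) (φ : ℕ → C(X, ℝ)), (∀ i x, 0 ≤ φ i x) ∧ (∑ i ∈ Finset.range n, φ i = 1) ∧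
      (∀ (i : ℕ) x, |u x - i * δ| * φ i x ≤ δ * φ i x) ∧
      ∀ i j, i + 2 ≤ j → φ i * φ j = 0 := by
  obtain ⟨n, hn⟩ := exists_nat_ge (‖u‖ / δ)
  set c : ℝ → ℝ := fun y ↦ max 0 (min y 1) with hc
  have hcc : Continuous c := by fun_prop
  have hmono : Monotone c := fun a b h ↦ max_le_max le_rfl (min_le_min h le_rfl)
  have c0 : ∀ y ≤ 0, c y = 0 := fun y hy ↦ max_eq_left ((min_le_left _ _).trans hy)
  have c1 : ∀ y, 1 ≤ y → c y = 1 := fun y hy ↦ by simp [hc, hy]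
  set φ : ℕ → C(X, ℝ) := fun i ↦
    ⟨fun x ↦ c (u x / δ - i + 1) - c (u x / δ - (i + 1 : ℕ) + 1), by fun_prop⟩ with hφ
  have hlow : ∀ (i : ℕ) x, u x / δ ≤ i - 1 → φ i x = 0 := fun i x h ↦ by
    simp only [hφ, ContinuousMap.coe_mk]
    rw [c0 _ (by linarith), c0 _ (by push_cast; linarith), sub_zero]
  have hhigh : ∀ (i : ℕ) x, (i : ℝ) + 1 ≤ u x / δ → φ i x = 0 := fun i x h ↦ by
    simp only [hφ, ContinuousMap.coe_mk]
    rw [c1 _ (by linarith), c1 _ (by push_cast; linarith), sub_self]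
  have hpos : ∀ i x, 0 ≤ φ i x := fun i x ↦
    sub_nonneg.2 (hmono (by push_cast; linarith))
  refine ⟨n + 1, φ, hpos, ?_, fun i x ↦ ?_, fun i j hij ↦ ?_⟩
  · ext x
    have hux : u x / δ ≤ n := by
      refine le_trans ?_ hn
      gcongr
      exact (le_abs_self _).trans (u.norm_coe_le_norm x)
    have hu0 : 0 ≤ u x / δ := div_nonneg (hu x) hδ.le
    simp only [ContinuousMap.sum_apply, hφ, ContinuousMap.coe_mk, ContinuousMap.one_apply]
    rw [Finset.sum_range_sub' (fun i : ℕ ↦ c (u x / δ - i + 1)) (n + 1), c1 _ (by simpa),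
      c0 _ (by push_cast; linarith), sub_zero]
  · rcases le_or_gt (u x / δ) (i - 1) with h | h
    · simp [hlow i x h]
    rcases le_or_gt ((i : ℝ) + 1) (u x / δ) with h' | h'
    · simp [hhigh i x h']
    refine mul_le_mul_of_nonneg_right ?_ (hpos i x)
    rw [lt_div_iff₀ hδ] at h
    rw [div_lt_iff₀ hδ] at h'
    rw [abs_le]
    constructor <;> linarith
  · ext x
    have hij' : (i : ℝ) + 2 ≤ j := by exact_mod_cast hij
    rcases le_or_gt (u x / δ) (j - 1) with h | h
    · simp [hlow j x h]
    · simp [hhigh i x (by linarith)]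

/-- A bounded bilinear form on `C(X, ℝ)` vanishing on pairs with zero product is balanced. -/
lemma ContinuousMap.bilin_mul_left_eq_mul_right {X E : Type*} [TopologicalSpace X]
    [CompactSpace X] [NormedAddCommGroup E] [NormedSpace ℝ E]
    (β : C(X, ℝ) →ₗ[ℝ] C(X, ℝ) →ₗ[ℝ] E) {C : ℝ} (hC : ∀ f g, ‖β f g‖ ≤ C * ‖f‖ * ‖g‖)
    (hβ : ∀ f g, f * g = 0 → β f g = 0) (u f g : C(X, ℝ)) : β (u * f) g = β f (u * g) := by
  wlog hC0 : 0 ≤ C generalizing C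
  · refine this (C := |C|) (fun f g ↦ (hC f g).trans ?_) (abs_nonneg C)
    gcongr
    exact le_abs_self C
  wlog hu : 0 ≤ u generalizing u
  · have h := this (u + ‖u‖ • 1) fun x ↦ by
      have := u.norm_coe_le_norm x
      have := (abs_le.1 this).1
      change 0 ≤ u x + ‖u‖ * 1
      linarith
    simpa [add_mul] using h
  suffices key : ∀ δ > 0, ‖β (u * f) g - β f (u * g)‖ ≤ δ * (8 * (C * ‖f‖ * ‖g‖)) by
    rw [← sub_eq_zero, ← norm_le_zero_iff]
    have hlim : Filter.Tendsto (fun δ : ℝ ↦ δ * (8 * (C * ‖f‖ * ‖g‖)))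
        (nhdsWithin 0 (Set.Ioi 0)) (nhds 0) :=
      tendsto_nhdsWithin_of_tendsto_nhds (Continuous.tendsto' (by fun_prop) _ _ (by simp))
    exact ge_of_tendsto hlim (by filter_upwards [self_mem_nhdsWithin] with δ hδ using key δ hδ)
  intro δ hδ
  obtain ⟨n, φ, hpos, hsum, hosc, hfar⟩ := exists_tent_partition hu hδ
  set S : (ℕ → C(X, ℝ)) → C(X, ℝ) → C(X, ℝ) :=
    fun w k ↦ ∑ i ∈ Finset.range n, w i * (φ i * k) with hS
  have bound : ∀ (w : ℕ → C(X, ℝ)) (K : ℝ), 0 ≤ K → (∀ i x, |w i x| * φ i x ≤ K * φ i x) →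
      ∀ k : C(X, ℝ), ‖S w k‖ ≤ K * ‖k‖ := by
    intro w K hK hw k
    refine (ContinuousMap.norm_le _ (by positivity)).2 fun x ↦ ?_
    have h1 : ∑ i ∈ Finset.range n, φ i x = 1 := by
      simpa using congrArg (fun F : C(X, ℝ) ↦ F x) hsum
    calc ‖(S w k) x‖
        ≤ ∑ i ∈ Finset.range n, ‖w i x * (φ i x * k x)‖ := by
          simpa [hS] using norm_sum_le (Finset.range n) fun i ↦ w i x * (φ i x * k x)
      _ ≤ ∑ i ∈ Finset.range n, K * φ i x * ‖k‖ := by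
          refine Finset.sum_le_sum fun i _ ↦ ?_
          rw [norm_mul, norm_mul, Real.norm_of_nonneg (hpos i x), ← mul_assoc, Real.norm_eq_abs]
          exact mul_le_mul (hw i x) (k.norm_coe_le_norm x) (norm_nonneg _)
            (mul_nonneg hK (hpos i x))
      _ = K * ‖k‖ := by rw [← Finset.sum_mul, ← Finset.mul_sum, h1, mul_one]
  have decomp : ∀ k : C(X, ℝ), ∑ i ∈ Finset.range n, φ i * k = k := fun k ↦ by
    rw [← Finset.sum_mul, hsum, one_mul]
  set e : Fin 3 → ℕ → C(X, ℝ) := fun r i ↦ if i % 3 = r then 1 else 0 with he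
  set t : ℕ → C(X, ℝ) := fun i ↦ u - ((i : ℝ) * δ) • 1 with ht
  have he' : ∀ r i x, |e r i x| * φ i x ≤ 1 * φ i x := fun r i x ↦
    mul_le_mul_of_nonneg_right (by simp only [he]; split_ifs <;> simp) (hpos i x)
  have ht' : ∀ i x, |t i x| * φ i x ≤ δ * φ i x := fun i x ↦ by simpa [ht] using hosc i x
  have bil : ∀ w w' k k', β (S w k) (S w' k') = ∑ i ∈ Finset.range n, ∑ j ∈ Finset.range n,
      β (w i * (φ i * k)) (w' j * (φ j * k')) := fun w w' k k' ↦ by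
    simp only [hS, map_sum, LinearMap.sum_apply]
    rw [Finset.sum_comm]
  have S1 : ∀ k, S 1 k = k := fun k ↦ by simpa [hS] using decomp k
  have Su : ∀ k, S (fun _ ↦ u) k = u * k := fun k ↦ by
    simp only [hS, ← Finset.mul_sum, decomp]
  have far : ∀ i j, i + 2 ≤ j ∨ j + 2 ≤ i → ∀ v w : C(X, ℝ),
      β (v * (φ i * f)) (w * (φ j * g)) = 0 := fun i j hij v w ↦ by
    have h0 : φ i * φ j = 0 := by
      rcases hij with h | h
      · exact hfar i j h
      · rw [mul_comm, hfar j i h]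
    refine hβ _ _ ?_
    rw [show v * (φ i * f) * (w * (φ j * g)) = φ i * φ j * (v * f * w * g) by ring, h0, zero_mul]
  have main : β (u * f) g - β f (u * g) = β (S t f) (S 1 g) - β (S 1 f) (S t g) +
      ∑ r, δ • (β (S (e (r + 1)) f) (S (e r) g) - β (S (e r) f) (S (e (r + 1)) g)) := by
    have h1 : β (u * f) g - β f (u * g) =
      β (S (fun _ ↦ u) f) (S 1 g) - β (S 1 f) (S (fun _ ↦ u) g) := by simp only [Su, S1]
    rw [h1]
    simp only [bil, ← Finset.sum_sub_distrib, Finset.smul_sum]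
    rw [Finset.sum_comm (s := Finset.univ), ← Finset.sum_add_distrib]
    refine Finset.sum_congr rfl fun i _ ↦ ?_
    rw [Finset.sum_comm (s := Finset.univ), ← Finset.sum_add_distrib]
    refine Finset.sum_congr rfl fun j _ ↦ ?_
    by_cases hij : i + 2 ≤ j ∨ j + 2 ≤ i
    · have h2 : ∀ w, β (w * (φ i * f)) (φ j * g) = 0 := fun w ↦ by simpa using far i j hij w 1
      have h3 : ∀ w, β (φ i * f) (w * (φ j * g)) = 0 := by simpa using far i j hij 1
      simp [far i j hij, h2, h3]
    have e1 : ∀ r k, e r k = (if k % 3 = r then (1 : ℝ) else 0) • (1 : C(X, ℝ)) := fun r k ↦ by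
      simp only [he]; split_ifs <;> simp
    simp only [ht, e1, sub_mul, smul_mul_assoc, one_mul, Pi.one_apply, map_sub, map_smul,
      LinearMap.sub_apply, LinearMap.smul_apply, Fin.sum_univ_three]
    have v1 : (0 : Fin 3) + 1 = 1 := rfl
    have v2 : (1 : Fin 3) + 1 = 2 := rfl
    have v3 : (2 : Fin 3) + 1 = 0 := rfl
    have h3 : i % 3 = 0 ∧ (i + 1) % 3 = 1 ∨ i % 3 = 1 ∧ (i + 1) % 3 = 2 ∨
        i % 3 = 2 ∧ (i + 1) % 3 = 0 := by omega
    have h4 : j % 3 = 0 ∧ (j + 1) % 3 = 1 ∨ j % 3 = 1 ∧ (j + 1) % 3 = 2 ∨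
        j % 3 = 2 ∧ (j + 1) % 3 = 0 := by omega
    obtain rfl | rfl | rfl : j = i ∨ j = i + 1 ∨ i = j + 1 := by omega
    · module
    · rcases h3 with ⟨h, h'⟩ | ⟨h, h'⟩ | ⟨h, h'⟩ <;> simp [h, h', v1, v2, v3] <;> module
    · rcases h4 with ⟨h, h'⟩ | ⟨h, h'⟩ | ⟨h, h'⟩ <;> simp [h, h', v1, v2, v3] <;> module
  have est : ∀ w w' K K', 0 ≤ K → 0 ≤ K' → (∀ i x, |w i x| * φ i x ≤ K * φ i x) →
      (∀ i x, |w' i x| * φ i x ≤ K' * φ i x) →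
      ‖β (S w f) (S w' g)‖ ≤ K * K' * (C * ‖f‖ * ‖g‖) := fun w w' K K' hK hK' hw hw' ↦
    calc ‖β (S w f) (S w' g)‖ ≤ C * ‖S w f‖ * ‖S w' g‖ := hC _ _
      _ ≤ C * (K * ‖f‖) * (K' * ‖g‖) := by
        gcongr
        · exact bound w K hK hw f
        · exact bound w' K' hK' hw' g
      _ = _ := by ring
  have h1' : ∀ i x, |(1 : ℕ → C(X, ℝ)) i x| * φ i x ≤ 1 * φ i x := fun i x ↦ by simp
  have hr : ∀ r : Fin 3, ‖δ • (β (S (e (r + 1)) f) (S (e r) g) - β (S (e r) f) (S (e (r + 1)) g))‖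
      ≤ δ * (2 * (C * ‖f‖ * ‖g‖)) := fun r ↦ by
    rw [norm_smul, Real.norm_of_nonneg hδ.le]
    gcongr
    refine (norm_sub_le _ _).trans ?_
    have h2 := est _ _ 1 1 zero_le_one zero_le_one (he' (r + 1)) (he' r)
    have h3 := est _ _ 1 1 zero_le_one zero_le_one (he' r) (he' (r + 1))
    linarith
  rw [main]
  have h2 := est t 1 δ 1 hδ.le zero_le_one ht' h1'
  have h3 := est 1 t 1 δ zero_le_one hδ.le h1' ht'
  have h4 := norm_sum_le Finset.univ
    fun r ↦ δ • (β (S (e (r + 1)) f) (S (e r) g) - β (S (e r) f) (S (e (r + 1)) g))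
  have h5 := Finset.sum_le_sum fun r (_ : r ∈ Finset.univ) ↦ hr r
  rw [Fin.sum_const, nsmul_eq_mul] at h5
  refine (norm_add_le _ _).trans ((add_le_add (norm_sub_le _ _) (h4.trans h5)).trans ?_)
  push_cast
  linarith

lemma eq_zero_of_forall_isSelfAdjoint {A E : Type*} [AddCommGroup A] [Module ℂ A]
    [StarAddMonoid A] [StarModule ℂ A] [AddCommGroup E] [Module ℂ E] {L : A → E}
    (hadd : ∀ a b, L (a + b) = L a + L b) (hsmul : ∀ (t : ℂ) a, L (t • a) = t • L a)
    (hL : ∀ h, IsSelfAdjoint h → L h = 0) (a : A) : L a = 0 := by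
  rw [← realPart_add_I_smul_imaginaryPart a, hadd, hsmul, hL _ (ℜ a).2, hL _ (ℑ a).2]
  simp

set_option maxHeartbeats 4000000 in
lemma polarization_cubic {A E : Type*} [NonUnitalCStarAlgebra A] [NormedAddCommGroup E]
    [NormedSpace ℂ E] (V : A →L[ℂ] A →L[ℂ] E)
    (hV : ∀ h, IsSelfAdjoint h → V (h * h) h = V h (h * h)) (a b c : A) :
    V (a * b) c + V (b * a) c + V (b * c) a + V (c * b) a + V (c * a) b + V (a * c) b
      - V c (a * b) - V c (b * a) - V a (b * c) - V a (c * b) - V b (c * a) - V b (a * c) = 0 := by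
  have s1 : ∀ h k, IsSelfAdjoint h → IsSelfAdjoint k →
      V (h * h) k + V (h * k) h + V (k * h) h
        - V k (h * h) - V h (h * k) - V h (k * h) = 0 := fun h k hh hk ↦ by
    have h0 := hV k hk
    have h1 := hV (h + k) (hh.add hk)
    have h2 := hV (h - k) (hh.sub hk)
    simp only [add_mul, mul_add, sub_mul, mul_sub, map_add, map_sub, add_apply, sub_apply]
      at h1 h2
    linear_combination (norm := module) (1 / 2 : ℂ) • h1 - (1 / 2 : ℂ) • h2 - h0
  have s2 : ∀ h k l, IsSelfAdjoint h → IsSelfAdjoint k → IsSelfAdjoint l →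
    V (h * k) l + V (k * h) l + V (k * l) h + V (l * k) h + V (l * h) k + V (h * l) k
      - V l (h * k) - V l (k * h) - V h (k * l) - V h (l * k) - V k (l * h) - V k (h * l) = 0 := by
    intro h k l hh hk hl
    have h1 := s1 h k hh hk
    have h2 := s1 l k hl hk
    have h3 := s1 (h + l) k (hh.add hl) hk
    simp only [add_mul, mul_add, map_add, add_apply] at h3
    linear_combination (norm := module) h3 - h1 - h2
  refine eq_zero_of_forall_isSelfAdjoint (L := fun x ↦ V (x * b) c + V (b * x) c + V (b * c) x
      + V (c * b) x + V (c * x) b + V (x * c) b - V c (x * b) - V c (b * x) - V x (b * c)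
      - V x (c * b) - V b (c * x) - V b (x * c)) ?_ ?_ (fun h hh ↦ ?_) a
  rotate_left 2
  · refine eq_zero_of_forall_isSelfAdjoint (L := fun x ↦ V (h * x) c + V (x * h) c + V (x * c) h
      + V (c * x) h + V (c * h) x + V (h * c) x - V c (h * x) - V c (x * h) - V h (x * c)
      - V h (c * x) - V x (c * h) - V x (h * c)) ?_ ?_ (fun k hk ↦ ?_) b
    rotate_left 2
    refine eq_zero_of_forall_isSelfAdjoint (L := fun x ↦ V (h * k) x + V (k * h) x + V (k * x) h
        + V (x * k) h + V (x * h) k + V (h * x) k - V x (h * k) - V x (k * h) - V h (k * x)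
        - V h (x * k) - V k (x * h) - V k (h * x)) ?_ ?_ (fun l hl ↦ s2 h k l hh hk hl) c
    all_goals
      intros
      simp only [add_mul, mul_add, smul_mul_assoc, mul_smul_comm, map_add, map_smul, add_apply,
        smul_apply, smul_add, smul_sub]
      try abel
  all_goals
    intros
    simp only [add_mul, mul_add, smul_mul_assoc, mul_smul_comm, map_add, map_smul, add_apply,
      smul_apply, smul_add, smul_sub]
    try abel

set_option maxHeartbeats 4000000 in
lemma polarization_quartic {A E : Type*} [NonUnitalCStarAlgebra A] [NormedAddCommGroup E]
    [NormedSpace ℂ E] (V : A →L[ℂ] A →L[ℂ] E)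
    (hV : ∀ h, IsSelfAdjoint h → V (h * h) (h * h) = V (h * h * h) h) {e : A}
    (he : IsSelfAdjoint e) (a c : A) :
    V (c * a + a * c) (e * e) + V (e * e) (c * a + a * c)
      + V (e * a + a * e) (c * e + e * c) + V (c * e + e * c) (e * a + a * e)
      - V (c * e * e + e * c * e + e * e * c) a - V (a * e * e + e * a * e + e * e * a) c
      - V (a * c * e + a * e * c + c * a * e + e * a * c + c * e * a + e * c * a) e = 0 := by
  have s1 : ∀ h k, IsSelfAdjoint h → IsSelfAdjoint k →
      V (h * k + k * h) (h * h) + V (h * h) (h * k + k * h)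
       - V (h * h * h) k - V (k * h * h + h * k * h + h * h * k) h = 0 := fun h k hh hk ↦ by
    have h1 := hV (h + k) (hh.add hk)
    have h2 := hV (h - k) (hh.sub hk)
    have h3 := hV (h + (k + k)) (hh.add (hk.add hk))
    have h4 := hV (h - (k + k)) (hh.sub (hk.add hk))
    simp only [add_mul, mul_add, sub_mul, mul_sub, map_add, map_sub, add_apply, sub_apply]
      at h1 h2 h3 h4 ⊢
    linear_combination (norm := module) (2 / 3 : ℂ) • h1 - (2 / 3 : ℂ) • h2 - (1 / 12 : ℂ) • h3
      + (1 / 12 : ℂ) • h4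
  have s2 : ∀ k l, IsSelfAdjoint k → IsSelfAdjoint l →
    V (l * k + k * l) (e * e) + V (e * e) (l * k + k * l)
      + V (e * k + k * e) (l * e + e * l) + V (l * e + e * l) (e * k + k * e)
      - V (l * e * e + e * l * e + e * e * l) k - V (k * e * e + e * k * e + e * e * k) l
      - V (k * l * e + k * e * l + l * k * e + e * k * l + l * e * k + e * l * k) e = 0 := by
    intro k l hk hl
    have h0 := s1 l k hl hk
    have h1 := s1 (e + l) k (he.add hl) hk
    have h2 := s1 (e - l) k (he.sub hl) hk
    simp only [add_mul, mul_add, sub_mul, mul_sub, map_add, map_sub, add_apply, sub_apply]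
      at h0 h1 h2 ⊢
    linear_combination (norm := module) (1 / 2 : ℂ) • h1 - (1 / 2 : ℂ) • h2 - h0
  refine eq_zero_of_forall_isSelfAdjoint (L := fun x ↦
    V (c * x + x * c) (e * e) + V (e * e) (c * x + x * c)
      + V (e * x + x * e) (c * e + e * c) + V (c * e + e * c) (e * x + x * e)
      - V (c * e * e + e * c * e + e * e * c) x - V (x * e * e + e * x * e + e * e * x) c
      - V (x * c * e + x * e * c + c * x * e + e * x * c + c * e * x + e * c * x) e)
    ?_ ?_ (fun k hk ↦ ?_) a
  rotate_left 2
  · refine eq_zero_of_forall_isSelfAdjoint (L := fun x ↦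
      V (x * k + k * x) (e * e) + V (e * e) (x * k + k * x)
      + V (e * k + k * e) (x * e + e * x) + V (x * e + e * x) (e * k + k * e)
      - V (x * e * e + e * x * e + e * e * x) k - V (k * e * e + e * k * e + e * e * k) x
      - V (k * x * e + k * e * x + x * k * e + e * k * x + x * e * k + e * x * k) e)
      ?_ ?_ (fun l hl ↦ s2 k l hk hl) c
    all_goals
      intros
      simp only [add_mul, mul_add, smul_mul_assoc, mul_smul_comm, map_add, map_smul, add_apply,
        smul_apply, smul_add, smul_sub]
      try abel
  all_goals
    intros
    simp only [add_mul, mul_add, smul_mul_assoc, mul_smul_comm, map_add, map_smul, add_apply,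
      smul_apply, smul_add, smul_sub]
    try abel

lemma bilin_add_swap_eq_zero {A E : Type*} [NonUnitalCStarAlgebra A] [PartialOrder A] [StarOrderedRing A]
    [NormedAddCommGroup E] [NormedSpace ℂ E] (V : A →L[ℂ] A →L[ℂ] E)
    (hV : ∀ h, IsSelfAdjoint h → V (h * h) (h * h) = V (h * h * h) h) {a c : A}
    (hac : a * c = 0) (hca : c * a = 0) : V a c + V c a = 0 := by
  have hl := CStarAlgebra.increasingApproximateUnit A
  set l := CStarAlgebra.approximateUnit A
  have := hl.neBot
  have hn : ∀ᶠ e in l, ‖e‖ ≤ 1 := hl.eventually_norm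
  have R : ∀ x : A, Tendsto (fun e ↦ x * e) l (𝓝 x) := hl.tendsto_mul_left
  have L : ∀ x : A, Tendsto (fun e ↦ e * x) l (𝓝 x) := hl.tendsto_mul_right
  have left : ∀ {F : A → A} {x : A}, Tendsto F l (𝓝 x) →
      Tendsto (fun e ↦ e * F e) l (𝓝 x) := fun {F x} hF ↦ by
    have h0 : Tendsto (fun e ↦ e * (F e - x)) l (𝓝 0) := by
      refine squeeze_zero_norm' (a := fun e ↦ ‖F e - x‖) ?_
        (tendsto_iff_norm_sub_tendsto_zero.1 hF)
      filter_upwards [hn] with e he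
      exact (norm_mul_le _ _).trans (mul_le_of_le_one_left (norm_nonneg _) he)
    simpa [mul_sub] using h0.add (L x)
  have right : ∀ {F : A → A} {x : A}, Tendsto F l (𝓝 x) →
      Tendsto (fun e ↦ F e * e) l (𝓝 x) := fun {F x} hF ↦ by
    have h0 : Tendsto (fun e ↦ (F e - x) * e) l (𝓝 0) := by
      refine squeeze_zero_norm' (a := fun e ↦ ‖F e - x‖) ?_
        (tendsto_iff_norm_sub_tendsto_zero.1 hF)
      filter_upwards [hn] with e he
      exact (norm_mul_le _ _).trans (mul_le_of_le_one_right (norm_nonneg _) he)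
    simpa [sub_mul] using h0.add (R x)
  have V2 : ∀ {F G : A → A} {x y : A}, Tendsto F l (𝓝 x) → Tendsto G l (𝓝 y) →
      Tendsto (fun e ↦ V (F e) (G e)) l (𝓝 (V x y)) := fun hF hG ↦
    (V.continuous₂.tendsto (_, _)).comp (hF.prodMk_nhds hG)
  have cube : ∀ x : A, Tendsto (fun e ↦ x * e * e + e * x * e + e * e * x) l (𝓝 (x + x + x)) :=
    fun x ↦ by
      refine ((right (R x)).add (right (L x))).add ?_
      simpa only [mul_assoc] using left (L x)
  have mid : ∀ x y : A, x * y = 0 → Tendsto (fun e ↦ x * e * y) l (𝓝 0) := fun x y hxy ↦ by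
    simpa only [mul_assoc, hxy] using (L y).const_mul x
  have last : Tendsto (fun e ↦ V (a * e * c + c * e * a) e) l (𝓝 0) := by
    have h0 := ((mid a c hac).add (mid c a hca)).norm.const_mul ‖V‖
    rw [add_zero, norm_zero, mul_zero] at h0
    refine squeeze_zero_norm' ?_ h0
    filter_upwards [hn] with e he
    exact (V.le_opNorm₂ _ _).trans (mul_le_of_le_one_right (by positivity) he)
  have lim := ((((V2 ((L a).add (R a)) ((R c).add (L c))).add
    (V2 ((R c).add (L c)) ((L a).add (R a)))).sub (V2 (cube c) (tendsto_const_nhds (x := a)))).sub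
    (V2 (cube a) (tendsto_const_nhds (x := c)))).sub last
  have h0 : ∀ᶠ e in l, (0 : E) = V (e * a + a * e) (c * e + e * c)
      + V (c * e + e * c) (e * a + a * e)
      - V (c * e * e + e * c * e + e * e * c) a - V (a * e * e + e * a * e + e * e * a) c
      - V (a * e * c + c * e * a) e := by
    filter_upwards [hl.eventually_isSelfAdjoint] with e he
    have := polarization_quartic V hV he a c
    simpa only [hac, hca, mul_assoc e a c, mul_assoc e c a, map_zero, mul_zero, zero_mul, add_zero,
      zero_add, zero_apply] using this.symm
  have h1 := tendsto_nhds_unique lim (tendsto_const_nhds.congr' h0)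
  simp only [map_add, add_apply] at h1
  linear_combination (norm := module) h1

lemma bilin_mul_mul_eq_zero {A E : Type*} [NonUnitalCStarAlgebra A] [PartialOrder A]
    [StarOrderedRing A] [NormedAddCommGroup E] [NormedSpace ℂ E] (V : A →L[ℂ] A →L[ℂ] E)
    (hV3 : ∀ h, IsSelfAdjoint h → V (h * h) h = V h (h * h))
    (hV4 : ∀ h, IsSelfAdjoint h → V (h * h) (h * h) = V (h * h * h) h) {a c : A}
    (hac : a * c = 0) (hca : c * a = 0) (y : A) : V (a * y * a) c = 0 := by
  have hac' : ∀ x, a * (c * x) = 0 := fun x ↦ by rw [← mul_assoc, hac, zero_mul]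
  have hca' : ∀ x, c * (a * x) = 0 := fun x ↦ by rw [← mul_assoc, hca, zero_mul]
  have j1 := polarization_cubic V hV3 a (a * y + y * a) c
  have j2 := polarization_cubic V hV3 (a * a) y c
  have j3 := polarization_cubic V hV3 a a (y * c + c * y)
  have j4 := bilin_add_swap_eq_zero V hV4 (a := a * y * a) (c := c)
    (by rw [mul_assoc, hac, mul_zero]) (by rw [mul_assoc, hca'])
  simp only [mul_assoc, mul_add, add_mul, hac, hca, hac', hca', map_add, map_zero, mul_zero,
    add_apply, zero_apply] at j1 j2 j3 j4 ⊢
  linear_combination (norm := module) (1 / 4 : ℂ) • j1 - (1 / 4 : ℂ) • j2 - (1 / 8 : ℂ) • j3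
    + (1 / 2 : ℂ) • j4

lemma exists_norm_sub_mul_mul_lt {A : Type*} [NonUnitalCStarAlgebra A] [PartialOrder A]
    [StarOrderedRing A] (a : A) {ε : ℝ} (hε : 0 < ε) : ∃ y, ‖a - a * y * a‖ < ε := by
  obtain ⟨h, hh⟩ : ∃ h, h = star a * a := ⟨_, rfl⟩
  have hsa : IsSelfAdjoint h := hh ▸ .star_mul_self a
  have hsp : ∀ t ∈ quasispectrum ℝ h, 0 ≤ t :=
    quasispectrum_nonneg_of_nonneg h (hh ▸ star_mul_self_nonneg a)
  obtain ⟨δ, hδ⟩ : ∃ δ, δ = ε ^ 2 / 2 := ⟨_, rfl⟩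
  have hδ0 : 0 < δ := by rw [hδ]; positivity
  have hden : ∀ t : ℝ, t ^ 2 + δ ^ 2 ≠ 0 := fun t ↦ by positivity
  obtain ⟨g, hg⟩ : ∃ g : ℝ → ℝ, ∀ t, g t = t / (t ^ 2 + δ ^ 2) := ⟨_, fun _ ↦ rfl⟩
  have hgc : Continuous g := by
    rw [funext hg]
    fun_prop (disch := assumption)
  have hg0 : g 0 = 0 := by simp [hg]
  obtain ⟨φ, hφ⟩ : ∃ φ : ℝ → ℝ, ∀ t, φ t = g t * t := ⟨_, fun _ ↦ rfl⟩
  have hφc : ContinuousOn φ (quasispectrum ℝ h) := by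
    rw [funext hφ]
    fun_prop
  have hφ0 : φ 0 = 0 := by simp [hφ]
  have hFs : star (cfcₙ φ h) = cfcₙ φ h := (cfcₙ_predicate φ h : IsSelfAdjoint _)
  have hid : cfcₙ (fun t : ℝ ↦ t) h = h := cfcₙ_id' ℝ h
  have hFg : cfcₙ g h * h = cfcₙ φ h := by
    rw [funext hφ, cfcₙ_mul g (fun t ↦ t) h, hid]
  refine ⟨cfcₙ g h * star a, ?_⟩
  have e1 : a * (cfcₙ g h * star a) * a = a * cfcₙ φ h := by
    rw [← hFg, hh]
    simp only [mul_assoc]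
  have m1 : cfcₙ (fun t ↦ t * φ t) h = h * cfcₙ φ h := by
    rw [cfcₙ_mul (fun t ↦ t) φ h, hid]
  have m2 : cfcₙ (fun t ↦ φ t * t) h = cfcₙ φ h * h := by
    rw [cfcₙ_mul φ (fun t ↦ t) h, hid]
  have m3 : cfcₙ (fun t ↦ φ t * t * φ t) h = cfcₙ φ h * h * cfcₙ φ h := by
    rw [cfcₙ_mul (fun t ↦ φ t * t) φ h, m2]
  have e2 : star (a - a * cfcₙ φ h) * (a - a * cfcₙ φ h) =
      cfcₙ (fun t ↦ (t - t * φ t) - (φ t * t - φ t * t * φ t)) h := by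
    rw [cfcₙ_sub (fun t ↦ t - t * φ t) (fun t ↦ φ t * t - φ t * t * φ t) h,
      cfcₙ_sub (fun t ↦ t) (fun t ↦ t * φ t) h,
      cfcₙ_sub (fun t ↦ φ t * t) (fun t ↦ φ t * t * φ t) h, m1, m2, m3, hid, star_sub, star_mul,
      hFs, hh]
    noncomm_ring
  rw [e1, ← sq_lt_sq₀ (norm_nonneg _) hε.le, sq, ← CStarRing.norm_star_mul_self, e2]
  refine (norm_cfcₙ_le (c := δ) fun t ht ↦ ?_).trans_lt (by rw [hδ]; linarith [pow_pos hε 2])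
  have ht0 := hsp t ht
  have e3 : (t - t * φ t) - (φ t * t - φ t * t * φ t) = t * δ ^ 4 / (t ^ 2 + δ ^ 2) ^ 2 := by
    rw [hφ, hg]
    have := hden t
    field_simp
    ring
  rw [e3, Real.norm_of_nonneg (by positivity), div_le_iff₀ (by have := hden t; positivity)]
  have h1 : t * δ ≤ t ^ 2 + δ ^ 2 := by nlinarith [sq_nonneg (t - δ), mul_nonneg ht0 hδ0.le]
  have h2 : δ ^ 2 ≤ t ^ 2 + δ ^ 2 := by linarith [sq_nonneg t]
  calc t * δ ^ 4 = δ * ((t * δ) * δ ^ 2) := by ring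
    _ ≤ δ * ((t ^ 2 + δ ^ 2) * (t ^ 2 + δ ^ 2)) := by gcongr
    _ = _ := by ring

lemma posPart_mul_eq_zero {A : Type*} [NonUnitalCStarAlgebra A] [PartialOrder A]
    [StarOrderedRing A] {p r : A} (hp : IsSelfAdjoint p) (h : p * r = 0) :
    p⁺ * r = 0 ∧ p⁻ * r = 0 := by
  have e1 : p⁺ * p = p⁺ * p⁺ := by
    nth_rw 2 [← CFC.posPart_sub_negPart p]
    rw [mul_sub, CFC.posPart_mul_negPart, sub_zero]
  have e2 : p⁻ * p = -(p⁻ * p⁻) := by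
    nth_rw 2 [← CFC.posPart_sub_negPart p]
    rw [mul_sub, CFC.negPart_mul_posPart, zero_sub]
  have key : ∀ q : A, IsSelfAdjoint q → q * q * r = 0 → q * r = 0 := fun q hq h0 ↦ by
    rw [← CStarRing.star_mul_self_eq_zero_iff, star_mul, hq.star_eq, mul_assoc, ← mul_assoc q, h0,
      mul_zero]
  refine ⟨key _ (CFC.posPart_nonneg p).isSelfAdjoint ?_,
    key _ (CFC.negPart_nonneg p).isSelfAdjoint ?_⟩
  · rw [← e1, mul_assoc, h, mul_zero]
  · rw [← neg_eq_zero, ← neg_mul, ← e2, mul_assoc, h, mul_zero]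

lemma bilin_eq_zero_of_isSelfAdjoint {A E : Type*} [NonUnitalCStarAlgebra A] [PartialOrder A]
    [StarOrderedRing A] [NormedAddCommGroup E] [NormedSpace ℂ E] (V : A →L[ℂ] A →L[ℂ] E)
    (hV : ∀ a b, 0 ≤ a → 0 ≤ b → a * b = 0 → V a b = 0) {p r : A} (hp : IsSelfAdjoint p)
    (hr : IsSelfAdjoint r) (h : p * r = 0) : V p r = 0 := by
  have comm : ∀ {x y : A}, IsSelfAdjoint x → IsSelfAdjoint y → x * y = 0 → y * x = 0 :=
    fun hx hy hxy ↦ by rw [← star_eq_zero, star_mul, hx.star_eq, hy.star_eq, hxy]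
  have key : ∀ q : A, 0 ≤ q → q * r = 0 → V q r = 0 := fun q hq h0 ↦ by
    obtain ⟨h1, h2⟩ := posPart_mul_eq_zero hr (comm hq.isSelfAdjoint hr h0)
    rw [← CFC.posPart_sub_negPart r, map_sub,
      hV _ _ hq (CFC.posPart_nonneg r)
        (comm (CFC.posPart_nonneg r).isSelfAdjoint hq.isSelfAdjoint h1),
      hV _ _ hq (CFC.negPart_nonneg r)
        (comm (CFC.negPart_nonneg r).isSelfAdjoint hq.isSelfAdjoint h2), sub_zero]
  obtain ⟨h1, h2⟩ := posPart_mul_eq_zero hp h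
  rw [← CFC.posPart_sub_negPart p, map_sub, sub_apply, key _ (CFC.posPart_nonneg p) h1,
    key _ (CFC.negPart_nonneg p) h2, sub_zero]

lemma bilin_balanced_of_isSelfAdjoint {A E : Type*} [NonUnitalCStarAlgebra A]
    [NormedAddCommGroup E] [NormedSpace ℂ E] (V : A →L[ℂ] A →L[ℂ] E)
    (hV : ∀ p r, IsSelfAdjoint p → IsSelfAdjoint r → p * r = 0 → V p r = 0) {h : A}
    (hh : IsSelfAdjoint h) :
    V (h * h) h = V h (h * h) ∧ V (h * h) (h * h) = V (h * h * h) h := by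
  let ι : C(quasispectrum ℝ h, ℝ) := ⟨Subtype.val, by fun_prop⟩
  let ψ : C(quasispectrum ℝ h, ℝ) → ContinuousMapZero (quasispectrum ℝ h) ℝ :=
    fun f ↦ ⟨f * ι, by simp [ι]⟩
  let Φ : C(quasispectrum ℝ h, ℝ) →ₗ[ℝ] A :=
    { toFun f := cfcₙHom hh (ψ f)
      map_add' f g := by
        rw [← map_add]
        congr 1
        ext x
        simp [ψ, add_mul]
      map_smul' r f := by
        rw [RingHom.id_apply, ← map_smul]
        congr 1
        ext x
        simp [ψ] }
  have hΦn : ∀ f, ‖Φ f‖ ≤ ‖f‖ * ‖ι‖ := fun f ↦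
    (norm_cfcₙHom h (ψ f)).trans_le (norm_mul_le f ι)
  have hΦsa : ∀ f, IsSelfAdjoint (Φ f) := fun f ↦ cfcₙHom_predicate hh _
  have hψ1 : ψ 1 = .id _ := by
    ext x
    simp [ψ, ι]
  have hψι : ψ ι = .id _ * .id _ := by
    ext x
    simp [ψ, ι]
  have hψιι : ψ (ι * ι) = .id _ * .id _ * .id _ := by
    ext x
    simp [ψ, ι]
  have hΦ1 : Φ 1 = h := (congrArg (cfcₙHom hh) hψ1).trans (cfcₙHom_id hh)
  have hΦι : Φ ι = h * h := (congrArg (cfcₙHom hh) hψι).trans (by rw [map_mul, cfcₙHom_id hh])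
  have hΦιι : Φ (ι * ι) = h * h * h :=
    (congrArg (cfcₙHom hh) hψιι).trans (by rw [map_mul, map_mul, cfcₙHom_id hh])
  have hΦ0 : ∀ f g, f * g = 0 → Φ f * Φ g = 0 := fun f g hfg ↦ by
    have h0 : ψ f * ψ g = 0 := by
      ext x
      have := congrArg (fun F : C(quasispectrum ℝ h, ℝ) ↦ F x) hfg
      simp only [ContinuousMap.mul_apply, ContinuousMap.zero_apply] at this
      simp [ψ, mul_mul_mul_comm, this]
    exact (map_mul (cfcₙHom hh) _ _).symm.trans ((congrArg (cfcₙHom hh) h0).trans (map_zero _))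
  let β : C(quasispectrum ℝ h, ℝ) →ₗ[ℝ] C(quasispectrum ℝ h, ℝ) →ₗ[ℝ] E :=
    LinearMap.mk₂ ℝ (fun f g ↦ V (Φ f) (Φ g)) (by simp) (by simp) (by simp) (by simp)
  have hβ : ∀ f g, ‖β f g‖ ≤ ‖V‖ * ‖ι‖ * ‖ι‖ * ‖f‖ * ‖g‖ := fun f g ↦
    calc ‖V (Φ f) (Φ g)‖ ≤ ‖V‖ * ‖Φ f‖ * ‖Φ g‖ := V.le_opNorm₂ _ _
      _ ≤ ‖V‖ * (‖f‖ * ‖ι‖) * (‖g‖ * ‖ι‖) := by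
        gcongr
        · exact hΦn f
        · exact hΦn g
      _ = _ := by ring
  have bal := ContinuousMap.bilin_mul_left_eq_mul_right β hβ
    fun f g hfg ↦ hV _ _ (hΦsa f) (hΦsa g) (hΦ0 f g hfg)
  have b1 : V (Φ (ι * 1)) (Φ 1) = V (Φ 1) (Φ (ι * 1)) := bal ι 1 1
  have b2 : V (Φ (ι * ι)) (Φ 1) = V (Φ ι) (Φ (ι * 1)) := bal ι ι 1
  rw [mul_one, hΦ1, hΦι] at b1
  rw [mul_one, hΦ1, hΦι, hΦιι] at b2
  exact ⟨b1, b2.symm⟩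

/-- A bounded bilinear map on a C⋆-algebra which vanishes on orthogonal pairs of positive elements
vanishes on all pairs of elements with zero products in both orders. -/
lemma bilin_eq_zero_of_mul_eq_zero {A E : Type*} [NonUnitalCStarAlgebra A] [PartialOrder A]
    [StarOrderedRing A] [NormedAddCommGroup E] [NormedSpace ℂ E] (V : A →L[ℂ] A →L[ℂ] E)
    (hV : ∀ a b, 0 ≤ a → 0 ≤ b → a * b = 0 → V a b = 0) {a c : A}
    (hac : a * c = 0) (hca : c * a = 0) : V a c = 0 := by
  have hsa := fun h (hh : IsSelfAdjoint h) ↦ bilin_balanced_of_isSelfAdjoint V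
    (fun p r hp hr ↦ bilin_eq_zero_of_isSelfAdjoint V hV hp hr) hh
  have hclosed : IsClosed {x | V x c = 0} :=
    isClosed_eq (by fun_prop) continuous_const
  refine hclosed.closure_subset (Metric.mem_closure_iff.2 fun ε hε ↦ ?_)
  obtain ⟨y, hy⟩ := exists_norm_sub_mul_mul_lt a hε
  exact ⟨a * y * a, bilin_mul_mul_eq_zero V (fun h hh ↦ (hsa h hh).1) (fun h hh ↦ (hsa h hh).2)
    hac hca y, by rwa [dist_eq_norm]⟩

lemma orth_map_of_nonneg {A B : Type*} [NonUnitalCStarAlgebra A]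
    [NonUnitalCStarAlgebra B] [PartialOrder A] [StarOrderedRing A] (T : A →L[ℂ] B)
    (hT : ∀ a b : A, 0 ≤ a → 0 ≤ b → a * b = 0 → orth (T a) (T b)) {a b : A} (hab : orth a b) :
    orth (T a) (T b) := by
  let S : A →L[ℂ] B := ((starL ℂ : B ≃L⋆[ℂ] B) : B →L⋆[ℂ] B).comp
    (T.comp ((starL ℂ : A ≃L⋆[ℂ] A) : A →L⋆[ℂ] A))
  have hS : ∀ x, S x = star (T (star x)) := fun _ ↦ rfl
  have h1 := bilin_eq_zero_of_mul_eq_zero ((ContinuousLinearMap.mul ℂ B).bilinearComp T S)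
    (fun x y hx hy hxy ↦ by
      simpa [hS, hy.isSelfAdjoint.star_eq] using (hT x y hx hy hxy).1) hab.1 hab.2
  have h2 := bilin_eq_zero_of_mul_eq_zero ((ContinuousLinearMap.mul ℂ B).flip.bilinearComp T S)
    (fun x y hx hy hxy ↦ by
      simpa [hS, hy.isSelfAdjoint.star_eq] using (hT x y hx hy hxy).2) hab.1 hab.2
  exact ⟨by simpa [hS] using h1, by simpa [hS] using h2⟩

/-- A bounded linear map between C*-algebras is orthogonality preserving iff it preserves
orthogonality on self-adjoint elements iff it preserves orthogonality on positive elements. -/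
theorem op_iff_op_on_sa_iff_op_on_pos {A B : Type*} [NonUnitalCStarAlgebra A]
    [NonUnitalCStarAlgebra B] [PartialOrder A] [StarOrderedRing A] (T : A →L[ℂ] B) :
    ((∀ a b : A, orth a b → orth (T a) (T b)) ↔
        (∀ a b : A, IsSelfAdjoint a → IsSelfAdjoint b → a * b = 0 → orth (T a) (T b))) ∧
      ((∀ a b : A, orth a b → orth (T a) (T b)) ↔
        (∀ a b : A, 0 ≤ a → 0 ≤ b → a * b = 0 → orth (T a) (T b))) := by
  have h : ∀ a b : A, IsSelfAdjoint a → IsSelfAdjoint b → a * b = 0 → orth a b :=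
    fun a b ha hb hab ↦ by
      rw [orth, hb.star_eq]
      exact ⟨hab, by rw [← star_eq_zero, star_mul, ha.star_eq, hb.star_eq, hab]⟩
  refine ⟨⟨fun hT a b ha hb hab ↦ hT a b (h a b ha hb hab), fun hT a b hab ↦ ?_⟩,
    fun hT a b ha hb hab ↦ hT a b (h a b ha.isSelfAdjoint hb.isSelfAdjoint hab),
    fun hT a b hab ↦ orth_map_of_nonneg T hT hab⟩
  exact orth_map_of_nonneg T
    (fun x y hx hy hxy ↦ hT x y hx.isSelfAdjoint hy.isSelfAdjoint hxy) hab
end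
end

section
/- Let A and B be C*-algebras and let T : A → B be a bijective bounded linear map. The following are equivalent: (a) T is orthogonality preserving; (b) T is biorthogonality preserving, i.e., a ⊥ b if and only if T(a) ⊥ T(b), for all a, b ∈ A; (c) T preserves orthogonality on self-adjoint elements (for self-adjoint a, b with a b = 0, T(a) ⊥ T(b)); (d) T preserves orthogonality on positive elements (for positive a, b with a b = 0, T(a) ⊥ T(b)); (e) T preserves zero triple products, i.e., {a,b,c} = 0 implies {T(a),T(b),T(c)} = 0 for all a,b,c ∈ A; (f) T preserves zero triple products in both directions, i.e., {a,b,c} = 0 if and only if {T(a),T(b),T(c)} = 0. -/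
noncomputable section

open CStar

open ContinuousMap TensorProduct Filter Topology

/-- The inclusion of real-valued continuous functions in complex-valued ones. -/
abbrev CStar.ofRealC (X : Type*) [TopologicalSpace X] [CompactSpace X] : C(X, ℝ) →L[ℝ] C(X, ℂ) :=
  Complex.ofRealCLM.compLeftContinuous ℝ X

namespace CStar

section Ideal
variable {R E : Type*} [CommRing R] [Algebra ℂ R] [NormedAddCommGroup E] [NormedSpace ℂ E]

/-- The largest ideal contained in the kernel of a linear map. -/
def kernelIdeal (β : R →ₗ[ℂ] E) : Ideal R where
  carrier := {w | ∀ t, β (t * w) = 0}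
  add_mem' ha hb t := by rw [mul_add, map_add, ha, hb, add_zero]
  zero_mem' t := by simp
  smul_mem' r w hw t := by rw [smul_eq_mul, ← mul_assoc]; exact hw _

lemma eq_zero_of_norm_add_nsmul_le {a b : E} {C : ℝ} (h : ∀ n : ℕ, ‖a + n • b‖ ≤ C) : b = 0 := by
  by_contra hb
  have hb' : 0 < ‖b‖ := norm_pos_iff.mpr hb
  obtain ⟨n, hn⟩ := exists_nat_gt ((C + ‖a‖) / ‖b‖)
  rw [div_lt_iff₀ hb'] at hn
  have h1 : ‖n • b‖ ≤ ‖a + n • b‖ + ‖a‖ := by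
    simpa using norm_sub_le (a + n • b) a
  rw [RCLike.norm_nsmul ℂ, nsmul_eq_mul] at h1
  linarith [h n]

lemma mem_kernelIdeal_of_sq_mem {β : R →ₗ[ℂ] E} {w : R} (hw : w ^ 2 ∈ kernelIdeal β)
    (hbdd : ∀ t, ∃ C : ℝ, ∀ n : ℕ, ‖β (t * (1 + w) ^ n)‖ ≤ C) : w ∈ kernelIdeal β := by
  intro t
  obtain ⟨C, hC⟩ := hbdd t
  refine eq_zero_of_norm_add_nsmul_le (a := β t) (C := C) fun n ↦ ?_
  have h : (1 + w) ^ n - (1 + n • w) ∈ kernelIdeal β := by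
    induction n with
    | zero => simp
    | succ n ih =>
      have : (1 + w) ^ (n + 1) - (1 + (n + 1) • w) =
          (1 + w) * ((1 + w) ^ n - (1 + n • w)) + n * w ^ 2 := by
        simp only [nsmul_eq_mul]; push_cast; ring
      rw [this]
      exact add_mem (Ideal.mul_mem_left _ _ ih) (Ideal.mul_mem_left _ _ hw)
  have h' := h t
  rw [mul_sub, map_sub, sub_eq_zero, mul_add, map_add, mul_one, mul_smul_comm, map_nsmul] at h'
  rw [← h']
  exact hC n

lemma mem_kernelIdeal_of_cube_mem {β : R →ₗ[ℂ] E} {w : R} (hw : w ^ 3 ∈ kernelIdeal β)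
    (hbdd : ∀ t, ∃ C : ℝ, ∀ n : ℕ, ‖β (t * (1 + w) ^ n)‖ ≤ C) : w ∈ kernelIdeal β := by
  refine mem_kernelIdeal_of_sq_mem (fun t ↦ ?_) hbdd
  have : w ∈ kernelIdeal (β ∘ₗ LinearMap.mulLeft ℂ w) := by
    refine mem_kernelIdeal_of_sq_mem (fun t ↦ ?_) fun t ↦ ?_
    · simpa [mul_left_comm, pow_succ, mul_assoc] using hw t
    · simpa [mul_assoc] using hbdd (w * t)
  simpa [mul_left_comm, pow_succ] using this t

lemma add_I_mul_cube_mem {S : Ideal R} {a b : R} (ha : a ^ 3 ∈ S) (hb : b ^ 3 ∈ S)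
    (hadd : (a + b) ^ 3 ∈ S) (hsub : (a - b) ^ 3 ∈ S) :
    (a + algebraMap ℂ R Complex.I * b) ^ 3 ∈ S := by
  obtain ⟨i, hi⟩ : ∃ i, i = algebraMap ℂ R Complex.I := ⟨_, rfl⟩
  obtain ⟨h, hh⟩ : ∃ h, h = algebraMap ℂ R 2⁻¹ := ⟨_, rfl⟩
  have hI : i ^ 2 = -1 := by rw [hi, ← map_pow, Complex.I_sq, map_neg, map_one]
  have hh : h * 2 = 1 := by
    rw [hh, ← map_ofNat (algebraMap ℂ R) 2, ← map_mul, inv_mul_cancel₀ two_ne_zero, map_one]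
  rw [← hi]
  have : (a + i * b) ^ 3 = 2 * a ^ 3 + (-2 * i) * b ^ 3 + (h * (i - 1)) * (a + b) ^ 3
      + (-h * (i + 1)) * (a - b) ^ 3 := by
    linear_combination (3 * a * b ^ 2 + i * b ^ 3) * hI + (a ^ 3 + 3 * a * b ^ 2
      - 3 * i * a ^ 2 * b - i * b ^ 3) * hh
  rw [this]
  exact add_mem (add_mem (add_mem (S.mul_mem_left _ ha) (S.mul_mem_left _ hb))
    (S.mul_mem_left _ hadd)) (S.mul_mem_left _ hsub)

omit [Algebra ℂ R] in
lemma mul_cube_mem {S : Ideal R} {a b : R} (ha : a ^ 3 ∈ S) : (a * b) ^ 3 ∈ S := by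
  rw [mul_pow]
  exact S.mul_mem_right _ ha

end Ideal

section CompactSpace
variable {X : Type*} [TopologicalSpace X] [CompactSpace X]

lemma ofRealC_mul (f g : C(X, ℝ)) : ofRealC X (f * g) = ofRealC X f * ofRealC X g := by
  ext x; simp

lemma ofRealC_pow (f : C(X, ℝ)) (n : ℕ) : ofRealC X (f ^ n) = ofRealC X f ^ n := by
  ext x; simp

/-- The truncation `max (f - s) 0`. -/
def truncation (f : C(X, ℝ)) (s : ℝ) : C(X, ℝ) where
  toFun x := max (f x - s) 0

omit [CompactSpace X] in
lemma truncation_mul_truncation (f : C(X, ℝ)) (s : ℝ) :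
    truncation f s * truncation f s = (f - algebraMap ℝ _ s) * truncation f s := by
  ext x
  simp only [truncation, ContinuousMap.mul_apply, ContinuousMap.coe_mk, ContinuousMap.sub_apply,
    _root_.algebraMap_apply, smul_eq_mul, mul_one]
  rcases max_cases (f x - s) 0 with h | h <;> simp [h.1]

omit [CompactSpace X] in
lemma truncation_mul_sub (f : C(X, ℝ)) (s : ℝ) :
    truncation f s * (truncation f s - (f - algebraMap ℝ _ s)) = 0 := by
  rw [mul_sub, truncation_mul_truncation]; ring

lemma hasDerivAt_truncation_sq (f : C(X, ℝ)) (s : ℝ) :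
    HasDerivAt (fun s ↦ truncation f s * truncation f s) ((-2 : ℝ) • truncation f s) s := by
  rw [hasDerivAt_iff_isLittleO_nhds_zero]
  refine Asymptotics.IsBigO.trans_isLittleO (g := fun h : ℝ ↦ h ^ 2) ?_ ?_
  · refine Asymptotics.IsBigO.of_bound 1 (Filter.Eventually.of_forall fun h ↦ ?_)
    rw [ContinuousMap.norm_le _ (by positivity)]
    intro x
    simp only [truncation, ContinuousMap.sub_apply, ContinuousMap.mul_apply, ContinuousMap.coe_mk,
      ContinuousMap.smul_apply, smul_eq_mul, Real.norm_eq_abs, abs_pow, one_mul, sq_abs]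
    rw [abs_le]
    rcases max_cases (f x - s) 0 with h1 | h1 <;>
      rcases max_cases (f x - (s + h)) 0 with h2 | h2 <;>
      rw [h1.1, h2.1] <;> constructor <;> nlinarith [h1.2, h2.2]
  · exact Asymptotics.isLittleO_pow_id (by norm_num)

lemma hasDerivAt_truncation_cube (f : C(X, ℝ)) (s : ℝ) :
    HasDerivAt (fun s ↦ (f - algebraMap ℝ _ s) * (truncation f s * truncation f s))
      ((-3 : ℝ) • (truncation f s * truncation f s)) s := by
  have h1 : HasDerivAt (fun s : ℝ ↦ f - algebraMap ℝ C(X, ℝ) s) (-1) s := by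
    have := ((Algebra.linearMap ℝ C(X, ℝ)).toContinuousLinearMap.hasFDerivAt (x := s)).hasDerivAt
    simpa [Algebra.algebraMap_eq_smul_one] using this.const_sub f
  refine (h1.mul (hasDerivAt_truncation_sq f s)).congr_deriv ?_
  rw [mul_smul_comm, ← truncation_mul_truncation, neg_one_mul]
  module

variable {E : Type*} [NormedAddCommGroup E] [NormedSpace ℂ E]
  (B : C(X, ℂ) →L[ℂ] C(X, ℂ) →L[ℂ] E)

lemma hasDerivAt_apply_mul_left {q : ℝ → C(X, ℝ)} {q' : C(X, ℝ)} {s : ℝ} (hq : HasDerivAt q q' s)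
    (g₁ g₂ : C(X, ℂ)) :
    HasDerivAt (fun s ↦ B (g₁ * ofRealC X (q s)) g₂) (B (g₁ * ofRealC X q') g₂) s :=
  (((B.flip g₂).restrictScalars ℝ ∘L ContinuousLinearMap.mul ℝ C(X, ℂ) g₁ ∘L
    ofRealC X).hasFDerivAt).comp_hasDerivAt s hq

lemma apply_cube_sub_eq_zero
    (hB : ∀ f g : C(X, ℝ), f * g = 0 → B (ofRealC X f) (ofRealC X g) = 0)
    (f : C(X, ℝ)) (g₁ g₂ : C(X, ℝ)) :
    B (ofRealC X (g₁ * f ^ 3)) (ofRealC X g₂)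
      - (3 : ℂ) • B (ofRealC X (g₁ * f ^ 2)) (ofRealC X (g₂ * f))
      + (3 : ℂ) • B (ofRealC X (g₁ * f)) (ofRealC X (g₂ * f ^ 2))
      - B (ofRealC X g₁) (ofRealC X (g₂ * f ^ 3)) = 0 := by
  let q (s : ℝ) : C(X, ℝ) := truncation f s * truncation f s
  let c (s : ℝ) : C(X, ℝ) := (f - algebraMap ℝ _ s) * q s
  let Ψ (s : ℝ) : E :=
    (2 : ℝ) • (B (ofRealC X g₁ * ofRealC X (c s)) (ofRealC X g₂)
      - B (ofRealC X g₁) (ofRealC X g₂ * ofRealC X (c s)))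
    + (3 : ℝ) • (B (ofRealC X g₁ * ofRealC X (q s)) (ofRealC X g₂ * ofRealC X f)
      - B (ofRealC X g₁ * ofRealC X f * ofRealC X (q s)) (ofRealC X g₂)
      + B (ofRealC X g₁) (ofRealC X g₂ * ofRealC X f * ofRealC X (q s))
      - B (ofRealC X g₁ * ofRealC X f) (ofRealC X g₂ * ofRealC X (q s)))
  have hΨ (s : ℝ) : HasDerivAt Ψ 0 s := by
    have hq := hasDerivAt_truncation_sq f s
    have hc := hasDerivAt_truncation_cube f s
    have key := (((hasDerivAt_apply_mul_left B hc (ofRealC X g₁) (ofRealC X g₂)).sub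
      (hasDerivAt_apply_mul_left B.flip hc (ofRealC X g₂) (ofRealC X g₁))).const_smul (2 : ℝ)).add
      (((((hasDerivAt_apply_mul_left B hq (ofRealC X g₁) (ofRealC X g₂ * ofRealC X f)).sub
      (hasDerivAt_apply_mul_left B hq (ofRealC X g₁ * ofRealC X f) (ofRealC X g₂))).add
      (hasDerivAt_apply_mul_left B.flip hq (ofRealC X g₂ * ofRealC X f) (ofRealC X g₁))).sub
      (hasDerivAt_apply_mul_left B.flip hq (ofRealC X g₂) (ofRealC X g₁ * ofRealC X f))).const_smul
      (3 : ℝ))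
    refine key.congr_deriv ?_
    have h0 := hB (g₁ * truncation f s) (g₂ * (truncation f s - (f - algebraMap ℝ _ s))) (by
      rw [mul_mul_mul_comm, truncation_mul_sub, mul_zero])
    have h1 := hB (g₁ * (truncation f s - (f - algebraMap ℝ _ s))) (g₂ * truncation f s) (by
      rw [mul_mul_mul_comm, mul_comm (truncation f s - _), truncation_mul_sub, mul_zero])
    rw [truncation_mul_truncation]
    simp only [ContinuousLinearMap.flip_apply, Algebra.algebraMap_eq_smul_one, mul_sub, sub_mul,
      mul_smul_comm, smul_mul_assoc, mul_one, one_mul, map_sub, map_smul,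
      ContinuousLinearMap.map_smul_of_tower, _root_.smul_apply, _root_.sub_apply, ← ofRealC_mul,
      smul_sub] at h0 h1 ⊢
    simp only [mul_comm _ f, mul_left_comm _ f, mul_assoc] at h0 h1 ⊢
    linear_combination (norm := module) (6 : ℝ) • h0 - (6 : ℝ) • h1
  have hconst := is_const_of_deriv_eq_zero (fun s ↦ (hΨ s).differentiableAt)
    (fun s ↦ (hΨ s).deriv) (-‖f‖) ‖f‖
  have hp : truncation f ‖f‖ = 0 := by
    ext x
    simpa [truncation] using (le_abs_self _).trans (f.norm_coe_le_norm x)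
  have hp' : truncation f (-‖f‖) = f - algebraMap ℝ _ (-‖f‖) := by
    ext x
    have := (neg_le_abs _).trans (f.norm_coe_le_norm x)
    simp [truncation]
    linarith
  simp only [Ψ, c, q, hp, hp'] at hconst
  generalize -‖f‖ = r at hconst
  simp only [mul_zero, map_zero, _root_.zero_apply, sub_zero, add_zero, smul_zero,
    Algebra.algebraMap_eq_smul_one, mul_sub, sub_mul,
    mul_smul_comm, smul_mul_assoc, mul_one, one_mul, map_sub, map_smul,
    ContinuousLinearMap.map_smul_of_tower, _root_.smul_apply, _root_.sub_apply, ← ofRealC_mul,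
    smul_sub] at hconst
  have h2 (g : C(X, ℝ)) : f * (f * g) = g * f ^ 2 := by ring
  have h3 (g : C(X, ℝ)) : f * (g * f ^ 2) = g * f ^ 3 := by ring
  simp only [mul_comm _ f, mul_left_comm _ f, h2, h3] at hconst
  simp only [mul_comm f] at hconst
  linear_combination (norm := module) (-1 : ℝ) • hconst

lemma exists_ofRealC_add_smul (g : C(X, ℂ)) :
    ∃ u v : C(X, ℝ), g = ofRealC X u + Complex.I • ofRealC X v :=
  ⟨Complex.reCLM.compLeftContinuous ℝ X g, Complex.imCLM.compLeftContinuous ℝ X g, by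
    ext x; simp [mul_comm Complex.I]⟩

/-- The linear map on the tensor product induced by a bounded bilinear map. -/
def tensorLift : C(X, ℂ) ⊗[ℂ] C(X, ℂ) →ₗ[ℂ] E := lift B.toLinearMap₁₂

omit [CompactSpace X] in
@[simp] lemma tensorLift_tmul (f g : C(X, ℂ)) : tensorLift B (f ⊗ₜ g) = B f g := rfl

/-- The universal commutator `f ⊗ 1 - 1 ⊗ f`. -/
def tensorSub (X : Type*) [TopologicalSpace X] [CompactSpace X] :
    C(X, ℂ) →ₗ[ℂ] C(X, ℂ) ⊗[ℂ] C(X, ℂ) :=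
  (TensorProduct.mk ℂ _ _).flip 1 - TensorProduct.mk ℂ _ _ 1

lemma tensorSub_apply (f : C(X, ℂ)) : tensorSub X f = f ⊗ₜ 1 - 1 ⊗ₜ f := rfl

variable {B}

lemma tensorSub_ofRealC_cube_mem
    (hB : ∀ f g : C(X, ℝ), f * g = 0 → B (ofRealC X f) (ofRealC X g) = 0) (f : C(X, ℝ)) :
    tensorSub X (ofRealC X f) ^ 3 ∈ kernelIdeal (tensorLift B) := by
  have key (g₁ g₂ : C(X, ℝ)) :
      tensorLift B ((ofRealC X g₁ ⊗ₜ ofRealC X g₂) * tensorSub X (ofRealC X f) ^ 3) = 0 := by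
    have h : (ofRealC X g₁ ⊗ₜ[ℂ] ofRealC X g₂) * tensorSub X (ofRealC X f) ^ 3 =
        ofRealC X (g₁ * f ^ 3) ⊗ₜ ofRealC X g₂
        - (3 : ℂ) • ofRealC X (g₁ * f ^ 2) ⊗ₜ ofRealC X (g₂ * f)
        + (3 : ℂ) • ofRealC X (g₁ * f) ⊗ₜ ofRealC X (g₂ * f ^ 2)
        - ofRealC X g₁ ⊗ₜ ofRealC X (g₂ * f ^ 3) := by
      have hmul (u v : C(X, ℂ)) : (ofRealC X g₁ * u) ⊗ₜ[ℂ] (ofRealC X g₂ * v) =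
          (ofRealC X g₁ ⊗ₜ ofRealC X g₂) * (u ⊗ₜ 1) * (1 ⊗ₜ v) := by simp
      have h₁ := hmul (ofRealC X f ^ 3) 1
      have h₂ := hmul (ofRealC X f ^ 2) (ofRealC X f)
      have h₃ := hmul (ofRealC X f) (ofRealC X f ^ 2)
      have h₄ := hmul 1 (ofRealC X f ^ 3)
      have hl (n : ℕ) : (ofRealC X f ^ n) ⊗ₜ[ℂ] (1 : C(X, ℂ)) = (ofRealC X f ⊗ₜ 1) ^ n := by simp
      have hr (n : ℕ) : (1 : C(X, ℂ)) ⊗ₜ[ℂ] (ofRealC X f ^ n) = (1 ⊗ₜ ofRealC X f) ^ n := by simp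
      rw [mul_one] at h₁ h₄
      rw [ofRealC_mul, ofRealC_mul, ofRealC_mul, ofRealC_mul, ofRealC_mul, ofRealC_mul, ofRealC_pow,
        ofRealC_pow, h₁, h₂, h₃, h₄, hl, hl, hr, hr, ← Algebra.TensorProduct.one_def,
        tensorSub_apply, ofNat_smul_eq_nsmul, nsmul_eq_mul, ofNat_smul_eq_nsmul, nsmul_eq_mul]
      push_cast
      ring
    rw [h, map_sub, map_add, map_sub, map_smul, map_smul]
    exact apply_cube_sub_eq_zero B hB f g₁ g₂
  intro t
  induction t with
  | zero => simp
  | add s t hs ht => rw [add_mul, map_add, hs, ht, add_zero]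
  | tmul g₁ g₂ =>
    obtain ⟨u₁, v₁, rfl⟩ := exists_ofRealC_add_smul g₁
    obtain ⟨u₂, v₂, rfl⟩ := exists_ofRealC_add_smul g₂
    simp only [add_tmul, tmul_add, ← smul_tmul', tmul_smul, add_mul, map_add, smul_mul_assoc,
      map_smul, key, smul_zero, add_zero]

lemma tensorSub_mem_of_star_mul_self
    (hB : ∀ f g : C(X, ℝ), f * g = 0 → B (ofRealC X f) (ofRealC X g) = 0) {u : C(X, ℂ)}
    (hu : star u * u = 1) : tensorSub X u ∈ kernelIdeal (tensorLift B) := by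
  have hu' : u * star u = 1 := by rw [mul_comm, hu]
  have hcube : tensorSub X u ^ 3 ∈ kernelIdeal (tensorLift B) := by
    obtain ⟨c, s, rfl⟩ := exists_ofRealC_add_smul u
    have hadd := tensorSub_ofRealC_cube_mem hB (c + s)
    have hsub := tensorSub_ofRealC_cube_mem hB (c - s)
    rw [map_add, map_add] at hadd
    rw [map_sub, map_sub] at hsub
    rw [map_add, map_smul, ← algebraMap_smul (C(X, ℂ) ⊗[ℂ] C(X, ℂ)), smul_eq_mul]
    exact add_I_mul_cube_mem (tensorSub_ofRealC_cube_mem hB c) (tensorSub_ofRealC_cube_mem hB s)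
      hadd hsub
  have hnorm {v : C(X, ℂ)} (hv : star v * v = 1) (n : ℕ) : ‖v ^ n‖ ≤ 1 := by
    rw [ContinuousMap.norm_le _ zero_le_one]
    intro x
    have := congr($hv x)
    simp only [ContinuousMap.mul_apply, ContinuousMap.star_apply, ContinuousMap.one_apply] at this
    have h1 : ‖v x‖ * ‖v x‖ = 1 := by rw [← CStarRing.norm_star_mul_self, this, norm_one]
    have h2 : ‖v x‖ = 1 := by nlinarith [norm_nonneg (v x)]
    simp [h2]
  have hw : tensorSub X u * 1 ⊗ₜ star u ∈ kernelIdeal (tensorLift B) := by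
    refine mem_kernelIdeal_of_cube_mem ?_ fun t ↦ ?_
    · exact mul_cube_mem hcube
    · have h1 : 1 + tensorSub X u * 1 ⊗ₜ star u = u ⊗ₜ star u := by
        rw [tensorSub_apply, sub_mul, Algebra.TensorProduct.tmul_mul_tmul,
          Algebra.TensorProduct.tmul_mul_tmul, hu', Algebra.TensorProduct.one_def]
        simp
      rw [h1]
      induction t with
      | zero => exact ⟨0, by simp⟩
      | add s t hs ht =>
        obtain ⟨C, hC⟩ := hs
        obtain ⟨D, hD⟩ := ht
        refine ⟨C + D, fun n ↦ ?_⟩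
        rw [add_mul, map_add]
        exact (norm_add_le _ _).trans (add_le_add (hC n) (hD n))
      | tmul g₁ g₂ =>
        refine ⟨‖B‖ * (‖g₁‖ * 1) * (‖g₂‖ * 1), fun n ↦ ?_⟩
        rw [Algebra.TensorProduct.tmul_pow, Algebra.TensorProduct.tmul_mul_tmul, tensorLift_tmul]
        refine (B.le_opNorm₂ _ _).trans ?_
        have h1 := hnorm hu n
        have h2 := hnorm (v := star u) (by simpa) n
        gcongr
        · exact (norm_mul_le _ _).trans (by gcongr)
        · exact (norm_mul_le _ _).trans (by gcongr)
  have := Ideal.mul_mem_right ((1 : C(X, ℂ)) ⊗ₜ[ℂ] u) _ hw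
  rwa [mul_assoc, Algebra.TensorProduct.tmul_mul_tmul, hu, mul_one,
    ← Algebra.TensorProduct.one_def, mul_one] at this

/-- A bounded bilinear map on continuous functions which vanishes on pairs with zero product is
balanced. -/
lemma apply_mul_eq_apply_mul
    (hB : ∀ f g : C(X, ℝ), f * g = 0 → B (ofRealC X f) (ofRealC X g) = 0)
    (f : C(X, ℝ)) (g₁ g₂ : C(X, ℂ)) :
    B (ofRealC X f * g₁) g₂ = B g₁ (ofRealC X f * g₂) := by
  have hunit (k : C(X, ℝ)) (hk : ‖k‖ ≤ 1) :
      tensorSub X (ofRealC X k) ∈ kernelIdeal (tensorLift B) := by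
    have hk' (x : X) : k x ^ 2 ≤ 1 := by
      rw [sq_le_one_iff_abs_le_one]; exact (k.norm_coe_le_norm x).trans hk
    let r : C(X, ℝ) := ⟨fun x ↦ √(1 - k x ^ 2), by fun_prop⟩
    let u : C(X, ℂ) := ofRealC X k + Complex.I • ofRealC X r
    have hu : star u * u = 1 := by
      ext x
      have : ((√(1 - k x ^ 2) : ℝ) : ℂ) ^ 2 = 1 - (k x : ℂ) ^ 2 := by
        rw [← Complex.ofReal_pow, Real.sq_sqrt (by linarith [hk' x])]; simp
      simp [u, r]
      linear_combination this - ((√(1 - k x ^ 2) : ℝ) : ℂ) ^ 2 * Complex.I_sq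
    have hk2 : ofRealC X k = (2⁻¹ : ℂ) • (u + star u) := by
      ext x
      simp [u]
      ring
    rw [hk2, map_smul, map_add, ← algebraMap_smul (C(X, ℂ) ⊗[ℂ] C(X, ℂ)), smul_eq_mul]
    refine Ideal.mul_mem_left _ _ (add_mem (tensorSub_mem_of_star_mul_self hB hu)
      (tensorSub_mem_of_star_mul_self hB ?_))
    rwa [star_star, mul_comm]
  have hf : tensorSub X (ofRealC X f) ∈ kernelIdeal (tensorLift B) := by
    have hpos : 0 < ‖f‖ + 1 := by positivity
    have h1 : ofRealC X f = ((‖f‖ + 1 : ℝ) : ℂ) • ofRealC X ((‖f‖ + 1)⁻¹ • f) := by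
      ext x
      have : ((‖f‖ + 1 : ℝ) : ℂ) ≠ 0 := by exact_mod_cast hpos.ne'
      simp only [map_smul, ContinuousMap.smul_apply, smul_eq_mul, Complex.real_smul]
      push_cast at this ⊢
      field_simp
    rw [h1, map_smul, ← algebraMap_smul (C(X, ℂ) ⊗[ℂ] C(X, ℂ)), smul_eq_mul]
    refine Ideal.mul_mem_left _ _ (hunit _ ?_)
    rw [norm_smul, norm_inv, Real.norm_of_nonneg hpos.le, inv_mul_le_one₀ hpos]
    linarith
  have := hf (g₁ ⊗ₜ g₂)
  rwa [tensorSub_apply, mul_sub, map_sub, Algebra.TensorProduct.tmul_mul_tmul,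
    Algebra.TensorProduct.tmul_mul_tmul, tensorLift_tmul, tensorLift_tmul, sub_eq_zero, mul_one,
    mul_one, mul_comm g₁, mul_comm g₂] at this

end CompactSpace

open ContinuousMapZero in
/-- Multiplication by the identity, as a map into the functions vanishing at `0`. -/
def mulId (s : Set ℂ) [Fact (0 ∈ s)] [CompactSpace s] : C(s, ℂ) →L[ℂ] C(s, ℂ)₀ where
  toFun f := ⟨(ContinuousMapZero.id s : C(s, ℂ)) * f, by simp; exact .inl rfl⟩
  map_add' f g := by ext x; exact mul_add (x : ℂ) (f x) (g x)
  map_smul' c f := by ext x; exact mul_smul_comm c (x : ℂ) (f x)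
  cont := by
    rw [ContinuousMapZero.isEmbedding_toContinuousMap.continuous_iff]
    exact continuous_const.mul continuous_id

section Bilinear
variable {A E : Type*} [NonUnitalCStarAlgebra A] [NormedAddCommGroup E] [NormedSpace ℂ E]

/-- The functional calculus `f ↦ a f(a)`. -/
def cfcMulSelf {a : A} (ha : IsStarNormal a) : C(quasispectrum ℂ a, ℂ) →L[ℂ] A :=
  cfcₙL ha ∘L mulId (quasispectrum ℂ a)

lemma cfcMulSelf_apply {a : A} (ha : IsStarNormal a) (f : C(quasispectrum ℂ a, ℂ)) :
    cfcMulSelf ha f = cfcₙHom ha (mulId _ f) := rfl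

lemma cfcMulSelf_one {a : A} (ha : IsStarNormal a) : cfcMulSelf ha 1 = a := by
  rw [cfcMulSelf_apply]
  convert cfcₙHom_id (R := ℂ) ha
  ext x; exact mul_one _

lemma cfcMulSelf_mul_self {a : A} (ha : IsStarNormal a) (f : C(quasispectrum ℂ a, ℂ)) :
    cfcMulSelf ha (ContinuousMapZero.id (quasispectrum ℂ a) * f) = a * cfcMulSelf ha f := by
  rw [cfcMulSelf_apply, cfcMulSelf_apply]
  conv_rhs => enter [1]; rw [← cfcₙHom_id (R := ℂ) ha]
  rw [← map_mul]
  rfl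

lemma cfcMulSelf_mul_cfcMulSelf {a : A} (ha : IsStarNormal a)
    {f g : C(quasispectrum ℂ a, ℂ)} (hfg : f * g = 0) :
    cfcMulSelf ha f * cfcMulSelf ha g = 0 := by
  rw [cfcMulSelf_apply, cfcMulSelf_apply, ← map_mul]
  convert map_zero (cfcₙHom (R := ℂ) ha)
  ext x
  have : f x * g x = 0 := congr($hfg x)
  change (_ * f x) * (_ * g x) = 0
  rw [mul_mul_mul_comm, this, mul_zero]

lemma ofReal_re_of_mem_quasispectrum {a : A} (ha : IsSelfAdjoint a) {z : ℂ}
    (hz : z ∈ quasispectrum ℂ a) : ((z.re : ℝ) : ℂ) = z :=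
  ha.quasispectrumRestricts.rightInvOn hz

lemma isSelfAdjoint_cfcMulSelf {a : A} (ha : IsSelfAdjoint a) (f : C(quasispectrum ℂ a, ℝ)) :
    IsSelfAdjoint (cfcMulSelf ha.isStarNormal (ofRealC _ f)) := by
  rw [cfcMulSelf_apply]
  refine IsSelfAdjoint.map ?_ _
  ext x
  change star ((x : ℂ) * (f x : ℂ)) = (x : ℂ) * (f x : ℂ)
  rw [← ofReal_re_of_mem_quasispectrum ha x.2, star_mul', Complex.star_def, Complex.conj_ofReal,
    Complex.conj_ofReal]

variable [PartialOrder A] [StarOrderedRing A] {F : A →L[ℂ] A →L[ℂ] E}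

omit [PartialOrder A] [StarOrderedRing A] in
lemma mul_eq_zero_of_mul_self_mul {p b : A} (hp : IsSelfAdjoint p) (h : p * p * b = 0) :
    p * b = 0 := by
  rw [← CStarRing.star_mul_self_eq_zero_iff, star_mul, hp.star_eq, mul_assoc, ← mul_assoc p, h,
    mul_zero]

lemma posPart_mul_eq_zero {a b : A} (ha : IsSelfAdjoint a) (h : a * b = 0) : a⁺ * b = 0 := by
  refine mul_eq_zero_of_mul_self_mul (CFC.posPart_nonneg a).isSelfAdjoint ?_
  have : a⁺ * a = a⁺ * a⁺ := by
    nth_rw 2 [← CFC.posPart_sub_negPart a]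
    rw [mul_sub, CFC.posPart_mul_negPart, sub_zero]
  rw [← this, mul_assoc, h, mul_zero]

lemma negPart_mul_eq_zero {a b : A} (ha : IsSelfAdjoint a) (h : a * b = 0) : a⁻ * b = 0 := by
  rw [← CFC.posPart_neg]
  exact posPart_mul_eq_zero ha.neg (by rw [neg_mul, h, neg_zero])

lemma apply_eq_zero_of_isSelfAdjoint (hF : ∀ a b : A, 0 ≤ a → 0 ≤ b → a * b = 0 → F a b = 0)
    {a b : A} (ha : IsSelfAdjoint a) (hb : IsSelfAdjoint b) (hab : a * b = 0) : F a b = 0 := by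
  have key {p : A} (hp : 0 ≤ p) (h : p * b = 0) : F p b = 0 := by
    have h' : b * p = 0 := by
      simpa [hb.star_eq, hp.isSelfAdjoint.star_eq] using congr(star $h)
    have h1 := posPart_mul_eq_zero hb h'
    have h2 := negPart_mul_eq_zero hb h'
    have h1' : p * b⁺ = 0 := by
      simpa [(CFC.posPart_nonneg b).isSelfAdjoint.star_eq, hp.isSelfAdjoint.star_eq]
        using congr(star $h1)
    have h2' : p * b⁻ = 0 := by
      simpa [(CFC.negPart_nonneg b).isSelfAdjoint.star_eq, hp.isSelfAdjoint.star_eq]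
        using congr(star $h2)
    rw [← CFC.posPart_sub_negPart b, map_sub, hF _ _ hp (CFC.posPart_nonneg b) h1',
      hF _ _ hp (CFC.negPart_nonneg b) h2', sub_zero]
  rw [← CFC.posPart_sub_negPart a, map_sub, _root_.sub_apply,
    key (CFC.posPart_nonneg a) (posPart_mul_eq_zero ha hab),
    key (CFC.negPart_nonneg a) (negPart_mul_eq_zero ha hab), sub_zero]

lemma apply_cfcMulSelf (hF : ∀ a b : A, 0 ≤ a → 0 ≤ b → a * b = 0 → F a b = 0) {a : A}
    (ha : IsSelfAdjoint a) (f g : C(quasispectrum ℂ a, ℂ)) :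
    F (a * cfcMulSelf ha.isStarNormal f) (cfcMulSelf ha.isStarNormal g) =
      F (cfcMulSelf ha.isStarNormal f) (a * cfcMulSelf ha.isStarNormal g) := by
  let Θ := cfcMulSelf ha.isStarNormal
  let B : C(quasispectrum ℂ a, ℂ) →L[ℂ] C(quasispectrum ℂ a, ℂ) →L[ℂ] E := F.bilinearComp Θ Θ
  have hid : (ContinuousMapZero.id (quasispectrum ℂ a) : C(quasispectrum ℂ a, ℂ)) =
      ofRealC _ (Complex.reCLM.compLeftContinuous ℝ _
        (ContinuousMapZero.id (quasispectrum ℂ a) : C(quasispectrum ℂ a, ℂ))) := by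
    ext x
    exact (ofReal_re_of_mem_quasispectrum ha x.2).symm
  rw [← cfcMulSelf_mul_self, ← cfcMulSelf_mul_self, hid]
  refine apply_mul_eq_apply_mul (B := B) (fun f g hfg ↦ ?_) _ f g
  refine apply_eq_zero_of_isSelfAdjoint hF (isSelfAdjoint_cfcMulSelf ha f)
    (isSelfAdjoint_cfcMulSelf ha g) (cfcMulSelf_mul_cfcMulSelf _ ?_)
  rw [← ofRealC_mul, hfg, map_zero]

lemma apply_sq_self (hF : ∀ a b : A, 0 ≤ a → 0 ≤ b → a * b = 0 → F a b = 0) {a : A}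
    (ha : IsSelfAdjoint a) : F (a * a) a = F a (a * a) := by
  simpa [cfcMulSelf_one] using apply_cfcMulSelf hF ha 1 1

lemma apply_cube_self (hF : ∀ a b : A, 0 ≤ a → 0 ≤ b → a * b = 0 → F a b = 0) {a : A}
    (ha : IsSelfAdjoint a) : F (a * (a * a)) a = F (a * a) (a * a) := by
  have := apply_cfcMulSelf hF ha (ContinuousMapZero.id (quasispectrum ℂ a) * 1) 1
  rwa [cfcMulSelf_mul_self, cfcMulSelf_one] at this

lemma induction_nonneg {p : A → Prop} (nonneg : ∀ a, 0 ≤ a → p a)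
    (add : ∀ a b, p a → p b → p (a + b)) (smul : ∀ (c : ℂ) a, p a → p (c • a)) (x : A) : p x := by
  have hx : x ∈ Submodule.span ℂ {a : A | 0 ≤ a} := by
    rw [CStarAlgebra.span_nonneg]; trivial
  induction hx using Submodule.span_induction with
  | mem a ha => exact nonneg a ha
  | zero => exact nonneg 0 le_rfl
  | add a b _ _ ha hb => exact add a b ha hb
  | smul c a _ ha => exact smul c a ha

omit [PartialOrder A] [StarOrderedRing A] in
lemma isSelfAdjoint_add_real_smul {a u : A} (ha : IsSelfAdjoint a) (hu : IsSelfAdjoint u) (t : ℝ) :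
    IsSelfAdjoint (a + (t : ℂ) • u) := by
  refine ha.add (IsSelfAdjoint.smul ?_ hu)
  exact Complex.conj_ofReal t

lemma apply_sq_self_polar (hF : ∀ a b : A, 0 ≤ a → 0 ≤ b → a * b = 0 → F a b = 0) {a u : A}
    (ha : IsSelfAdjoint a) (hu : IsSelfAdjoint u) :
    F (a * u + u * a) a + F (a * a) u = F u (a * a) + F a (a * u + u * a) := by
  have h (t : ℝ) := apply_sq_self hF (isSelfAdjoint_add_real_smul ha hu t)
  have h1 := h 1
  have h2 := h (-1)
  have h3 := h 2
  have h4 := h (-2)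
  simp only [mul_add, add_mul, mul_smul_comm, smul_mul_assoc, map_add, map_smul,
    _root_.add_apply, _root_.smul_apply, Complex.ofReal_neg, Complex.ofReal_one,
    Complex.ofReal_ofNat] at h1 h2 h3 h4 ⊢
  linear_combination (norm := module) (8 / 12 : ℂ) • (h1 - h2) - (1 / 12 : ℂ) • (h3 - h4)

lemma apply_cube_self_polar (hF : ∀ a b : A, 0 ≤ a → 0 ≤ b → a * b = 0 → F a b = 0) {a u : A}
    (ha : IsSelfAdjoint a) (hu : IsSelfAdjoint u) :
    F (a * (a * u) + a * (u * a) + u * (a * a)) a + F (a * (a * a)) u =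
      F (a * a) (a * u + u * a) + F (a * u + u * a) (a * a) := by
  have h (t : ℝ) := apply_cube_self hF (isSelfAdjoint_add_real_smul ha hu t)
  have h1 := h 1
  have h2 := h (-1)
  have h3 := h 2
  have h4 := h (-2)
  simp only [mul_add, add_mul, mul_smul_comm, smul_mul_assoc, map_add, map_smul,
    _root_.add_apply, _root_.smul_apply, Complex.ofReal_neg, Complex.ofReal_one,
    Complex.ofReal_ofNat] at h1 h2 h3 h4 ⊢
  linear_combination (norm := module) (8 / 12 : ℂ) • (h1 - h2) - (1 / 12 : ℂ) • (h3 - h4)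

lemma tendsto_apply_cube (hF : ∀ a b : A, 0 ≤ a → 0 ≤ b → a * b = 0 → F a b = 0) {a : A}
    (ha : IsSelfAdjoint a) :
    Tendsto (fun u ↦ F (a * (a * a)) u) (CStarAlgebra.approximateUnit A) (𝓝 (F (a * a) a)) := by
  have hl := CStarAlgebra.increasingApproximateUnit A
  have h1 := hl.tendsto_mul_left a
  have h2 := hl.tendsto_mul_right a
  have h3 := (h1.add h2)
  have h4 := ((h1.const_mul a).add (h2.const_mul a)).add (hl.tendsto_mul_right (a * a))
  have h5 := ((((F (a * a)).continuous.tendsto _).comp h3).add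
    ((((F.flip (a * a)).continuous.tendsto _).comp h3))).sub
    ((((F.flip a).continuous.tendsto _).comp h4))
  refine (h5.congr' ?_).trans_eq ?_
  · filter_upwards [hl.eventually_isSelfAdjoint] with u hu
    exact sub_eq_of_eq_add' (apply_cube_self_polar hF ha hu).symm
  · congr 1
    simp only [map_add, ContinuousLinearMap.flip_apply, ← apply_sq_self hF ha]
    abel

lemma exists_tendsto_apply (hF : ∀ a b : A, 0 ≤ a → 0 ≤ b → a * b = 0 → F a b = 0) (x : A) :
    ∃ y, Tendsto (fun u ↦ F x u) (CStarAlgebra.approximateUnit A) (𝓝 y) := by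
  induction x using induction_nonneg with
  | nonneg x hx =>
    have h : (x ^ (3 : NNReal)⁻¹) * (x ^ (3 : NNReal)⁻¹ * x ^ (3 : NNReal)⁻¹) = x := by
      rw [← mul_assoc, ← CFC.nnrpow_three _ CFC.nnrpow_nonneg,
        CFC.nnrpow_inv_nnrpow x (by norm_num) hx]
    rw [← h]
    exact ⟨_, tendsto_apply_cube hF (CFC.nnrpow_nonneg).isSelfAdjoint⟩
  | add x y hx hy =>
    obtain ⟨v, hv⟩ := hx
    obtain ⟨w, hw⟩ := hy
    exact ⟨v + w, by simpa using hv.add hw⟩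
  | smul c x hx =>
    obtain ⟨v, hv⟩ := hx
    exact ⟨c • v, by simpa using hv.const_smul c⟩

/-- A pointwise limit of `u ↦ F x u` along the approximate unit is a bounded operator in `x`. -/
lemma exists_clm_tendsto_apply
    (h : ∀ x, ∃ y, Tendsto (fun u ↦ F x u) (CStarAlgebra.approximateUnit A) (𝓝 y)) :
    ∃ M : A →L[ℂ] E, ∀ x, Tendsto (fun u ↦ F x u) (CStarAlgebra.approximateUnit A) (𝓝 (M x)) := by
  choose M hM using h
  have hl := CStarAlgebra.increasingApproximateUnit A
  let M' : A →ₗ[ℂ] E :=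
    { toFun := M
      map_add' x y := tendsto_nhds_unique (hM _) (by simpa using (hM x).add (hM y))
      map_smul' c x := tendsto_nhds_unique (hM _) (by simpa using (hM x).const_smul c) }
  refine ⟨M'.mkContinuous ‖F‖ fun x ↦ le_of_tendsto (hM x).norm ?_, hM⟩
  filter_upwards [hl.eventually_norm] with u hu
  calc ‖F x u‖ ≤ ‖F‖ * ‖x‖ * ‖u‖ := F.le_opNorm₂ x u
    _ ≤ ‖F‖ * ‖x‖ * 1 := by gcongr
    _ = ‖F‖ * ‖x‖ := mul_one _

/-- A bounded bilinear map vanishing on pairs of positive elements with zero product has a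
symmetric part of the form `M (a b + b a)`, where `M` is obtained by evaluating along the
approximate unit. -/
theorem exists_clm_of_apply_eq_zero (hF : ∀ a b : A, 0 ≤ a → 0 ≤ b → a * b = 0 → F a b = 0) :
    ∃ M : A →L[ℂ] E,
      (∀ x, Tendsto (fun u ↦ F x u) (CStarAlgebra.approximateUnit A) (𝓝 (M x))) ∧
      (∀ x, Tendsto (fun u ↦ F u x) (CStarAlgebra.approximateUnit A) (𝓝 (M x))) ∧
      ∀ a b, M (a * b + b * a) = F a b + F b a := by
  obtain ⟨M, hM⟩ := exists_clm_tendsto_apply (exists_tendsto_apply hF)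
  have hl := CStarAlgebra.increasingApproximateUnit A
  have hcube {a : A} (ha : IsSelfAdjoint a) : M (a * (a * a)) = F (a * a) a :=
    tendsto_nhds_unique (hM _) (tendsto_apply_cube hF ha)
  have hpolar {a u : A} (ha : IsSelfAdjoint a) (hu : IsSelfAdjoint u) :
      M (a * (a * u) + a * (u * a) + u * (a * a)) = F (a * u + u * a) a + F (a * a) u := by
    have h (t : ℝ) := hcube (isSelfAdjoint_add_real_smul ha hu t)
    have h1 := h 1
    have h2 := h (-1)
    have h3 := h 2
    have h4 := h (-2)
    simp only [mul_add, add_mul, mul_smul_comm, smul_mul_assoc, map_add, map_smul,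
      _root_.add_apply, _root_.smul_apply, Complex.ofReal_neg, Complex.ofReal_one,
      Complex.ofReal_ofNat] at h1 h2 h3 h4 ⊢
    linear_combination (norm := module) (8 / 12 : ℂ) • (h1 - h2) - (1 / 12 : ℂ) • (h3 - h4)
  have hsum {a : A} := (hl.tendsto_mul_left a).add (hl.tendsto_mul_right a)
  have hsq {a : A} (ha : IsSelfAdjoint a) : M (a * a) = F a a := by
    have h1 := ((hl.tendsto_mul_left a).const_mul a).add ((hl.tendsto_mul_right a).const_mul a)
      |>.add (hl.tendsto_mul_right (a * a))
    have h2 := ((F.flip a).continuous.tendsto _).comp (hsum (a := a)) |>.add (hM (a * a))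
    have h3 := (M.continuous.tendsto _).comp h1
    have h4 := tendsto_nhds_unique (h3.congr' ?_) h2
    · simp only [map_add, ContinuousLinearMap.flip_apply] at h4
      linear_combination (norm := module) (2⁻¹ : ℂ) • h4
    · filter_upwards [hl.eventually_isSelfAdjoint] with u hu
      exact hpolar ha hu
  have hadd {a b : A} (ha : IsSelfAdjoint a) (hb : IsSelfAdjoint b) :
      M (a * b + b * a) = F a b + F b a := by
    have h1 := hsq (ha.add hb)
    simp only [mul_add, add_mul, map_add, _root_.add_apply] at h1 ⊢
    linear_combination (norm := module) h1 - hsq ha - hsq hb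
  refine ⟨M, hM, fun x ↦ ?_, fun a b ↦ ?_⟩
  · induction x using induction_nonneg with
    | nonneg x hx =>
      obtain ⟨a, ha, rfl⟩ : ∃ a, IsSelfAdjoint a ∧ a * a = x :=
        ⟨CFC.sqrt x, (CFC.sqrt_nonneg x).isSelfAdjoint, CFC.sqrt_mul_sqrt_self x hx⟩
      have h1 := ((F.flip a).continuous.tendsto _).comp (hsum (a := a)) |>.add (hM (a * a)) |>.sub
        (((F a).continuous.tendsto _).comp (hsum (a := a)))
      refine (h1.congr' ?_).trans_eq ?_
      · filter_upwards [hl.eventually_isSelfAdjoint] with u hu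
        exact sub_eq_of_eq_add (apply_sq_self_polar hF ha hu)
      · congr 1
        simp
    | add x y hx hy => simpa using hx.add hy
    | smul c x hx => simpa using hx.const_smul c
  · induction a using induction_nonneg with
    | nonneg a ha =>
      induction b using induction_nonneg with
      | nonneg b hb => exact hadd ha.isSelfAdjoint hb.isSelfAdjoint
      | add b c hb hc =>
        simp only [mul_add, add_mul, map_add, _root_.add_apply] at hb hc ⊢
        linear_combination (norm := module) hb + hc
      | smul c b hb =>
        simp only [mul_smul_comm, smul_mul_assoc, map_add, map_smul, _root_.smul_apply] at hb ⊢
        linear_combination (norm := module) c • hb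
    | add a c ha hc =>
      simp only [mul_add, add_mul, map_add, _root_.add_apply] at ha hc ⊢
      linear_combination (norm := module) ha + hc
    | smul c a ha =>
      simp only [mul_smul_comm, smul_mul_assoc, map_add, map_smul, _root_.smul_apply] at ha ⊢
      linear_combination (norm := module) c • ha

end Bilinear

lemma add_eq_zero_of_mul_star_add {R : Type*} [NonUnitalCStarAlgebra R] {x y : R}
    (h : x * star x + y * star y = 0) : x = 0 := by
  let _ := CStarAlgebra.spectralOrder R
  have := CStarAlgebra.spectralOrderedRing R
  rw [add_eq_zero_iff_of_nonneg (mul_star_self_nonneg x) (mul_star_self_nonneg y),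
    CStarRing.mul_star_self_eq_zero_iff] at h
  exact h.1

lemma star_mul_eq_zero_of_mul_star_mul {R : Type*} [NonUnitalCStarAlgebra R] {h x : R}
    (hx : h * star h * x = 0) : star h * x = 0 := by
  rw [← CStarRing.star_mul_self_eq_zero_iff, star_mul, star_star, mul_assoc, ← mul_assoc h, hx,
    mul_zero]

section Weighted
variable {A R : Type*} [NonUnitalRing A] [StarRing A] [CStarAlgebra R]

/-- An additive map `τ` into a C⋆-algebra which is, up to multiplication by a fixed element `h`,
a Jordan `*`-homomorphism. -/
structure IsWeightedJordan (τ : A →+ R) (h : R) : Prop where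
  apply_mul_star (x : A) : τ x * star h = h * star (τ (star x))
  star_mul_apply (x : A) : star h * τ x = star (τ (star x)) * h
  jordan_mul_star (a b : A) :
    τ (a * b + b * a) * star h = τ a * star (τ (star b)) + τ b * star (τ (star a))
  star_mul_jordan (a b : A) :
    star h * τ (a * b + b * a) = star (τ (star a)) * τ b + star (τ (star b)) * τ a

namespace IsWeightedJordan
variable {τ : A →+ R} {h : R} (H : IsWeightedJordan τ h)
include H

lemma mul_star_mul_comm (x : A) : h * star h * τ x = τ x * (star h * h) := by
  rw [mul_assoc, H.star_mul_apply, ← mul_assoc, ← H.apply_mul_star, mul_assoc]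

lemma mul_star_mul_jordan (a b : A) :
    h * star h * τ (a * b + b * a) = τ a * star h * τ b + τ b * star h * τ a := by
  rw [mul_assoc, H.star_mul_jordan, mul_add, ← mul_assoc, ← mul_assoc, ← H.apply_mul_star,
    ← H.apply_mul_star]

lemma mul_star_eq_zero {x : A} (hx : h * star h * τ x = 0) : τ x * star h = 0 := by
  rw [← CStarRing.mul_star_self_eq_zero_iff, star_mul, star_star, mul_assoc, ← mul_assoc (star h),
    ← mul_assoc, ← H.mul_star_mul_comm, hx, zero_mul]

lemma eq_zero_of_mul_eq_zero {x : A} (hx : h * star h * τ x = 0) : τ x = 0 := by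
  have h1 : h * star h * τ (x * star x + star x * x) = 0 := by
    rw [H.mul_star_mul_jordan, H.mul_star_eq_zero hx, mul_assoc,
      star_mul_eq_zero_of_mul_star_mul hx]
    simp
  have h2 := H.mul_star_eq_zero h1
  rw [H.jordan_mul_star, star_star] at h2
  exact add_eq_zero_of_mul_star_add h2

lemma mul_mul_jordan_jordan (a b c : A) :
    h * star h * (h * star h * τ ((a * b + b * a) * c + c * (a * b + b * a))) =
      (τ a * star h * τ b + τ b * star h * τ a) * star h * τ c +
      τ c * star h * (τ a * star h * τ b + τ b * star h * τ a) := by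
  rw [H.mul_star_mul_jordan, mul_add, ← H.mul_star_mul_jordan, ← mul_assoc, ← mul_assoc,
    ← mul_assoc (h * star h), ← mul_assoc (h * star h), H.mul_star_mul_comm c]
  simp only [mul_assoc]

lemma mul_mul_triple (a b c : A) :
    h * star h * (h * star h * τ (a * b * c + c * b * a)) =
      τ a * star h * τ b * star h * τ c + τ c * star h * τ b * star h * τ a := by
  have h1 := H.mul_mul_jordan_jordan a b c
  have h2 := H.mul_mul_jordan_jordan b c a
  have h3 := H.mul_mul_jordan_jordan a c b
  have h4 : (a * b * c + c * b * a) + (a * b * c + c * b * a) =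
      ((a * b + b * a) * c + c * (a * b + b * a)) + ((b * c + c * b) * a + a * (b * c + c * b))
      - ((a * c + c * a) * b + b * (a * c + c * a)) := by noncomm_ring
  have h5 : (2 : ℂ) • (h * star h * (h * star h * τ (a * b * c + c * b * a))) =
      (2 : ℂ) • (τ a * star h * τ b * star h * τ c + τ c * star h * τ b * star h * τ a) := by
    rw [two_smul, ← mul_add, ← mul_add, ← map_add, h4, map_sub, map_add, mul_sub, mul_add, mul_sub,
      mul_add, h1, h2, h3]
    simp only [mul_add, add_mul, mul_assoc]
    module
  exact smul_right_injective R (two_ne_zero (α := ℂ)) h5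

lemma triple_eq_zero_iff (hmul : ∀ a b, ∃ c, τ c = τ a * τ b) (hstar : ∀ a, ∃ c, τ c = star (τ a))
    (hinj : Function.Injective τ) (a b c : A) :
    a * star b * c + c * star b * a = 0 ↔
      τ a * star (τ b) * τ c + τ c * star (τ b) * τ a = 0 := by
  have hprod (a b c : A) : ∃ d, τ d = τ a * star (τ b) * τ c := by
    obtain ⟨b', hb⟩ := hstar b
    obtain ⟨d, hd⟩ := hmul a b'
    obtain ⟨e, he⟩ := hmul d c
    exact ⟨e, by rw [he, hd, hb]⟩
  have hterm (a b c : A) : τ a * star h * τ (star b) * star h * τ c =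
      h * star h * (τ a * star (τ b) * τ c) := by
    obtain ⟨d, hd⟩ := hprod a b c
    rw [← hd, H.mul_star_mul_comm, hd, mul_assoc (τ a), H.star_mul_apply, star_star,
      mul_assoc _ (τ c), ← H.mul_star_mul_comm]
    simp only [mul_assoc]
  have key := H.mul_mul_triple a (star b) c
  rw [hterm, hterm, ← mul_add] at key
  constructor
  · intro h0
    rw [h0, map_zero, mul_zero, mul_zero] at key
    obtain ⟨d, hd⟩ := hprod a b c
    obtain ⟨e, he⟩ := hprod c b a
    rw [← hd, ← he, ← map_add] at key ⊢
    exact H.eq_zero_of_mul_eq_zero key.symm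
  · intro h0
    rw [h0, mul_zero] at key
    have h1 : h * star h * τ (a * star b * c + c * star b * a) = 0 := by
      rw [← CStarRing.star_mul_self_eq_zero_iff, star_mul, star_mul h, star_star, mul_assoc, key,
        mul_zero]
    exact (map_eq_zero_iff τ hinj).mp (H.eq_zero_of_mul_eq_zero h1)

end IsWeightedJordan
end Weighted

section Multiplier
open scoped MultiplierAlgebra
variable {B : Type*} [NonUnitalCStarAlgebra B]

/-- A bounded net converging strictly converges to a multiplier. -/
lemma exists_multiplier_of_tendsto {ι : Type*} {l : Filter ι} [l.NeBot] {f : ι → B} {C : ℝ}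
    (hC : ∀ᶠ i in l, ‖f i‖ ≤ C) (hl : ∀ z, ∃ w, Tendsto (fun i ↦ f i * z) l (𝓝 w))
    (hr : ∀ z, ∃ w, Tendsto (fun i ↦ z * f i) l (𝓝 w)) :
    ∃ h : 𝓜(ℂ, B), (∀ z, Tendsto (fun i ↦ f i * z) l (𝓝 (h.fst z))) ∧
      ∀ z, Tendsto (fun i ↦ z * f i) l (𝓝 (h.snd z)) := by
  choose L hL using hl
  choose R hR using hr
  let L' : B →ₗ[ℂ] B :=
    { toFun := L
      map_add' x y := tendsto_nhds_unique (hL _) (by simpa [mul_add] using (hL x).add (hL y))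
      map_smul' c x := tendsto_nhds_unique (hL _)
        (by simpa [mul_smul_comm] using (hL x).const_smul c) }
  let R' : B →ₗ[ℂ] B :=
    { toFun := R
      map_add' x y := tendsto_nhds_unique (hR _) (by simpa [add_mul] using (hR x).add (hR y))
      map_smul' c x := tendsto_nhds_unique (hR _)
        (by simpa [smul_mul_assoc] using (hR x).const_smul c) }
  refine ⟨⟨(L'.mkContinuous C fun x ↦ le_of_tendsto (hL x).norm ?_,
    R'.mkContinuous C fun x ↦ le_of_tendsto (hR x).norm ?_), fun x y ↦
    tendsto_nhds_unique ((hR x).mul_const y) ?_⟩, hL, hR⟩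
  · filter_upwards [hC] with i hi
    exact (norm_mul_le _ _).trans (by gcongr)
  · filter_upwards [hC] with i hi
    rw [mul_comm C]
    exact (norm_mul_le _ _).trans (by gcongr)
  · exact ((hL y).const_mul x).congr fun i ↦ (mul_assoc _ _ _).symm

lemma eq_of_forall_mul_eq {x y : B} (h : ∀ v, v * x = v * y) : x = y := by
  rw [← sub_eq_zero, ← CStarRing.star_mul_self_eq_zero_iff, mul_sub, h, sub_self]

lemma eq_of_forall_eq_mul {x y : B} (h : ∀ v, x * v = y * v) : x = y := by
  rw [← sub_eq_zero, ← CStarRing.mul_star_self_eq_zero_iff, sub_mul, h, sub_self]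

/-- The inclusion of a C⋆-algebra in its multiplier algebra. -/
def toMultiplier (B : Type*) [NonUnitalCStarAlgebra B] : B →⋆ₙₐ[ℂ] 𝓜(ℂ, B) :=
  DoubleCentralizer.coeHom

lemma toMultiplier_injective : Function.Injective (toMultiplier B) := fun _ _ hxy ↦
  eq_of_forall_eq_mul fun v ↦ congr(($hxy).fst v)

lemma multiplier_mul_coe (h : 𝓜(ℂ, B)) (z : B) :
    h * toMultiplier B z = toMultiplier B (h.fst z) := by
  refine DoubleCentralizer.ext _ _ _ _ (Prod.ext ?_ ?_)
  · ext w
    refine eq_of_forall_mul_eq fun v ↦ ?_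
    change v * h.fst (z * w) = v * (h.fst z * w)
    rw [← h.central, ← mul_assoc, ← mul_assoc, h.central]
  · ext w
    exact h.central w z

lemma coe_mul_multiplier (h : 𝓜(ℂ, B)) (z : B) :
    toMultiplier B z * h = toMultiplier B (h.snd z) := by
  refine DoubleCentralizer.ext _ _ _ _ (Prod.ext ?_ ?_)
  · ext w
    exact (h.central z w).symm
  · ext w
    refine eq_of_forall_eq_mul fun v ↦ ?_
    change h.snd (w * z) * v = w * h.snd z * v
    rw [h.central, mul_assoc, mul_assoc, h.central]

variable {A : Type*} [NonUnitalCStarAlgebra A]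

/-- The map `x ↦ T(x*)*`. -/
def conjStar (T : A →L[ℂ] B) : A →L[ℂ] B :=
  ((starL ℂ : B ≃L⋆[ℂ] B) : B →L⋆[ℂ] B).comp (T.comp ((starL ℂ : A ≃L⋆[ℂ] A) : A →L⋆[ℂ] A))

lemma conjStar_apply (T : A →L[ℂ] B) (x : A) : conjStar T x = star (T (star x)) := rfl

theorem exists_isWeightedJordan [PartialOrder A] [StarOrderedRing A] {T : A →L[ℂ] B}
    (hT : Function.Surjective T)
    (hpos : ∀ a b : A, 0 ≤ a → 0 ≤ b → a * b = 0 → orth (T a) (T b)) :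
    ∃ h : 𝓜(ℂ, B), IsWeightedJordan ((toMultiplier B : B →+ 𝓜(ℂ, B)).comp (T : A →+ B)) h := by
  let T' := conjStar T
  have hl := CStarAlgebra.increasingApproximateUnit A
  have hstar (x : A) : star (T x) = T' (star x) := by rw [conjStar_apply, star_star]
  have hstar' (x : A) : star (T' x) = T (star x) := by rw [conjStar_apply, star_star]
  have hT' : Function.Surjective T' := fun z ↦ by
    obtain ⟨x, hx⟩ := hT (star z)
    exact ⟨star x, by rw [← hstar, hx, star_star]⟩
  obtain ⟨M₁, hM₁, hM₁', hM₁J⟩ := exists_clm_of_apply_eq_zero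
    (F := (ContinuousLinearMap.mul ℂ B).bilinearComp T T') fun a b ha hb hab ↦ by
      change T a * star (T (star b)) = 0
      rw [hb.isSelfAdjoint.star_eq]
      exact (hpos a b ha hb hab).1
  obtain ⟨M₂, hM₂, hM₂', hM₂J⟩ := exists_clm_of_apply_eq_zero
    (F := (ContinuousLinearMap.mul ℂ B).bilinearComp T' T) fun a b ha hb hab ↦ by
      change star (T (star a)) * T b = 0
      have hba : b * a = 0 := by
        simpa [ha.isSelfAdjoint.star_eq, hb.isSelfAdjoint.star_eq] using congr(star $hab)
      rw [ha.isSelfAdjoint.star_eq]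
      exact (hpos b a hb ha hba).2
  simp only [ContinuousLinearMap.bilinearComp_apply, ContinuousLinearMap.mul_apply'] at *
  obtain ⟨h, hh, hh'⟩ := exists_multiplier_of_tendsto (l := CStarAlgebra.approximateUnit A)
    (f := T) (C := ‖T‖)
    (by
      filter_upwards [hl.eventually_norm] with u hu
      simpa using T.le_opNorm_of_le hu)
    (fun z ↦ by obtain ⟨x, rfl⟩ := hT' z; exact ⟨_, hM₁' x⟩)
    (fun z ↦ by obtain ⟨x, rfl⟩ := hT' z; exact ⟨_, hM₂ x⟩)
  have hfst (x : A) : h.fst (T' x) = M₁ x := tendsto_nhds_unique (hh _) (hM₁' x)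
  have hsnd (x : A) : h.snd (T' x) = M₂ x := tendsto_nhds_unique (hh' _) (hM₂ x)
  have hM₁star (x : A) : star (M₁ (star x)) = M₁ x := by
    refine tendsto_nhds_unique ((hM₁ (star x)).star.congr' ?_) (hM₁' x)
    filter_upwards [hl.eventually_star_eq] with u hu
    rw [star_mul, hstar, hstar', star_star, hu]
  have hM₂star (x : A) : star (M₂ (star x)) = M₂ x := by
    refine tendsto_nhds_unique ((hM₂ (star x)).star.congr' ?_) (hM₂' x)
    filter_upwards [hl.eventually_star_eq] with u hu
    rw [star_mul, hstar, hstar', star_star, hu]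
  have h1 (x : A) : toMultiplier B (T x) * star h = toMultiplier B (M₁ x) := by
    rw [coe_mul_multiplier, DoubleCentralizer.star_snd, hstar, hfst, hM₁star]
  have h2 (x : A) : star h * toMultiplier B (T x) = toMultiplier B (M₂ x) := by
    rw [multiplier_mul_coe, DoubleCentralizer.star_fst, hstar, hsnd, hM₂star]
  have h3 (x : A) : star (toMultiplier B (T (star x))) = toMultiplier B (T' x) := by
    rw [← map_star, hstar, star_star]
  refine ⟨h, ⟨fun x ↦ ?_, fun x ↦ ?_, fun a b ↦ ?_, fun a b ↦ ?_⟩⟩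
  · change toMultiplier B (T x) * star h = h * star (toMultiplier B (T (star x)))
    rw [h1, h3, multiplier_mul_coe, hfst]
  · change star h * toMultiplier B (T x) = star (toMultiplier B (T (star x))) * h
    rw [h2, h3, coe_mul_multiplier, hsnd]
  · change toMultiplier B (T (a * b + b * a)) * star h =
      toMultiplier B (T a) * star (toMultiplier B (T (star b))) +
        toMultiplier B (T b) * star (toMultiplier B (T (star a)))
    rw [h1, h3, h3, hM₁J, map_add, map_mul, map_mul]
  · change star h * toMultiplier B (T (a * b + b * a)) =
      star (toMultiplier B (T (star a))) * toMultiplier B (T b) +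
        star (toMultiplier B (T (star b))) * toMultiplier B (T a)
    rw [h2, h3, h3, hM₂J, map_add, map_mul, map_mul]

end Multiplier

section Orthogonality
variable {A B : Type*} [NonUnitalCStarAlgebra A] [NonUnitalCStarAlgebra B]

lemma tp_eq_zero_iff {a b c : A} :
    tp a b c = 0 ↔ a * star b * c + c * star b * a = 0 := by
  rw [tp, smul_eq_zero_iff_right (inv_ne_zero two_ne_zero)]

lemma orth_iff_tp_eq_zero {a b : A} : orth a b ↔ tp a a b = 0 := by
  rw [tp_eq_zero_iff]
  constructor
  · rintro ⟨h1, h2⟩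
    have h1' : b * star a = 0 := by simpa using congr(star $h1)
    have h2' : star a * b = 0 := by simpa using congr(star $h2)
    rw [mul_assoc, h2', h1', mul_zero, zero_mul, add_zero]
  · intro h
    let _ := CStarAlgebra.spectralOrder A
    have := CStarAlgebra.spectralOrderedRing A
    have hneg : star (star a * b) * (star a * b) = -((star b * b) * (star a * a)) := by
      rw [eq_neg_iff_add_eq_zero]
      simpa [mul_add, mul_assoc] using congr(star b * $h)
    have hsa : (star b * b) * (star a * a) = (star a * a) * (star b * b) := by
      have := (IsSelfAdjoint.star_mul_self (star a * b)).star_eq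
      rw [hneg, star_neg, neg_inj] at this
      simpa [mul_assoc] using this.symm
    have hnonneg : 0 ≤ (star b * b) * (star a * a) :=
      Commute.mul_nonneg (star_mul_self_nonneg b) (star_mul_self_nonneg a) hsa
    have hab : star a * b = 0 := by
      rw [← CStarRing.star_mul_self_eq_zero_iff]
      refine le_antisymm ?_ (star_mul_self_nonneg _)
      rw [hneg]
      exact neg_nonpos.mpr hnonneg
    rw [mul_assoc, hab, mul_zero, zero_add] at h
    have hba : b * star a = 0 := by
      rw [← CStarRing.mul_star_self_eq_zero_iff]
      simp [← mul_assoc, h]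
    exact ⟨by simpa using congr(star $hba), by simpa using congr(star $hab)⟩

theorem tp_eq_zero_iff_of_orth [PartialOrder A] [StarOrderedRing A] {T : A →L[ℂ] B}
    (hT : Function.Bijective T)
    (hpos : ∀ a b : A, 0 ≤ a → 0 ≤ b → a * b = 0 → orth (T a) (T b)) (a b c : A) :
    tp a b c = 0 ↔ tp (T a) (T b) (T c) = 0 := by
  obtain ⟨h, H⟩ := exists_isWeightedJordan hT.surjective hpos
  have hinj : Function.Injective (toMultiplier B) := toMultiplier_injective
  rw [tp_eq_zero_iff, tp_eq_zero_iff,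
    H.triple_eq_zero_iff (fun a b ↦ ?_) (fun a ↦ ?_) (hinj.comp hT.injective), ← hinj.eq_iff]
  · simp [map_star]
  · obtain ⟨c, hc⟩ := hT.surjective (T a * T b)
    exact ⟨c, by simp [hc]⟩
  · obtain ⟨c, hc⟩ := hT.surjective (star (T a))
    exact ⟨c, by simp [hc, map_star]⟩

end Orthogonality
end CStar

/-- Characterizations of bijective bounded orthogonality preserving operators between
C*-algebras. -/
theorem bijective_op_tfae {A B : Type*} [NonUnitalCStarAlgebra A] [NonUnitalCStarAlgebra B]
    [PartialOrder A] [StarOrderedRing A] (T : A →L[ℂ] B) (hT : Function.Bijective T) :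
    List.TFAE
      [∀ a b : A, orth a b → orth (T a) (T b),
        ∀ a b : A, orth a b ↔ orth (T a) (T b),
        ∀ a b : A, IsSelfAdjoint a → IsSelfAdjoint b → a * b = 0 → orth (T a) (T b),
        ∀ a b : A, 0 ≤ a → 0 ≤ b → a * b = 0 → orth (T a) (T b),
        ∀ a b c : A, tp a b c = 0 → tp (T a) (T b) (T c) = 0,
        ∀ a b c : A, tp a b c = 0 ↔ tp (T a) (T b) (T c) = 0] := by
  tfae_have 1 → 3 := fun h a b ha hb hab ↦
    h a b ⟨by rw [hb.star_eq, hab], by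
      simpa [ha.star_eq, hb.star_eq] using congr(star $hab)⟩
  tfae_have 3 → 4 := fun h a b ha hb ↦ h a b ha.isSelfAdjoint hb.isSelfAdjoint
  tfae_have 4 → 6 := fun h ↦ tp_eq_zero_iff_of_orth hT h
  tfae_have 6 → 5 := fun h a b c ↦ (h a b c).mp
  tfae_have 5 → 1 := fun h a b hab ↦
    orth_iff_tp_eq_zero.mpr (h a a b (orth_iff_tp_eq_zero.mp hab))
  tfae_have 6 → 2 := fun h a b ↦ by
    rw [orth_iff_tp_eq_zero, orth_iff_tp_eq_zero, h]
  tfae_have 2 → 1 := fun h a b ↦ (h a b).mp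
  tfae_finish
end
end

section
/- Let A and B be unital C*-algebras and let T : A → B be a bijective bounded linear map. Then T is orthogonality preserving if and only if the following hold: the element h := T(1) is invertible in B and, writing u := h (h* h)^{-1/2} for the unitary factor in the polar decomposition of h, the element h u* lies in the center of B (it commutes with every element of B), and there exists a bijective bounded linear map S : A → B satisfying S(x ∘ y) = S(x) ∘_u S(y) and S(x*) = S(x)^{*_u} for all x, y ∈ A, such that T(x) = h u* S(x) = S(x) u* h for every x ∈ A. -/
noncomputable section

open CStar
/-- The Jordan product `x ∘ y = (1/2)(xy + yx)` on a C*-algebra. -/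
def CStar.jmul {A : Type*} [NonUnitalCStarAlgebra A] (x y : A) : A :=
  (2 : ℂ)⁻¹ • (x * y + y * x)

/-- The `u`-isotope Jordan product `x ∘_u y = (1/2)(x u* y + y u* x)`. -/
def CStar.jmulIso {A : Type*} [NonUnitalCStarAlgebra A] (u x y : A) : A :=
  (2 : ℂ)⁻¹ • (x * star u * y + y * star u * x)

/-- The `u`-isotope involution `x^{*_u} = u x* u`. -/
def CStar.starIso {A : Type*} [NonUnitalCStarAlgebra A] (u x : A) : A :=
  u * star x * u

/-- The unitary factor `u = h (h* h)^{-1/2}` in the polar decomposition of an invertible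
element `h` of a unital C*-algebra. -/
def CStar.polarUnitary {B : Type*} [CStarAlgebra B] [PartialOrder B] [StarOrderedRing B]
    (h : B) : B :=
  h * Ring.inverse (CFC.sqrt (star h * h))

section Auxiliary

/-- The hat function supported on `[-1, 1]`. -/
def hat (t : ℝ) : ℝ := max 0 (1 - |t|)

/-- Summing against integer translates of the hat function is piecewise linear interpolation. -/
lemma sum_hat {N : ℕ} {t : ℝ} (ht : |t| < N) (c : ℤ → ℝ) :
    ∑ i ∈ Finset.Icc (-N : ℤ) N, c i * hat (t - i) =
      c ⌊t⌋ * (1 - Int.fract t) + c (⌊t⌋ + 1) * Int.fract t := by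
  have h0 := Int.fract_nonneg t
  have h1 := Int.fract_lt_one t
  have hf := Int.floor_add_fract t
  rw [abs_lt] at ht
  have hl : -(N : ℤ) ≤ ⌊t⌋ := by rw [Int.le_floor]; push_cast; linarith
  have hu : ⌊t⌋ < (N : ℤ) := by rw [Int.floor_lt]; push_cast; linarith
  rw [← Finset.sum_subset (s₁ := {⌊t⌋, ⌊t⌋ + 1})]
  · rw [Finset.sum_pair (by omega)]
    congr 2
    · rw [hat, show t - (⌊t⌋ : ℝ) = Int.fract t from rfl, abs_of_nonneg h0, max_eq_right (by linarith)]
    · rw [hat, show t - ((⌊t⌋ + 1 : ℤ) : ℝ) = Int.fract t - 1 by push_cast; linarith,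
        abs_of_nonpos (by linarith), max_eq_right (by linarith)]
      ring
  · intro i hi
    simp only [Finset.mem_insert, Finset.mem_singleton] at hi
    rw [Finset.mem_Icc]; omega
  · intro i _ hi
    simp only [Finset.mem_insert, Finset.mem_singleton, not_or] at hi
    rw [hat, max_eq_left, mul_zero]
    rcases lt_or_ge i ⌊t⌋ with h | h
    · have : (i : ℝ) + 1 ≤ ⌊t⌋ := by exact_mod_cast h
      linarith [le_abs_self (t - i)]
    · have : (⌊t⌋ : ℝ) + 2 ≤ i := by
        have : ⌊t⌋ + 2 ≤ i := by omega
        exact_mod_cast this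
      linarith [neg_abs_le (t - i)]

lemma hat_mul_hat {i j : ℤ} (h : 2 ≤ |i - j|) (t : ℝ) : hat (t - i) * hat (t - j) = 0 := by
  have h2 : (2 : ℝ) ≤ |(i : ℝ) - j| := by exact_mod_cast h
  have h3 : |(i : ℝ) - j| ≤ |t - i| + |t - j| := by
    rw [abs_sub_comm t i, show (i : ℝ) - j = (i - t) + (t - j) by ring]
    exact abs_add_le _ _
  rcases le_total 1 |t - i| with h4 | h4
  · rw [hat, max_eq_left (by linarith), zero_mul]
  · rw [mul_comm, hat, max_eq_left (by linarith), zero_mul]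

variable {K : Type*} [TopologicalSpace K] [CompactSpace K]
  {E : Type*} [NormedAddCommGroup E] [NormedSpace ℝ E]

/-- The hat function centred at the integer `i`, composed with `x`. -/
def hatComp (x : C(K, ℝ)) (i : ℤ) : C(K, ℝ) where
  toFun k := hat (x k - i)
  continuous_toFun := by unfold hat; fun_prop

lemma norm_sum_hatComp_le {x : C(K, ℝ)} {N : ℕ} (hN : ‖x‖ < N) {c : ℤ → ℝ} (hc : ∀ i, |c i| ≤ 1) :
    ‖∑ i ∈ Finset.Icc (-N : ℤ) N, c i • hatComp x i‖ ≤ 1 := by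
  rw [ContinuousMap.norm_le _ zero_le_one]
  intro k
  have hk : |x k| < N := (x.norm_coe_le_norm k).trans_lt hN
  have := sum_hat hk c
  rw [ContinuousMap.sum_apply]
  simp only [ContinuousMap.smul_apply, smul_eq_mul, hatComp, ContinuousMap.coe_mk]
  rw [this, Real.norm_eq_abs]
  have h0 := Int.fract_nonneg (x k)
  have h1 := Int.fract_lt_one (x k)
  have e1 := abs_le.1 (hc ⌊x k⌋)
  have e2 := abs_le.1 (hc (⌊x k⌋ + 1))
  rw [abs_le]
  constructor <;> nlinarith

lemma sum_smul_hatComp {x : C(K, ℝ)} {N : ℕ} (hN : ‖x‖ < N) :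
    ∑ i ∈ Finset.Icc (-N : ℤ) N, (i : ℝ) • hatComp x i = x ∧
      ∑ i ∈ Finset.Icc (-N : ℤ) N, hatComp x i = 1 := by
  constructor <;> ext k
  · have := sum_hat ((x.norm_coe_le_norm k).trans_lt hN) (fun i => i)
    rw [ContinuousMap.sum_apply]
    simp only [ContinuousMap.smul_apply, smul_eq_mul, hatComp, ContinuousMap.coe_mk]
    rw [this]
    push_cast
    linarith [Int.floor_add_fract (x k)]
  · have := sum_hat ((x.norm_coe_le_norm k).trans_lt hN) (fun _ => 1)
    rw [ContinuousMap.sum_apply]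
    simpa [hatComp] using this

lemma sin_pi_div_two_mul_int {d : ℤ} (h : |d| ≤ 1) : Real.sin (Real.pi / 2 * d) = d := by
  rw [abs_le] at h
  obtain rfl | rfl | rfl : d = -1 ∨ d = 0 ∨ d = 1 := by omega
  all_goals simp

/-- The bound does not depend on `x`, so that it forces `V x 1 = V 1 x` by homogeneity. -/
lemma norm_bilin_sub_le (V : C(K, ℝ) →ₗ[ℝ] C(K, ℝ) →ₗ[ℝ] E) {C : ℝ} (hC0 : 0 ≤ C)
    (hC : ∀ f g, ‖V f g‖ ≤ C * ‖f‖ * ‖g‖) (hV : ∀ f g, f * g = 0 → V f g = 0) (x : C(K, ℝ)) :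
    ‖V x 1 - V 1 x‖ ≤ 2 * C := by
  obtain ⟨N, hN⟩ := exists_nat_gt ‖x‖
  obtain ⟨hx, h1⟩ := sum_smul_hatComp hN
  set s : ℤ → ℝ := fun i => Real.sin (Real.pi / 2 * i)
  set c : ℤ → ℝ := fun i => Real.cos (Real.pi / 2 * i)
  have hs := norm_sum_hatComp_le hN (c := s) fun i => Real.abs_sin_le_one _
  have hc := norm_sum_hatComp_le hN (c := c) fun i => Real.abs_cos_le_one _
  set S := ∑ i ∈ Finset.Icc (-N : ℤ) N, s i • hatComp x i with hS
  set D := ∑ i ∈ Finset.Icc (-N : ℤ) N, c i • hatComp x i with hD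
  have expand (p q : ℤ → ℝ) : V (∑ i ∈ Finset.Icc (-N : ℤ) N, p i • hatComp x i)
      (∑ i ∈ Finset.Icc (-N : ℤ) N, q i • hatComp x i) = ∑ i ∈ Finset.Icc (-N : ℤ) N,
        ∑ j ∈ Finset.Icc (-N : ℤ) N, (p i * q j) • V (hatComp x i) (hatComp x j) := by
    simp only [map_sum, LinearMap.sum_apply, map_smul, LinearMap.smul_apply, mul_smul,
      Finset.smul_sum]
    rw [Finset.sum_comm]
    simp only [smul_comm (q _)]
  have key : V x 1 - V 1 x = V S D - V D S := by
    have h1' : ∑ i ∈ Finset.Icc (-N : ℤ) N, (1 : ℝ) • hatComp x i = 1 := by simpa using h1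
    conv_lhs => rw [← hx, ← h1']
    rw [hS, hD, expand (fun i => i) (fun _ => 1), expand (fun _ => 1) (fun i => i), expand, expand]
    simp only [← Finset.sum_sub_distrib, ← sub_smul]
    refine Finset.sum_congr rfl fun i _ => Finset.sum_congr rfl fun j _ => ?_
    rcases le_or_gt 2 |i - j| with h | h
    · rw [hV _ _ (by ext k; exact hat_mul_hat h _), smul_zero, smul_zero]
    · have := sin_pi_div_two_mul_int (show |i - j| ≤ 1 by omega)
      push_cast at this
      rw [mul_sub, Real.sin_sub] at this
      simp only [s, c]
      rw [this, mul_one, one_mul]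
  have hb : ∀ f g : C(K, ℝ), ‖f‖ ≤ 1 → ‖g‖ ≤ 1 → ‖V f g‖ ≤ C := fun f g hf hg =>
    (hC f g).trans <| by
      rw [mul_assoc]
      exact mul_le_of_le_one_right hC0 (mul_le_one₀ hf (norm_nonneg _) hg)
  rw [key, two_mul]
  exact (norm_sub_le _ _).trans (add_le_add (hb _ _ hs hc) (hb _ _ hc hs))

/-- A bounded bilinear map on `C(K, ℝ)` vanishing on pairs with zero product satisfies
`V x 1 = V 1 x`. -/
lemma bilin_comm_one (V : C(K, ℝ) →ₗ[ℝ] C(K, ℝ) →ₗ[ℝ] E) {C : ℝ} (hC0 : 0 ≤ C)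
    (hC : ∀ f g, ‖V f g‖ ≤ C * ‖f‖ * ‖g‖) (hV : ∀ f g, f * g = 0 → V f g = 0) (x : C(K, ℝ)) :
    V x 1 = V 1 x := by
  by_contra h
  have hpos : 0 < ‖V x 1 - V 1 x‖ := norm_pos_iff.2 (sub_ne_zero.2 h)
  obtain ⟨n, hn⟩ := exists_nat_gt (2 * C / ‖V x 1 - V 1 x‖)
  have := norm_bilin_sub_le V hC0 hC hV ((n : ℝ) • x)
  rw [map_smul, LinearMap.smul_apply, map_smul, ← smul_sub, norm_smul, Real.norm_natCast] at this
  rw [div_lt_iff₀ hpos] at hn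
  linarith

/-- A bounded bilinear map on `C(K, ℝ)` vanishing on pairs with zero product depends on `f * x`
only. -/
lemma bilin_mul_one (V : C(K, ℝ) →ₗ[ℝ] C(K, ℝ) →ₗ[ℝ] E) {C : ℝ} (hC0 : 0 ≤ C)
    (hC : ∀ f g, ‖V f g‖ ≤ C * ‖f‖ * ‖g‖) (hV : ∀ f g, f * g = 0 → V f g = 0) (f x : C(K, ℝ)) :
    V (f * x) 1 = V f x := by
  have := bilin_comm_one (V.comp (LinearMap.mulLeft ℝ f)) (C := C * ‖f‖) (by positivity)
    (fun u v => (hC _ _).trans ?_) (fun u v huv => hV _ _ ?_) x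
  · simpa using this
  · rw [mul_assoc C ‖f‖]
    refine mul_le_mul_of_nonneg_right ?_ (norm_nonneg v)
    exact mul_le_mul_of_nonneg_left (norm_mul_le f u) hC0
  · simp [mul_assoc, huv]

section OrthogonalityPreserving

variable {A B : Type*} [CStarAlgebra A] [CStarAlgebra B]

lemma orth_linear_identity (L : C(K, ℝ) →ₗ[ℝ] B) {C : ℝ} (hC0 : 0 ≤ C)
    (hC : ∀ f, ‖L f‖ ≤ C * ‖f‖) (hL : ∀ f g, f * g = 0 → orth (L f) (L g)) (f x : C(K, ℝ)) :
    L (f * x) * star (L 1) = L f * star (L x) ∧ star (L 1) * L (f * x) = star (L x) * L f := by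
  have hb (f g : C(K, ℝ)) : ‖L f‖ * ‖L g‖ ≤ C * C * ‖f‖ * ‖g‖ :=
    (mul_le_mul (hC f) (hC g) (norm_nonneg _) (by positivity)).trans_eq (by ring)
  constructor
  · refine bilin_mul_one (LinearMap.mk₂ ℝ (fun f g => L f * star (L g)) ?_ ?_ ?_ ?_)
      (mul_nonneg hC0 hC0) (fun f g => ?_) (fun f g h => (hL f g h).1) f x
    · simp [add_mul]
    · simp
    · simp [mul_add]
    · simp
    · exact (norm_mul_le _ _).trans (by simpa using hb f g)
  · refine bilin_mul_one (LinearMap.mk₂ ℝ (fun f g => star (L g) * L f) ?_ ?_ ?_ ?_)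
      (mul_nonneg hC0 hC0) (fun f g => ?_) (fun f g h => (hL f g h).2) f x
    · simp [mul_add]
    · simp
    · simp [add_mul]
    · simp
    · exact (norm_mul_le _ _).trans (by simpa [mul_comm] using hb f g)

lemma orth_preserving_identities {T : A →L[ℂ] B} (hT : ∀ a b : A, orth a b → orth (T a) (T b))
    {a : A} (ha : IsSelfAdjoint a) :
    T (a * a) * star (T 1) = T a * star (T a) ∧ star (T 1) * T (a * a) = star (T a) * T a ∧
      T a * star (T 1) = T 1 * star (T a) ∧ star (T 1) * T a = star (T a) * T 1 := by
  let φ : C(spectrum ℝ a, ℝ) →⋆ₐ[ℝ] A := cfcHom ha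
  let L : C(spectrum ℝ a, ℝ) →ₗ[ℝ] B := T.toLinearMap.restrictScalars ℝ ∘ₗ φ.toAlgHom.toLinearMap
  have hLφ (f) : L f = T (φ f) := rfl
  have key := orth_linear_identity L (norm_nonneg T)
    (fun f => (T.le_opNorm _).trans_eq (by congr 1; exact norm_cfcHom a f ha)) fun f g h => by
      refine hT _ _ ?_
      have h' : g * f = 0 := by rw [mul_comm, h]
      have hs : star (φ g) = φ g := by rw [← map_star, star_trivial]
      constructor
      · change φ f * star (φ g) = 0
        rw [hs, ← map_mul, h, map_zero]
      · change star (φ g) * φ f = 0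
        rw [hs, ← map_mul, h', map_zero]
  let x : C(spectrum ℝ a, ℝ) := (ContinuousMap.id ℝ).restrict (spectrum ℝ a)
  have hx : φ x = a := cfcHom_id ha
  have h1 := key x x
  have h2 := key 1 x
  simp only [hLφ, map_mul, map_one, hx, one_mul] at h1 h2
  exact ⟨h1.1, h1.2, h2.1, h2.2⟩

/-- A surjective orthogonality preserving operator maps `1` to an invertible element. -/
lemma isUnit_map_one [PartialOrder B] [StarOrderedRing B] {T : A →L[ℂ] B}
    (hs : Function.Surjective T) (hT : ∀ a b : A, orth a b → orth (T a) (T b)) :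
    IsUnit (T 1) := by
  obtain ⟨x, hx⟩ := hs 1
  have hu (w : B) (hw : 0 ≤ w) : IsUnit (1 + w) :=
    CStarAlgebra.isUnit_of_le 1 (le_add_of_nonneg_right hw)
  set r : A := (realPart x : A)
  set m : A := (imaginaryPart x : A)
  have hxr : x = r + Complex.I • m := (realPart_add_I_smul_imaginaryPart x).symm
  obtain ⟨hr1, hr2, -, -⟩ := orth_preserving_identities hT (realPart x).2
  obtain ⟨hm1, hm2, -, -⟩ := orth_preserving_identities hT (imaginaryPart x).2
  have hp : T r + Complex.I • T m = 1 := by rw [← hx, hxr, map_add, map_smul]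
  set w := T r - Complex.I • T m with hw
  set y := (2 : ℂ) • (r * r + m * m)
  have e1 : T y * star (T 1) = 1 + w * star w := by
    have h1 : (1 : B) = (T r + Complex.I • T m) * star (T r + Complex.I • T m) := by simp [hp]
    rw [h1, hw, map_smul, map_add, smul_mul_assoc, add_mul, hr1, hm1]
    simp only [star_add, star_sub, star_smul, Complex.star_def, Complex.conj_I, add_mul, mul_add,
      sub_mul, mul_sub, smul_mul_assoc, mul_smul_comm]
    match_scalars <;> (ring_nf; try simp)
  have e2 : star (T 1) * T y = 1 + star w * w := by
    have h1 : (1 : B) = star (T r + Complex.I • T m) * (T r + Complex.I • T m) := by simp [hp]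
    rw [h1, hw, map_smul, map_add, mul_smul_comm, mul_add, hr2, hm2]
    simp only [star_add, star_sub, star_smul, Complex.star_def, Complex.conj_I, add_mul, mul_add,
      sub_mul, mul_sub, smul_mul_assoc, mul_smul_comm]
    match_scalars <;> (ring_nf; try simp)
  rw [← isUnit_star]
  obtain ⟨u, hu1⟩ := hu _ (mul_star_self_nonneg w)
  obtain ⟨v, hv1⟩ := hu _ (star_mul_self_nonneg w)
  rw [isUnit_iff_exists_and_exists]
  constructor
  · exact ⟨T y * ↑v⁻¹, by rw [← mul_assoc, e2, ← hv1, Units.mul_inv]⟩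
  · exact ⟨↑u⁻¹ * T y, by rw [mul_assoc, e1, ← hu1, Units.inv_mul]⟩

lemma linearMap_ext_of_isSelfAdjoint {f g : A →ₗ[ℂ] B}
    (h : ∀ a, IsSelfAdjoint a → f a = g a) (x : A) : f x = g x := by
  rw [← realPart_add_I_smul_imaginaryPart x, map_add, map_add, map_smul, map_smul,
    h _ (realPart x).2, h _ (imaginaryPart x).2]

/-- If `T (a²) k = T(a)²` for all self-adjoint `a`, then `T (x ∘ y) k = T x ∘ T y`. -/
lemma map_jordan_mul_of_isSelfAdjoint {T : A →ₗ[ℂ] B} {k : B}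
    (h : ∀ a : A, IsSelfAdjoint a → T (a * a) * k = T a * T a) (x y : A) :
    T (x * y + y * x) * k = T x * T y + T y * T x := by
  have h2 {a b : A} (ha : IsSelfAdjoint a) (hb : IsSelfAdjoint b) :
      T (a * b + b * a) * k = T a * T b + T b * T a := by
    have e := h (a + b) (ha.add hb)
    have e' : (a + b) * (a + b) = a * a + (a * b + b * a) + b * b := by noncomm_ring
    rw [e', map_add T, map_add T _ (a * b + b * a), add_mul, add_mul, h a ha, h b hb,
      map_add T a b] at e
    rw [← sub_eq_zero] at e ⊢
    rw [← e]
    noncomm_ring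
  let F (y : A) : A →ₗ[ℂ] B :=
    LinearMap.mulRight ℂ k ∘ₗ T ∘ₗ (LinearMap.mulRight ℂ y + LinearMap.mulLeft ℂ y)
  let G (y : A) : A →ₗ[ℂ] B :=
    (LinearMap.mulRight ℂ (T y) + LinearMap.mulLeft ℂ (T y)) ∘ₗ T
  have h3 {a : A} (ha : IsSelfAdjoint a) (x : A) : F a x = G a x :=
    linearMap_ext_of_isSelfAdjoint (fun b hb => h2 hb ha) x
  refine linearMap_ext_of_isSelfAdjoint (f := F y) (g := G y) (fun a ha => ?_) x
  have := h3 ha y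
  change T (y * a + a * y) * k = T y * T a + T a * T y at this
  change T (a * y + y * a) * k = T a * T y + T y * T a
  rw [add_comm, this, add_comm]

lemma orth_of_triple_eq_zero [PartialOrder B] [StarOrderedRing B] {a b : B}
    (h : a * star a * b + b * star a * a = 0) : orth a b := by
  have h1 : star b * (a * star a) * b + (star b * b) * (star a * a) = 0 := by
    rw [← mul_zero (star b), ← h]
    noncomm_ring
  have hp : 0 ≤ star b * (a * star a) * b := star_left_conjugate_nonneg (mul_star_self_nonneg a) b
  have h2 : star b * b * (star a * a) = - (star b * (a * star a) * b) := by
    rw [eq_neg_iff_add_eq_zero, add_comm, h1]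
  have h3 : 0 ≤ star b * b * (star a * a) := by
    refine Commute.mul_nonneg (star_mul_self_nonneg b) (star_mul_self_nonneg a) ?_
    refine ((IsSelfAdjoint.star_mul_self b).commute_iff (IsSelfAdjoint.star_mul_self a)).2 ?_
    rw [h2]
    exact hp.isSelfAdjoint.neg
  have h4 : star b * (a * star a) * b = 0 := by
    refine le_antisymm ?_ hp
    rwa [h2, Left.nonneg_neg_iff] at h3
  have h5 : star b * b * (star a * a) = 0 := by rw [h2, h4, neg_zero]
  constructor
  · have h6 : b * (star a * a) = 0 := by
      rw [← CStarRing.star_mul_self_eq_zero_iff, star_mul, mul_assoc, ← mul_assoc (star b), h5,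
        mul_zero]
    rw [← CStarRing.star_mul_self_eq_zero_iff, star_mul, star_star, ← mul_assoc, mul_assoc b, h6,
      zero_mul]
  · rw [← CStarRing.mul_star_self_eq_zero_iff]
    rw [← h4]
    simp [mul_assoc]

lemma jordan_triple_identity {R : Type*} [Ring R] (x w z : R) :
    ((x * w + w * x) * z + z * (x * w + w * x)) + ((z * w + w * z) * x + x * (z * w + w * z)) -
      ((x * z + z * x) * w + w * (x * z + z * x)) = 2 * (x * w * z + z * w * x) := by
  noncomm_ring

/-- Jordan `*`-homomorphisms preserve orthogonality. -/
lemma orth_map_of_jordan [PartialOrder B] [StarOrderedRing B] {J : A →ₗ[ℂ] B}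
    (hJ : ∀ x y : A, J (x * y + y * x) = J x * J y + J y * J x)
    (hJs : ∀ x, J (star x) = star (J x)) {a b : A} (h : orth a b) : orth (J a) (J b) := by
  apply orth_of_triple_eq_zero
  obtain ⟨h1, h2⟩ := h
  have h3 : star a * b = 0 := by rw [← star_eq_zero]; simpa using h2
  have h4 : b * star a = 0 := by rw [← star_eq_zero]; simpa using h1
  have e := congrArg J (jordan_triple_identity a (star a) b)
  rw [map_sub, map_add, hJ, hJ, hJ, hJ, hJ, hJ, hJs, jordan_triple_identity, mul_assoc a, h3, h4,
    mul_zero, zero_mul, add_zero, mul_zero, map_zero] at e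
  have h5 : (2 : ℂ) • (J a * star (J a) * J b + J b * star (J a) * J a) = 0 := by
    rw [two_smul, ← two_mul, e]
  exact (smul_eq_zero.1 h5).resolve_left two_ne_zero

lemma isUnit_sqrt_star_mul_self [PartialOrder B] [StarOrderedRing B] {h : B} (hh : IsUnit h) :
    IsUnit (CFC.sqrt (star h * h)) :=
  (CFC.isUnit_sqrt_iff _ (star_mul_self_nonneg h)).2 (hh.star.mul hh)

/-- For invertible `h`, the element `u = polarUnitary h` is unitary and `h u*` is positive. -/
lemma polarUnitary_spec [PartialOrder B] [StarOrderedRing B] {h : B} (hh : IsUnit h) :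
    star (polarUnitary h) * polarUnitary h = 1 ∧ polarUnitary h * star (polarUnitary h) = 1 ∧
      0 ≤ h * star (polarUnitary h) := by
  set m := CFC.sqrt (star h * h) with hm
  have hmu : IsUnit m := isUnit_sqrt_star_mul_self hh
  have hm0 : 0 ≤ m := CFC.sqrt_nonneg _
  have hmm : m * m = star h * h := CFC.sqrt_mul_sqrt_self _ (star_mul_self_nonneg h)
  have hn0 : 0 ≤ Ring.inverse m := by
    rwa [CFC.ringInverse_nonneg_iff_nonneg_of_isUnit hmu]
  have hu : polarUnitary h = h * Ring.inverse m := rfl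
  have hus : star (polarUnitary h) = Ring.inverse m * star h := by
    rw [hu, star_mul, hn0.isSelfAdjoint.star_eq]
  have h1 : star (polarUnitary h) * polarUnitary h = 1 := by
    rw [hus, hu, mul_assoc, ← mul_assoc (star h), ← hmm, mul_assoc m, Ring.mul_inverse_cancel _ hmu,
      mul_one, Ring.inverse_mul_cancel _ hmu]
  have huu : IsUnit (polarUnitary h) := hh.mul hmu.ringInverse
  refine ⟨h1, ?_, ?_⟩
  · exact huu.mul_right_cancel (by rw [mul_assoc, h1, mul_one, one_mul])
  · rw [hus, ← mul_assoc]
    exact star_right_conjugate_nonneg hn0 h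

end OrthogonalityPreserving

end Auxiliary

/-- A bijective bounded linear map `T` between unital C*-algebras is orthogonality preserving
iff `h = T 1` is invertible, `h u*` is central (where `u` is the unitary polar factor of `h`),
and `T = h u* S(·) = S(·) u* h` for a bijective bounded linear map `S` which is a Jordan
`*`-isomorphism onto the `u`-isotope. -/
theorem bijective_op_iff_structure {A B : Type*} [CStarAlgebra A] [CStarAlgebra B]
    [PartialOrder B] [StarOrderedRing B] (T : A →L[ℂ] B) (hT : Function.Bijective T) :
    (∀ a b : A, orth a b → orth (T a) (T b)) ↔
      (IsUnit (T 1) ∧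
        (∀ b : B, (T 1 * star (polarUnitary (T 1))) * b = b * (T 1 * star (polarUnitary (T 1)))) ∧
        ∃ S : A →L[ℂ] B, Function.Bijective S ∧
          (∀ x y : A, S (jmul x y) = jmulIso (polarUnitary (T 1)) (S x) (S y)) ∧
          (∀ x : A, S (star x) = starIso (polarUnitary (T 1)) (S x)) ∧
          (∀ x : A, T x = T 1 * star (polarUnitary (T 1)) * S x) ∧
          (∀ x : A, T x = S x * star (polarUnitary (T 1)) * (T 1))) := by
  set h := T 1 with hh
  set u := polarUnitary h with hu
  constructor
  · intro hop
    have hunit : IsUnit h := isUnit_map_one hT.2 hop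
    obtain ⟨huu, huu', hk0⟩ := polarUnitary_spec hunit
    rw [← hu] at huu huu' hk0
    set k := h * star u with hk
    have hks : star k = k := hk0.isSelfAdjoint.star_eq
    have hku : k * u = h := by rw [hk, mul_assoc, huu, mul_one]
    have hkunit : IsUnit k :=
      hunit.mul (isUnit_iff_exists_and_exists.2 ⟨⟨u, huu⟩, ⟨u, huu'⟩⟩)
    let R : A →L[ℂ] B := (ContinuousLinearMap.mul ℂ B).flip (star u) ∘L T
    have hR (x : A) : R x = T x * star u := rfl
    have hRT (x : A) : R x * u = T x := by rw [hR, mul_assoc, huu, mul_one]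
    have hR1 : R 1 = k := rfl
    have hRop (a b : A) (hab : orth a b) : orth (R a) (R b) := by
      obtain ⟨h1, h2⟩ := hop a b hab
      constructor
      · rw [hR, hR, star_mul, star_star, mul_assoc, ← mul_assoc (star u), huu, one_mul, h1]
      · rw [hR, hR, star_mul, star_star, mul_assoc, ← mul_assoc (star (T b)), h2, zero_mul,
          mul_zero]
    have hcomm2 (b : B) : k * k * b = b * (k * k) := by
      obtain ⟨x, hx⟩ := hT.2 (b * u)
      have hx' : R x = b := by rw [hR, hx, mul_assoc, huu', mul_one]
      rw [← hx']
      refine linearMap_ext_of_isSelfAdjoint (f := LinearMap.mulLeft ℂ (k * k) ∘ₗ R.toLinearMap)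
        (g := LinearMap.mulRight ℂ (k * k) ∘ₗ R.toLinearMap) (fun a ha => ?_) x
      obtain ⟨-, -, h3, h4⟩ := orth_preserving_identities hRop ha
      rw [hR1, hks] at h3 h4
      change k * k * R a = R a * (k * k)
      rw [mul_assoc, h4, ← mul_assoc, ← h3, mul_assoc]
    have hcomm (b : B) : k * b = b * k := by
      have : CFC.sqrt (k * k) = k := CFC.sqrt_mul_self k hk0
      have h1 : Commute (CFC.sqrt (k * k)) b := by
        rw [CFC.sqrt_eq_cfc]
        exact Commute.cfc_nnreal (hcomm2 b) _
      rw [this] at h1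
      exact h1
    have hRsa {a : A} (ha : IsSelfAdjoint a) : star (R a) = R a := by
      obtain ⟨-, -, -, h4⟩ := orth_preserving_identities hRop ha
      rw [hR1, hks, ← hcomm] at h4
      exact (hkunit.mul_left_cancel h4).symm
    have hRstar (x : A) : R (star x) = star (R x) := by
      conv_lhs => rw [← realPart_add_I_smul_imaginaryPart x]
      conv_rhs => rw [← realPart_add_I_smul_imaginaryPart x]
      simp [hRsa (realPart x).2, hRsa (imaginaryPart x).2]
    have hRj (x y : A) : R (x * y + y * x) * k = R x * R y + R y * R x :=
      map_jordan_mul_of_isSelfAdjoint (T := R.toLinearMap) (fun a ha => by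
        have := (orth_preserving_identities hRop ha).1
        rw [hR1, hks, hRsa ha] at this
        exact this) x y
    obtain ⟨n, hkn, hnk⟩ : ∃ n, k * n = 1 ∧ n * k = 1 :=
      ⟨_, Ring.mul_inverse_cancel _ hkunit, Ring.inverse_mul_cancel _ hkunit⟩
    have hns : star n = n := by
      refine left_inv_eq_right_inv ?_ hkn
      conv_lhs => rw [← hks, ← star_mul, hkn, star_one]
    have hnc (b : B) : n * b = b * n := by
      rw [← mul_one (n * b), ← hkn, ← mul_assoc, mul_assoc n, ← hcomm, ← mul_assoc, hnk, one_mul]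
    have hRk (w : A) : R w = R w * k * n := by rw [mul_assoc, hkn, mul_one]
    refine ⟨hunit, hcomm, ContinuousLinearMap.mul ℂ B n ∘L T, ⟨fun x y hxy => ?_, fun b => ?_⟩,
      fun x y => ?_, fun x => ?_, fun x => ?_, fun x => ?_⟩
    · refine hT.1 ?_
      rw [← one_mul (T x), ← one_mul (T y), ← hkn, mul_assoc k n (T x), mul_assoc k n (T y)]
      exact congrArg (k * ·) hxy
    · obtain ⟨x, hx⟩ := hT.2 (k * b)
      refine ⟨x, ?_⟩
      change n * T x = b
      rw [hx, ← mul_assoc, hnk, one_mul]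
    · have hterm (x y : A) : n * T x * star u * (n * T y) = n * (R x * R y * n) * u := by
        rw [hnc (T y), ← hRT y, mul_assoc _ u n, ← hnc u, mul_assoc n (T x), ← hR]
        simp only [mul_assoc]
      rw [jmul, jmulIso, map_smul]
      change (2 : ℂ)⁻¹ • (n * T (x * y + y * x)) =
        (2 : ℂ)⁻¹ • (n * T x * star u * (n * T y) + n * T y * star u * (n * T x))
      rw [hterm, hterm, ← hRT (x * y + y * x), hRk, hRj]
      simp only [add_mul, mul_add, mul_assoc]
    · change n * T (star x) = u * star (n * T x) * u
      rw [star_mul, hns, ← hnc, ← hRT (star x), hRstar, hR, star_mul, star_star]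
      simp only [← mul_assoc]
      rw [hnc u]
    · change T x = k * (n * T x)
      rw [← mul_assoc, hkn, one_mul]
    · change T x = n * T x * star u * h
      rw [mul_assoc n, ← hR, ← hku, ← mul_assoc, mul_assoc n, ← hcomm, ← mul_assoc, hnk, one_mul,
        hRT]
  · rintro ⟨hunit, hcomm, S, hSb, hSj, hSs, hTS, -⟩ a b hab
    obtain ⟨huu, huu', -⟩ := polarUnitary_spec hunit
    rw [← hu] at huu huu'
    generalize h * star u = k at hcomm hTS
    let J : A →ₗ[ℂ] B := LinearMap.mulRight ℂ (star u) ∘ₗ S.toLinearMap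
    have hJ (x : A) : J x = S x * star u := rfl
    have hJS (x : A) : J x * u = S x := by rw [hJ, mul_assoc, huu, mul_one]
    have hcs (b : B) : star k * b = b * star k := by
      rw [← star_star b, ← star_mul, ← star_mul, hcomm]
    obtain ⟨h1, h2⟩ : orth (J a) (J b) := by
      refine orth_map_of_jordan (fun x y => ?_) (fun x => ?_) hab
      · have := hSj x y
        rw [jmul, jmulIso, map_smul] at this
        have := smul_right_injective B (inv_ne_zero (two_ne_zero (α := ℂ))) this
        rw [hJ, this]
        simp only [hJ, add_mul, mul_assoc]
      · rw [hJ, hJ, hSs, starIso, mul_assoc, huu', mul_one, star_mul, star_star]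
    constructor
    · have : T a * star (T b) = k * (J a * star (J b)) * star k := by
        rw [hTS, hTS, hJ, hJ, star_mul, star_mul, star_star, mul_assoc (S a), ← mul_assoc (star u),
          huu, one_mul]
        simp only [mul_assoc]
      rw [this, h1, mul_zero, zero_mul]
    · have : star (T b) * T a = star u * (star k * (star (J b) * J a)) * (k * u) := by
        rw [hTS, hTS, ← hJS, ← hJS, star_mul, star_mul, hcomm, mul_assoc (star u), ← hcs,
          mul_assoc (J a), ← hcomm u]
        simp only [mul_assoc]
      rw [this, h2, mul_zero, mul_zero, zero_mul]
end
end

section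
/- Let A be a C*-algebra, let I ⊆ A be a closed two-sided ideal, and let x, y be positive elements of A such that x y ∈ I. Then there exist positive elements x₁, y₁ ∈ A such that x₁ y₁ = 0, x − x₁ ∈ I and y − y₁ ∈ I. (Equivalently: orthogonality of positive cosets in the quotient A/I can be lifted to orthogonality of positive representatives in A.) -/
open Filter Topology

namespace TwoSidedIdeal

variable {A : Type*} [NonUnitalCStarAlgebra A] {I : TwoSidedIdeal A}

lemma real_smul_mem_of_isClosed (hI : IsClosed (I : Set A)) (c : ℝ) {z : A} (hz : z ∈ I) :
    c • z ∈ I := by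
  let := CStarAlgebra.spectralOrder A
  have := CStarAlgebra.spectralOrderedRing A
  have hl := CStarAlgebra.increasingApproximateUnit A
  have := hl.toIsApproximateUnit.neBot
  have h : Tendsto (fun e : A ↦ (c • e) * z) (CStarAlgebra.approximateUnit A) (𝓝 (c • z)) := by
    simpa only [smul_mul_assoc] using (hl.toIsApproximateUnit.tendsto_mul_right z).const_smul c
  exact hI.mem_of_tendsto h (.of_forall fun e ↦ I.mul_mem_left _ _ hz)

lemma cfcₙ_pow_succ_sub_mem {a b : A} (ha : IsSelfAdjoint a) (hb : IsSelfAdjoint b)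
    (hab : a - b ∈ I) (n : ℕ) :
    cfcₙ (fun t : ℝ ↦ t ^ (n + 1)) a - cfcₙ (fun t : ℝ ↦ t ^ (n + 1)) b ∈ I := by
  induction n with
  | zero => simpa [cfcₙ_id' ℝ a, cfcₙ_id' ℝ b] using hab
  | succ n ih =>
    have key (c : A) (hc : IsSelfAdjoint c) :
        cfcₙ (fun t : ℝ ↦ t ^ (n + 1 + 1)) c = cfcₙ (fun t : ℝ ↦ t ^ (n + 1)) c * c := by
      simp_rw [pow_succ _ (n + 1)]
      rw [cfcₙ_mul (fun t : ℝ ↦ t ^ (n + 1)) (fun t ↦ t) c, cfcₙ_id' ℝ c]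
    rw [key a ha, key b hb]
    have := I.add_mem (I.mul_mem_right _ a ih)
      (I.mul_mem_left (cfcₙ (fun t : ℝ ↦ t ^ (n + 1)) b) _ hab)
    convert this using 1
    noncomm_ring

lemma cfcₙ_mul_eval_sub_mem (hI : IsClosed (I : Set A)) {a b : A} (ha : IsSelfAdjoint a)
    (hb : IsSelfAdjoint b) (hab : a - b ∈ I) (p : Polynomial ℝ) :
    cfcₙ (fun t : ℝ ↦ t * p.eval t) a - cfcₙ (fun t : ℝ ↦ t * p.eval t) b ∈ I := by
  induction p using Polynomial.induction_on' with
  | add p q hp hq =>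
    have key (c : A) : cfcₙ (fun t : ℝ ↦ t * (p + q).eval t) c =
        cfcₙ (fun t : ℝ ↦ t * p.eval t) c + cfcₙ (fun t : ℝ ↦ t * q.eval t) c := by
      simp_rw [Polynomial.eval_add, mul_add]
      exact cfcₙ_add _ _ _
    rw [key a, key b, add_sub_add_comm]
    exact I.add_mem hp hq
  | monomial n r =>
    have key (c : A) : cfcₙ (fun t : ℝ ↦ t * (Polynomial.monomial n r).eval t) c =
        r • cfcₙ (fun t : ℝ ↦ t ^ (n + 1)) c := by
      rw [← cfcₙ_const_mul r (fun t : ℝ ↦ t ^ (n + 1)) c]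
      congr 1
      ext t
      rw [Polynomial.eval_monomial]
      ring
    rw [key a, key b, ← smul_sub]
    exact real_smul_mem_of_isClosed hI r (cfcₙ_pow_succ_sub_mem ha hb hab n)

/-- The continuous functional calculus preserves congruence modulo a closed ideal. -/
lemma cfcₙ_sub_cfcₙ_mem (hI : IsClosed (I : Set A)) {a b : A} (ha : IsSelfAdjoint a)
    (hb : IsSelfAdjoint b) (hab : a - b ∈ I) {f : ℝ → ℝ} (hf : Continuous f) (hf0 : f 0 = 0) :
    cfcₙ f a - cfcₙ f b ∈ I := by
  change _ ∈ (I : Set A)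
  rw [← hI.closure_eq, Metric.mem_closure_iff]
  intro ε hε
  set M := max ‖a‖ ‖b‖
  obtain ⟨p, hp⟩ := exists_polynomial_near_of_continuousOn (-M) M f hf.continuousOn (ε / 5)
    (by positivity)
  have h0 : |p.eval 0| < ε / 5 := by
    simpa [hf0] using hp 0 (by simp [M])
  have hq (t : ℝ) : t * p.divX.eval t = p.eval t - p.eval 0 := by
    have := congrArg (Polynomial.eval t) p.divX_mul_X_add
    simp only [Polynomial.eval_add, Polynomial.eval_mul, Polynomial.eval_X, Polynomial.eval_C,
      Polynomial.coeff_zero_eq_eval_zero] at this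
    linarith
  refine ⟨_, cfcₙ_mul_eval_sub_mem hI ha hb hab p.divX, ?_⟩
  have key (c : A) (hc : IsSelfAdjoint c) (hcM : ‖c‖ ≤ M) :
      ‖cfcₙ f c - cfcₙ (fun t : ℝ ↦ t * p.divX.eval t) c‖ ≤ 2 * (ε / 5) := by
    rw [← cfcₙ_sub f _ c]
    refine norm_cfcₙ_le fun t ht ↦ ?_
    have htc : |t| ≤ M := by
      have := norm_apply_le_norm_cfcₙ (fun t : ℝ ↦ t) c ht
      rw [cfcₙ_id' ℝ c] at this
      exact this.trans hcM
    have h1 := abs_lt.1 (hp t (abs_le.1 htc))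
    have h2 := abs_lt.1 h0
    rw [hq, Real.norm_eq_abs, abs_le]
    constructor <;> linarith
  rw [dist_eq_norm, sub_sub_sub_comm]
  have := norm_sub_le (cfcₙ f a - cfcₙ (fun t : ℝ ↦ t * p.divX.eval t) a)
    (cfcₙ f b - cfcₙ (fun t : ℝ ↦ t * p.divX.eval t) b)
  linarith [key a ha (le_max_left _ _), key b hb (le_max_right _ _)]

lemma star_mul_self_sub_mul_cfcₙ (a : A) {h : ℝ → ℝ} (hh : Continuous h) (h0 : h 0 = 0) :
    star (star a - star a * cfcₙ h (a * star a)) * (star a - star a * cfcₙ h (a * star a)) =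
      cfcₙ (fun t : ℝ ↦ (t - h t * t) - (t - h t * t) * h t) (a * star a) := by
  have hb : IsSelfAdjoint (a * star a) := .mul_star_self a
  have hH : star (cfcₙ h (a * star a)) = cfcₙ h (a * star a) :=
    (cfcₙ_predicate h (a * star a) : IsSelfAdjoint _).star_eq
  have h1 : Continuous fun t : ℝ ↦ t - h t * t := by fun_prop
  have h2 : Continuous fun t : ℝ ↦ (t - h t * t) * h t := by fun_prop
  have h3 : Continuous fun t : ℝ ↦ h t * t := by fun_prop
  rw [cfcₙ_sub (fun t : ℝ ↦ t - h t * t) (fun t : ℝ ↦ (t - h t * t) * h t) (a * star a)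
      h1.continuousOn (by simp) h2.continuousOn (by simp),
    cfcₙ_mul (fun t : ℝ ↦ t - h t * t) h (a * star a) h1.continuousOn (by simp)
      hh.continuousOn h0,
    cfcₙ_sub (fun t : ℝ ↦ t) (fun t ↦ h t * t) (a * star a) continuousOn_id rfl
      h3.continuousOn (by simp),
    cfcₙ_mul h (fun t : ℝ ↦ t) (a * star a) hh.continuousOn h0 continuousOn_id rfl,
    cfcₙ_id' ℝ (a * star a)]
  simp only [star_sub, star_mul, star_star, hH]
  noncomm_ring

/-- Closed two-sided ideals of C⋆-algebras are closed under the involution. -/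
lemma star_mem_of_isClosed (hI : IsClosed (I : Set A)) {a : A} (ha : a ∈ I) : star a ∈ I := by
  change _ ∈ (I : Set A)
  rw [← hI.closure_eq, Metric.mem_closure_iff]
  intro ε hε
  set δ : ℝ := (ε / 2) ^ 2 with hδ
  have hδ0 : 0 < δ := by positivity
  set b := a * star a
  have hb : IsSelfAdjoint b := .mul_star_self a
  set h : ℝ → ℝ := fun t ↦ |t| / (|t| + δ)
  have hpos (t : ℝ) : 0 < |t| + δ := by positivity
  have hcont : Continuous h :=
    continuous_abs.div (by fun_prop) fun t ↦ (hpos t).ne'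
  have h0 : h 0 = 0 := by simp [h]
  have hmem : cfcₙ h b ∈ I := by
    simpa using cfcₙ_sub_cfcₙ_mem hI hb (.zero A) (by simpa using I.mul_mem_right _ _ ha) hcont h0
  refine ⟨star a * cfcₙ h b, I.mul_mem_left _ _ hmem, ?_⟩
  have hsq := star_mul_self_sub_mul_cfcₙ a hcont h0
  have hle : ‖star a - star a * cfcₙ h b‖ * ‖star a - star a * cfcₙ h b‖ ≤ δ := by
    rw [← CStarRing.norm_star_mul_self, hsq]
    refine norm_cfcₙ_le fun t _ ↦ ?_
    have h1 : (t - h t * t) - (t - h t * t) * h t = t * (δ / (|t| + δ)) ^ 2 := by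
      have := (hpos t).ne'
      simp only [h]
      field_simp
      ring
    rw [h1, norm_mul, norm_pow, Real.norm_eq_abs, Real.norm_eq_abs,
      abs_of_nonneg (div_nonneg hδ0.le (hpos t).le), div_pow, ← mul_div_assoc,
      div_le_iff₀ (pow_pos (hpos t) 2)]
    nlinarith [abs_nonneg t, mul_nonneg hδ0.le (sq_nonneg |t|),
      mul_nonneg (mul_nonneg hδ0.le hδ0.le) (abs_nonneg t), pow_pos hδ0 3]
  rw [dist_eq_norm]
  nlinarith [norm_nonneg (star a - star a * cfcₙ h b)]

end TwoSidedIdeal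

/-- Orthogonality of positive cosets modulo a closed two-sided ideal of a C*-algebra can be
lifted to orthogonality of positive representatives. -/
theorem exists_orthogonal_positive_lift {A : Type*} [NonUnitalCStarAlgebra A]
    [PartialOrder A] [StarOrderedRing A] (I : TwoSidedIdeal A) (hI : IsClosed (I : Set A))
    (x y : A) (hx : 0 ≤ x) (hy : 0 ≤ y) (hxy : x * y ∈ I) :
    ∃ x₁ y₁ : A, 0 ≤ x₁ ∧ 0 ≤ y₁ ∧ x₁ * y₁ = 0 ∧ x - x₁ ∈ I ∧ y - y₁ ∈ I := by
  have hxs : IsSelfAdjoint x := .of_nonneg hx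
  have hys : IsSelfAdjoint y := .of_nonneg hy
  have hd : IsSelfAdjoint (x - y) := hxs.sub hys
  have hs : IsSelfAdjoint (x + y) := hxs.add hys
  have hyx : y * x ∈ I := by
    simpa [hxs.star_eq, hys.star_eq] using TwoSidedIdeal.star_mem_of_isClosed hI hxy
  have hsq : (x + y) * (x + y) - star (x - y) * (x - y) ∈ I := by
    have := I.nsmul_mem 2 (I.add_mem hxy hyx)
    convert this using 1
    rw [hd.star_eq]
    noncomm_ring
  have hss : IsSelfAdjoint ((x + y) * (x + y)) := by
    simpa [hs.star_eq] using IsSelfAdjoint.star_mul_self (x + y)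
  have habs : (x + y) - CFC.abs (x - y) ∈ I := by
    have hss0 : 0 ≤ (x + y) * (x + y) := by
      simpa [hs.star_eq] using star_mul_self_nonneg (x + y)
    have := TwoSidedIdeal.cfcₙ_sub_cfcₙ_mem hI hss (.star_mul_self (x - y)) hsq
      Real.continuous_sqrt Real.sqrt_zero
    rwa [← CFC.sqrt_eq_real_sqrt _ hss0, ← CFC.sqrt_eq_real_sqrt _ (star_mul_self_nonneg _),
      CFC.sqrt_mul_self _ (add_nonneg hx hy)] at this
  have hsub := CFC.posPart_sub_negPart (x - y) hd
  have hpos : x - (x - y)⁺ ∈ I := by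
    have h2 : x - (x - y)⁺ = (1 / 2 : ℝ) • ((x + y) - CFC.abs (x - y)) := by
      have hadd : (x + y) - CFC.abs (x - y) = (2 : ℝ) • (x - (x - y)⁺) := by
        rw [eq_sub_of_add_eq (CFC.abs_add_self (x - y) hd), two_smul, two_smul]
        abel
      rw [hadd, smul_smul]
      norm_num
    rw [h2]
    exact TwoSidedIdeal.real_smul_mem_of_isClosed hI _ habs
  refine ⟨(x - y)⁺, (x - y)⁻, CFC.posPart_nonneg _, CFC.negPart_nonneg _,
    CFC.posPart_mul_negPart _, hpos, ?_⟩
  have hneg : y - (x - y)⁻ = x - (x - y)⁺ := by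
    rw [← sub_eq_zero] at hsub ⊢
    rw [← hsub]
    abel
  rwa [hneg]
end

section
/- Let A and B be C*-algebras and let T : A → B be a surjective orthogonality preserving bounded linear operator. Then the kernel of T is a closed two-sided (ring) ideal of A. -/
noncomputable section

open CStar

open Complex in
/-- For a bilinear map vanishing on pairs with zero product, and a chain `h` in which only
neighbours have nonzero product, the antisymmetric neighbour sum is a difference of two values. -/
theorem LinearMap.two_I_smul_sum_chain {R F : Type*} [CommRing R] [Algebra ℂ R] [AddCommGroup F]
    [Module ℂ F] (V : R →ₗ[ℂ] R →ₗ[ℂ] F) (hV : ∀ f g, f * g = 0 → V f g = 0) (h : ℕ → R)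
    (hh : ∀ k j, k + 1 < j → h k * h j = 0) (m : ℕ) :
    V (∑ k ∈ Finset.range (m + 1), I ^ k • h k) (∑ k ∈ Finset.range (m + 1), (-I) ^ k • h k) -
      V (∑ k ∈ Finset.range (m + 1), (-I) ^ k • h k) (∑ k ∈ Finset.range (m + 1), I ^ k • h k) =
    (2 * I) • ∑ k ∈ Finset.range m, (V (h (k + 1)) (h k) - V (h k) (h (k + 1))) := by
  induction m with
  | zero => simp
  | succ m ih =>
    have hz : ∀ c : ℂ, (∑ k ∈ Finset.range m, c ^ k • h k) * h (m + 1) = 0 := fun c ↦ by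
      rw [Finset.sum_mul]
      refine Finset.sum_eq_zero fun k hk ↦ ?_
      rw [smul_mul_assoc, hh k (m + 1) (by simpa using hk), smul_zero]
    have h1 : ∀ c : ℂ, V (∑ k ∈ Finset.range (m + 1), c ^ k • h k) (h (m + 1)) =
        c ^ m • V (h m) (h (m + 1)) := fun c ↦ by
      rw [Finset.sum_range_succ, map_add, LinearMap.add_apply, hV _ _ (hz c)]; simp
    have h2 : ∀ c : ℂ, V (h (m + 1)) (∑ k ∈ Finset.range (m + 1), c ^ k • h k) =
        c ^ m • V (h (m + 1)) (h m) := fun c ↦ by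
      rw [Finset.sum_range_succ, map_add, hV _ _ ((mul_comm _ _).trans (hz c))]; simp
    have e1 : I ^ (m + 1) * (-I) ^ m = I := by
      rw [pow_succ, mul_right_comm, ← mul_pow]; simp
    have e2 : (-I) ^ (m + 1) * I ^ m = -I := by
      rw [pow_succ, mul_right_comm, ← mul_pow]; simp
    have e3 : (-I) ^ (m + 1) * I ^ (m + 1) = 1 := by
      rw [← mul_pow]; simp
    rw [Finset.sum_range_succ (fun k ↦ V (h (k + 1)) (h k) - V (h k) (h (k + 1))) m, smul_add,
      ← ih, Finset.sum_range_succ _ (m + 1), Finset.sum_range_succ _ (m + 1)]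
    simp only [map_add, LinearMap.add_apply, map_smul, LinearMap.smul_apply, h1, h2, smul_add,
      smul_smul, e1, e2, e3, mul_comm (I ^ (m + 1)) ((-I) ^ (m + 1))]
    module

theorem sum_range_clamp {t : ℝ} (ht : 0 ≤ t) (m : ℕ) :
    ∑ k ∈ Finset.range m, max 0 (min 1 (t - k)) = min t m := by
  induction m with
  | zero => simp [ht]
  | succ m ih =>
    rw [Finset.sum_range_succ, ih]
    push_cast
    rcases le_total t m with h | h
    · rw [min_eq_left h, min_eq_left (h.trans (by linarith : (m : ℝ) ≤ m + 1)),
        max_eq_left ((min_le_right _ _).trans (sub_nonpos.2 h)), add_zero]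
    · rw [min_eq_right h, max_eq_right (le_min zero_le_one (by linarith)), ← min_add_add_left,
        add_sub_cancel, min_comm]

/-- A bilinear map on `C(K, ℂ)` that vanishes on pairs with zero product satisfies
`V b 1 = V 1 b` up to a constant, uniformly in the real function `b` with values in `[0, n]`. -/
theorem ContinuousMap.norm_apply_one_sub_le {K F : Type*} [TopologicalSpace K] [CompactSpace K]
    [NormedAddCommGroup F] [NormedSpace ℂ F] (V : C(K, ℂ) →ₗ[ℂ] C(K, ℂ) →ₗ[ℂ] F)
    (hV : ∀ f g, f * g = 0 → V f g = 0) {C : ℝ} (hC0 : 0 ≤ C) (hC : ∀ f g, ‖V f g‖ ≤ C * ‖f‖ * ‖g‖)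
    (b : C(K, ℝ)) (n : ℕ) (h0 : ∀ x, 0 ≤ b x) (hn : ∀ x, b x ≤ n) (β : C(K, ℂ))
    (hβ : ∀ x, β x = b x) : ‖V β 1 - V 1 β‖ ≤ C := by
  let ur : ℕ → K → ℝ := fun k x ↦ max 0 (min 1 (b x + 1 - k))
  have ur_mem (k x) : 0 ≤ ur k x ∧ ur k x ≤ 1 := ⟨le_max_left _ _, by simp [ur]⟩
  have ur_zero (x) : ur 0 x = 1 := by simp [ur, h0 x]
  have ur_anti (k x) : ur (k + 1) x ≤ ur k x := by
    simp only [ur]; gcongr; simp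
  have ur_or (k j) (hkj : k < j) (x) : ur j x = 0 ∨ ur k x = 1 := by
    have : (k : ℝ) + 1 ≤ j := by exact_mod_cast hkj
    simp only [ur]
    rcases le_total (b x + 1) j with h | h
    · left; rw [max_eq_left]; exact (min_le_right _ _).trans (by linarith)
    · right; rw [min_eq_left (by linarith)]; simp
  let u : ℕ → C(K, ℂ) := fun k ↦ ⟨fun x ↦ (ur k x : ℂ), by fun_prop⟩
  have u_zero : u 0 = 1 := by ext x; simp [u, ur_zero]
  have u_mul (k j) (hkj : k < j) : u j * u k = u j := by
    ext x
    rcases ur_or k j hkj x with h | h <;> simp [u, h]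
  have ur_sum (m : ℕ) (x) (hm : b x ≤ m) : ∑ k ∈ Finset.range m, ur (k + 1) x = b x := by
    rw [← min_eq_left hm, ← sum_range_clamp (h0 x) m]
    refine Finset.sum_congr rfl fun k _ ↦ ?_
    simp [ur]
  have u_sum : ∑ k ∈ Finset.range n, u (k + 1) = β := by
    ext x
    rw [hβ, ← ur_sum n x (hn x)]
    simp [u]
  let h : ℕ → C(K, ℂ) := fun k ↦ u k - u (k + 1)
  have hh (k j) (hkj : k + 1 < j) : h k * h j = 0 := by
    have h1 := u_mul k j (by omega)
    have h2 := u_mul (k + 1) j (by omega)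
    have h3 := u_mul k (j + 1) (by omega)
    have h4 := u_mul (k + 1) (j + 1) (by omega)
    simp only [h]
    linear_combination h1 - h2 - h3 + h4
  have hstep (k) : V (u (k + 1)) 1 - V 1 (u (k + 1)) =
      V (h (k + 1)) (h k) - V (h k) (h (k + 1)) := by
    have a1 := u_mul k (k + 1) (by omega)
    have a2 := u_mul (k + 1) (k + 2) (by omega)
    have a3 := u_mul k (k + 2) (by omega)
    have z1 : u (k + 2) * (1 - u (k + 1)) = 0 := by linear_combination -a2
    have z2 : h (k + 1) * (1 - u k) = 0 := by
      simp only [h]; linear_combination -a1 + a3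
    have b1 := hV _ _ z1
    have b2 := hV _ _ z2
    have b3 := hV _ _ ((mul_comm _ _).trans z1)
    have b4 := hV _ _ ((mul_comm _ _).trans z2)
    simp only [h, map_sub, LinearMap.sub_apply] at b1 b2 b3 b4 ⊢
    linear_combination (norm := module) b2 + b1 - b4 - b3
  have key := V.two_I_smul_sum_chain hV h hh n
  have hnorm (c : ℂ) (hc : ‖c‖ = 1) : ‖∑ k ∈ Finset.range (n + 1), c ^ k • h k‖ ≤ 1 := by
    rw [ContinuousMap.norm_le _ zero_le_one]
    intro x
    have : ∑ k ∈ Finset.range (n + 1), (ur k x - ur (k + 1) x) ≤ 1 := by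
      rw [Finset.sum_range_sub', ur_zero]
      linarith [(ur_mem (n + 1) x).1]
    refine le_trans ?_ this
    rw [ContinuousMap.coe_sum, Finset.sum_apply]
    refine norm_sum_le_of_le _ fun k _ ↦ ?_
    simp only [h, u, ContinuousMap.smul_apply, ContinuousMap.sub_apply, ContinuousMap.coe_mk,
      norm_smul, norm_pow, hc, one_pow, one_mul]
    rw [← Complex.ofReal_sub, Complex.norm_real, Real.norm_eq_abs,
      abs_of_nonneg (by linarith [ur_anti k x])]
  have hsum : V β 1 - V 1 β =
      ∑ k ∈ Finset.range n, (V (h (k + 1)) (h k) - V (h k) (h (k + 1))) := by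
    rw [← u_sum, map_sum, map_sum, LinearMap.sum_apply, ← Finset.sum_sub_distrib]
    exact Finset.sum_congr rfl fun k _ ↦ hstep k
  rw [← hsum] at key
  have hb (f g : C(K, ℂ)) (hf : ‖f‖ ≤ 1) (hg : ‖g‖ ≤ 1) : ‖V f g‖ ≤ C :=
    (hC f g).trans (by
      calc C * ‖f‖ * ‖g‖ ≤ C * 1 * 1 := by gcongr
        _ = C := by ring)
  have i1 := hnorm Complex.I (by simp)
  have i2 := hnorm (-Complex.I) (by simp)
  have := congrArg norm key
  rw [norm_smul] at this
  simp only [norm_mul, Complex.norm_ofNat, Complex.norm_I, mul_one] at this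
  linarith [norm_sub_le_of_le (hb _ _ i1 i2) (hb _ _ i2 i1)]

theorem ContinuousMap.apply_one_eq_of_mem_Icc {K F : Type*} [TopologicalSpace K] [CompactSpace K]
    [NormedAddCommGroup F] [NormedSpace ℂ F] (V : C(K, ℂ) →ₗ[ℂ] C(K, ℂ) →ₗ[ℂ] F)
    (hV : ∀ f g, f * g = 0 → V f g = 0) {C : ℝ} (hC0 : 0 ≤ C)
    (hC : ∀ f g, ‖V f g‖ ≤ C * ‖f‖ * ‖g‖) (a : C(K, ℝ)) (ha : ∀ x, a x ∈ Set.Icc 0 1)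
    (α : C(K, ℂ)) (hα : ∀ x, α x = a x) : V α 1 = V 1 α := by
  rw [← sub_eq_zero, ← norm_le_zero_iff]
  refine le_of_forall_pos_le_add fun ε hε ↦ ?_
  obtain ⟨n, hn⟩ := exists_nat_gt (C / ε)
  have hn0 : (0 : ℝ) < n := (div_nonneg hC0 hε.le).trans_lt hn
  have := norm_apply_one_sub_le V hV hC0 hC ((n : ℝ) • a) n
    (fun x ↦ mul_nonneg hn0.le (ha x).1) (fun x ↦ mul_le_of_le_one_right hn0.le (ha x).2)
    ((n : ℂ) • α) (fun x ↦ by simp [hα])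
  rw [map_smul, map_smul, LinearMap.smul_apply, ← smul_sub, norm_smul, Complex.norm_natCast]
    at this
  rw [div_lt_iff₀ hε] at hn
  rw [zero_add]
  exact le_of_mul_le_mul_left (this.trans hn.le) hn0

/-- A bounded bilinear map on `C(K, ℂ)` that vanishes on pairs with zero product factors through
multiplication. -/
theorem ContinuousMap.apply_eq_apply_mul_one {K F : Type*} [TopologicalSpace K] [CompactSpace K]
    [NormedAddCommGroup F] [NormedSpace ℂ F] (V : C(K, ℂ) →ₗ[ℂ] C(K, ℂ) →ₗ[ℂ] F)
    (hV : ∀ f g, f * g = 0 → V f g = 0) {C : ℝ} (hC0 : 0 ≤ C)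
    (hC : ∀ f g, ‖V f g‖ ≤ C * ‖f‖ * ‖g‖) (f g : C(K, ℂ)) : V f g = V (f * g) 1 := by
  have hIcc (a : C(K, ℝ)) (ha : ∀ x, a x ∈ Set.Icc 0 1) (α : C(K, ℂ)) (hα : ∀ x, α x = a x) :
      V f α = V (f * α) 1 := by
    have := apply_one_eq_of_mem_Icc (V ∘ₗ LinearMap.mulLeft ℂ f)
      (fun x y hxy ↦ hV _ _ (by rw [LinearMap.mulLeft_apply, mul_assoc, hxy, mul_zero]))
      (C := C * ‖f‖) (by positivity)
      (fun x y ↦ (hC _ _).trans (by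
        rw [mul_assoc C ‖f‖ ‖x‖, LinearMap.mulLeft_apply]
        gcongr
        exact norm_mul_le f x)) a ha α hα
    simpa using this.symm
  have hreal (b : C(K, ℝ)) (β : C(K, ℂ)) (hβ : ∀ x, β x = b x) : V f β = V (f * β) 1 := by
    have hM : 0 < 2 * (‖b‖ + 1) := by positivity
    have key := hIcc ((2 * (‖b‖ + 1))⁻¹ • (b + ContinuousMap.const K (‖b‖ + 1))) (fun x ↦ by
      have := abs_le.1 (b.norm_coe_le_norm x)
      simp only [smul_apply, add_apply, const_apply, smul_eq_mul, Set.mem_Icc]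
      constructor
      · have : 0 ≤ b x + (‖b‖ + 1) := by linarith
        positivity
      · rw [inv_mul_le_one₀ hM]; linarith)
      (((2 * (‖b‖ + 1))⁻¹ : ℂ) • (β + ((‖b‖ + 1 : ℝ) : ℂ) • 1)) (fun x ↦ by simp [hβ])
    have hM' : (2 * (‖b‖ + 1) : ℂ)⁻¹ ≠ 0 := inv_ne_zero (by exact_mod_cast hM.ne')
    rw [mul_smul_comm, map_smul, map_smul, LinearMap.smul_apply] at key
    have := smul_right_injective F hM' key
    simpa [mul_add, add_left_inj] using this
  have hg : g = (⟨fun x ↦ ((g x).re : ℂ), by fun_prop⟩ : C(K, ℂ)) +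
      Complex.I • (⟨fun x ↦ ((g x).im : ℂ), by fun_prop⟩ : C(K, ℂ)) := by
    ext x; simp [mul_comm Complex.I, Complex.re_add_im]
  rw [hg, mul_add, map_add, map_add, LinearMap.add_apply, mul_smul_comm, map_smul, map_smul,
    LinearMap.smul_apply, hreal ⟨fun x ↦ (g x).re, by fun_prop⟩ _ fun x ↦ rfl,
    hreal ⟨fun x ↦ (g x).im, by fun_prop⟩ _ fun x ↦ rfl]

open scoped ContinuousMapZero

/-- The functional calculus of `a`, extended to functions not vanishing at `0` by sending the
constant function `1` to `e`. -/
def cfcWithUnit {A : Type*} [NonUnitalCStarAlgebra A] (e : A) {a : A} (ha : IsStarNormal a) :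
    C(quasispectrum ℂ a, ℂ) →ₗ[ℂ] A where
  toFun f := f 0 • e + cfcₙHom ha ⟨f - ContinuousMap.const _ (f 0), by simp⟩
  map_add' f g := by
    have : (⟨f + g - ContinuousMap.const _ ((f + g) 0), by simp⟩ : C(quasispectrum ℂ a, ℂ)₀) =
        ⟨f - ContinuousMap.const _ (f 0), by simp⟩ + ⟨g - ContinuousMap.const _ (g 0), by simp⟩ := by
      ext x; simp [add_sub_add_comm]
    rw [this, map_add, ContinuousMap.add_apply, add_smul]
    abel
  map_smul' c f := by
    have : (⟨c • f - ContinuousMap.const _ ((c • f) 0), by simp⟩ : C(quasispectrum ℂ a, ℂ)₀) =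
        c • ⟨f - ContinuousMap.const _ (f 0), by simp⟩ := by
      ext x; simp [mul_sub]
    rw [this, map_smul, ContinuousMap.smul_apply, smul_assoc, smul_add, RingHom.id_apply]

section cfcWithUnit

variable {A : Type*} [NonUnitalCStarAlgebra A] {e a : A} (ha : IsStarNormal a)

theorem cfcWithUnit_of_apply_zero (f : C(quasispectrum ℂ a, ℂ)) (hf : f 0 = 0) :
    cfcWithUnit e ha f = cfcₙHom ha ⟨f, hf⟩ := by
  simp only [cfcWithUnit, LinearMap.coe_mk, AddHom.coe_mk, hf, zero_smul, zero_add]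
  congr 1
  ext x
  simp

theorem cfcWithUnit_one : cfcWithUnit e ha 1 = e := by
  have : (⟨1 - ContinuousMap.const _ ((1 : C(quasispectrum ℂ a, ℂ)) 0), by simp⟩ :
      C(quasispectrum ℂ a, ℂ)₀) = 0 := by
    ext x; simp
  simp only [cfcWithUnit, LinearMap.coe_mk, AddHom.coe_mk]
  rw [this, map_zero (cfcₙHom ha), add_zero, ContinuousMap.one_apply, one_smul]

theorem cfcWithUnit_id :
    cfcWithUnit e ha (ContinuousMap.restrict _ (.id ℂ)) = a :=
  (cfcWithUnit_of_apply_zero ha _ rfl).trans (cfcₙHom_id ha)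

theorem cfcWithUnit_id_mul_id :
    cfcWithUnit e ha (ContinuousMap.restrict _ (.id ℂ) * ContinuousMap.restrict _ (.id ℂ)) =
      a * a := by
  rw [cfcWithUnit_of_apply_zero ha _ (mul_zero _)]
  conv_rhs => rw [← cfcₙHom_id (R := ℂ) ha, ← map_mul]
  rfl

theorem mul_cfcₙHom_eq_self (h1 : e * a = a) (h2 : e * star a = star a)
    (f : C(quasispectrum ℂ a, ℂ)₀) : e * cfcₙHom ha f = cfcₙHom ha f := by
  induction f using ContinuousMapZero.induction_on_of_compact with
  | zero => simp
  | smul r f hf => rw [map_smul, mul_smul_comm, hf]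
  | id => rwa [cfcₙHom_id ha]
  | star_id => rwa [map_star, cfcₙHom_id]
  | add f g hf hg => rw [map_add, mul_add, hf, hg]
  | mul f g hf hg => rw [map_mul, ← mul_assoc, hf]
  | frequently f hf =>
    exact hf.mem_of_closed <| isClosed_eq
      (continuous_const.mul (cfcₙHom_continuous ha)) (cfcₙHom_continuous ha)

theorem cfcWithUnit_mul_eq_zero (he : IsSelfAdjoint e) (h1 : e * a = a) (h2 : a * e = a)
    (f g : C(quasispectrum ℂ a, ℂ)) (hfg : f * g = 0) :
    cfcWithUnit e ha f * cfcWithUnit e ha g = 0 := by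
  have h3 : e * star a = star a := by simpa [he.star_eq] using congrArg star h2
  have hl := mul_cfcₙHom_eq_self (e := e) ha h1 h3
  have hr (k : C(quasispectrum ℂ a, ℂ)₀) : cfcₙHom ha k * e = cfcₙHom ha k := by
    simpa [he.star_eq, ← map_star] using congrArg star (hl (star k))
  have aux (p q : C(quasispectrum ℂ a, ℂ)) (hpq : p * q = 0) (hp : p 0 = 0) :
      cfcWithUnit e ha p * cfcWithUnit e ha q = 0 ∧
      cfcWithUnit e ha q * cfcWithUnit e ha p = 0 := by
    rw [cfcWithUnit_of_apply_zero ha p hp]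
    simp only [cfcWithUnit, LinearMap.coe_mk, AddHom.coe_mk, mul_add, add_mul, mul_smul_comm,
      smul_mul_assoc, hl, hr, ← map_mul, ← map_smul, ← map_add]
    rw [← map_zero (cfcₙHom (R := ℂ) ha)]
    constructor <;> congr 1 <;> ext x <;>
      · have hx : p x * q x = 0 := DFunLike.congr_fun hpq x
        simp [-mul_eq_zero]
        linear_combination hx
  have h0 : f 0 * g 0 = 0 := DFunLike.congr_fun hfg 0
  rcases mul_eq_zero.1 h0 with h | h
  · exact (aux f g hfg h).1
  · exact (aux g f ((mul_comm _ _).trans hfg) h).2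

theorem norm_cfcWithUnit_le (f : C(quasispectrum ℂ a, ℂ)) :
    ‖cfcWithUnit e ha f‖ ≤ (‖e‖ + 2) * ‖f‖ := by
  have h0 : ‖f 0‖ ≤ ‖f‖ := f.norm_coe_le_norm 0
  simp only [cfcWithUnit, LinearMap.coe_mk, AddHom.coe_mk]
  refine (norm_add_le _ _).trans ?_
  rw [norm_smul, norm_cfcₙHom a _ ha]
  have : ‖(⟨f - ContinuousMap.const _ (f 0), by simp⟩ : C(quasispectrum ℂ a, ℂ)₀)‖ ≤ 2 * ‖f‖ := by
    change ‖f - ContinuousMap.const _ (f 0)‖ ≤ _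
    rw [ContinuousMap.norm_le _ (by positivity)]
    intro x
    refine (norm_sub_le _ _).trans ?_
    rw [ContinuousMap.const_apply]
    linarith [f.norm_coe_le_norm x]
  nlinarith [norm_nonneg e]

end cfcWithUnit

theorem exists_isSelfAdjoint_localUnit {A : Type*} [NonUnitalCStarAlgebra A] {e z : A}
    (he : IsSelfAdjoint e) (h1 : e * z = z) (h2 : z * e = z) :
    ∃ x y : A, IsSelfAdjoint x ∧ IsSelfAdjoint y ∧ (e * x = x ∧ x * e = x) ∧
      (e * y = y ∧ y * e = y) ∧ z = x + Complex.I • y := by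
  have h3 : e * star z = star z := by simpa [he.star_eq] using congrArg star h2
  have h4 : star z * e = star z := by simpa [he.star_eq] using congrArg star h1
  refine ⟨realPart z, imaginaryPart z, (realPart z).2, (imaginaryPart z).2, ?_, ?_,
    (realPart_add_I_smul_imaginaryPart z).symm⟩
  · rw [realPart_apply_coe, mul_smul_comm, smul_mul_assoc, mul_add, add_mul, h1, h2, h3, h4]
    exact ⟨rfl, rfl⟩
  · rw [imaginaryPart_apply_coe, mul_smul_comm, smul_mul_assoc, mul_smul_comm, smul_mul_assoc,
      mul_sub, sub_mul, h1, h2, h3, h4]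
    exact ⟨rfl, rfl⟩

section zeroProduct

variable {A F : Type*} [NonUnitalCStarAlgebra A] [NormedAddCommGroup F] [NormedSpace ℂ F]

theorem LinearMap.apply_localUnit_of_isSelfAdjoint (V : A →ₗ[ℂ] A →ₗ[ℂ] F)
    (hV : ∀ x y, x * y = 0 → y * x = 0 → V x y = 0) {C : ℝ} (hC0 : 0 ≤ C)
    (hC : ∀ x y, ‖V x y‖ ≤ C * ‖x‖ * ‖y‖) {e : A} (he : IsSelfAdjoint e) {a : A}
    (ha' : IsSelfAdjoint a) (h1 : e * a = a) (h2 : a * e = a) :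
    V e a = V a e ∧ V a a = V (a * a) e := by
  have ha : IsStarNormal a := ha'.isStarNormal
  have key := ContinuousMap.apply_eq_apply_mul_one
    (V.compl₁₂ (cfcWithUnit e ha) (cfcWithUnit e ha))
    (fun f g hfg ↦ hV _ _ (cfcWithUnit_mul_eq_zero ha he h1 h2 f g hfg)
      (cfcWithUnit_mul_eq_zero ha he h1 h2 g f ((mul_comm _ _).trans hfg)))
    (C := C * (‖e‖ + 2) * (‖e‖ + 2)) (by positivity)
    (fun f g ↦ (hC _ _).trans (by
      calc _ ≤ C * ((‖e‖ + 2) * ‖f‖) * ((‖e‖ + 2) * ‖g‖) := by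
            gcongr <;> exact norm_cfcWithUnit_le ha _
        _ = _ := by ring))
  simp only [LinearMap.compl₁₂_apply, cfcWithUnit_one] at key
  constructor
  · simpa only [cfcWithUnit_one, cfcWithUnit_id, one_mul] using
      key 1 (ContinuousMap.restrict _ (.id ℂ))
  · simpa only [cfcWithUnit_id_mul_id, cfcWithUnit_id] using
      key (ContinuousMap.restrict _ (.id ℂ)) (ContinuousMap.restrict _ (.id ℂ))

theorem LinearMap.apply_localUnit_comm (V : A →ₗ[ℂ] A →ₗ[ℂ] F)
    (hV : ∀ x y, x * y = 0 → y * x = 0 → V x y = 0) {C : ℝ} (hC0 : 0 ≤ C)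
    (hC : ∀ x y, ‖V x y‖ ≤ C * ‖x‖ * ‖y‖) {e : A} (he : IsSelfAdjoint e) {z : A}
    (h1 : e * z = z) (h2 : z * e = z) : V e z = V z e := by
  obtain ⟨x, y, hx, hy, ⟨hx1, hx2⟩, ⟨hy1, hy2⟩, rfl⟩ := exists_isSelfAdjoint_localUnit he h1 h2
  simp only [map_add, map_smul, LinearMap.add_apply, LinearMap.smul_apply,
    (V.apply_localUnit_of_isSelfAdjoint hV hC0 hC he hx hx1 hx2).1,
    (V.apply_localUnit_of_isSelfAdjoint hV hC0 hC he hy hy1 hy2).1]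

theorem LinearMap.apply_add_apply_swap (V : A →ₗ[ℂ] A →ₗ[ℂ] F)
    (hV : ∀ x y, x * y = 0 → y * x = 0 → V x y = 0) {C : ℝ} (hC0 : 0 ≤ C)
    (hC : ∀ x y, ‖V x y‖ ≤ C * ‖x‖ * ‖y‖) {e : A} (he : IsSelfAdjoint e) {z w : A}
    (h1 : e * z = z) (h2 : z * e = z) (h3 : e * w = w) (h4 : w * e = w) :
    V z w + V w z = V (z * w + w * z) e := by
  have sa (x y : A) (hx : IsSelfAdjoint x) (hy : IsSelfAdjoint y) (hxe : e * x = x ∧ x * e = x)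
      (hye : e * y = y ∧ y * e = y) : V x y + V y x = V (x * y + y * x) e := by
    have k1 := (V.apply_localUnit_of_isSelfAdjoint hV hC0 hC he hx hxe.1 hxe.2).2
    have k2 := (V.apply_localUnit_of_isSelfAdjoint hV hC0 hC he hy hye.1 hye.2).2
    have k3 := (V.apply_localUnit_of_isSelfAdjoint hV hC0 hC he (hx.add hy)
      (by rw [mul_add, hxe.1, hye.1]) (by rw [add_mul, hxe.2, hye.2])).2
    simp only [map_add, LinearMap.add_apply, mul_add, add_mul] at k3 ⊢
    linear_combination (norm := module) k3 - k1 - k2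
  obtain ⟨x, y, hx, hy, hx1, hy1, rfl⟩ := exists_isSelfAdjoint_localUnit he h1 h2
  obtain ⟨p, q, hp, hq, hp1, hq1, rfl⟩ := exists_isSelfAdjoint_localUnit he h3 h4
  have k1 := sa x p hx hp hx1 hp1
  have k2 := sa x q hx hq hx1 hq1
  have k3 := sa y p hy hp hy1 hp1
  have k4 := sa y q hy hq hy1 hq1
  simp only [map_add, map_smul, LinearMap.add_apply, LinearMap.smul_apply, mul_add, add_mul,
    mul_smul_comm, smul_mul_assoc] at k1 k2 k3 k4 ⊢
  linear_combination (norm := module) k1 + Complex.I • k2 + Complex.I • k3 +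
    (Complex.I * Complex.I) • k4

end zeroProduct

section LocalUnits

open Filter Topology

variable {A : Type*} [NonUnitalCStarAlgebra A]

theorem exists_isSelfAdjoint_approximateUnit (x y : A) {ε : ℝ} (hε : 0 < ε) :
    ∃ u : A, IsSelfAdjoint u ∧ ‖u‖ ≤ 1 ∧ ‖u * x - x‖ ≤ ε ∧ ‖x * u - x‖ ≤ ε ∧
      ‖u * y - y‖ ≤ ε ∧ ‖y * u - y‖ ≤ ε := by
  let _ := CStarAlgebra.spectralOrder A
  have := CStarAlgebra.spectralOrderedRing A
  have hl := CStarAlgebra.increasingApproximateUnit A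
  have close {f : A → A} {z : A} (h : Tendsto f (CStarAlgebra.approximateUnit A) (𝓝 z)) :
      ∀ᶠ u in CStarAlgebra.approximateUnit A, ‖f u - z‖ ≤ ε :=
    (h.eventually (Metric.closedBall_mem_nhds z hε)).mono fun u hu ↦ by
      rwa [← mem_closedBall_iff_norm]
  obtain ⟨u, hu⟩ := (hl.eventually_isSelfAdjoint.and <| hl.eventually_norm.and <|
    (close (hl.tendsto_mul_right x)).and <| (close (hl.tendsto_mul_left x)).and <|
    (close (hl.tendsto_mul_right y)).and <| close (hl.tendsto_mul_left y)).exists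
  exact ⟨u, hu⟩

/-- A selfadjoint element `u` is within `ε` of some `w` which has a local unit. -/
theorem IsSelfAdjoint.exists_localUnit {u : A} (hu : IsSelfAdjoint u) {ε : ℝ} (hε : 0 < ε) :
    ∃ e w : A, IsSelfAdjoint e ∧ ‖e‖ ≤ 1 ∧ IsSelfAdjoint w ∧ ‖w - u‖ ≤ ε ∧
      e * w = w ∧ w * e = w := by
  have hc : Continuous fun t : ℝ ↦ min 1 (|t| / ε) := by fun_prop
  have hd : Continuous fun t : ℝ ↦ t - max (-ε) (min t ε) := by fun_prop
  have h0 : (fun t : ℝ ↦ t - max (-ε) (min t ε)) 0 = 0 := by simp [hε.le]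
  have hmul (t : ℝ) : min 1 (|t| / ε) * (t - max (-ε) (min t ε)) = t - max (-ε) (min t ε) := by
    rcases le_total |t| ε with h | h
    · obtain ⟨h1, h2⟩ := abs_le.1 h
      rw [min_eq_left h2, max_eq_right h1, sub_self, mul_zero]
    · rw [min_eq_left ((one_le_div hε).2 h), one_mul]
  refine ⟨cfcₙ (fun t : ℝ ↦ min 1 (|t| / ε)) u, cfcₙ (fun t : ℝ ↦ t - max (-ε) (min t ε)) u,
    cfcₙ_predicate _ u, norm_cfcₙ_le fun t _ ↦ ?_, cfcₙ_predicate _ u, ?_, ?_, ?_⟩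
  · rw [Real.norm_of_nonneg (by positivity)]
    exact min_le_left _ _
  · nth_rewrite 2 [← cfcₙ_id' ℝ u]
    rw [← cfcₙ_sub _ _ u hd.continuousOn h0]
    refine norm_cfcₙ_le fun t _ ↦ ?_
    rw [sub_sub_cancel_left, norm_neg, Real.norm_eq_abs, abs_le]
    exact ⟨le_max_left _ _, max_le (by linarith) (min_le_right _ _)⟩
  · rw [← cfcₙ_mul _ _ u hc.continuousOn (by simp) hd.continuousOn h0]
    simp only [hmul]
  · rw [← cfcₙ_mul _ _ u hd.continuousOn h0 hc.continuousOn (by simp)]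
    simp only [mul_comm _ (min _ _), hmul]

/-- Any two elements can be approximated by elements sharing a common local unit. -/
theorem exists_seq_localUnit (x y : A) :
    ∃ e w : ℕ → A, (∀ n, IsSelfAdjoint (e n)) ∧ (∀ n, ‖e n‖ ≤ 1) ∧ (∀ n, IsSelfAdjoint (w n)) ∧
      (∀ n, e n * w n = w n) ∧ (∀ n, w n * e n = w n) ∧
      Tendsto (fun n ↦ w n * x * w n) atTop (𝓝 x) ∧
      Tendsto (fun n ↦ w n * y * w n) atTop (𝓝 y) := by
  have step (n : ℕ) : ∃ e w : A, IsSelfAdjoint e ∧ ‖e‖ ≤ 1 ∧ IsSelfAdjoint w ∧ e * w = w ∧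
      w * e = w ∧ ‖w * x * w - x‖ ≤ 3 * (‖x‖ + 1) * (1 / ((n : ℝ) + 1)) ∧
      ‖w * y * w - y‖ ≤ 3 * (‖y‖ + 1) * (1 / ((n : ℝ) + 1)) := by
    have hε : 0 < 1 / ((n : ℝ) + 1) := Nat.one_div_pos_of_nat
    have hε1 : 1 / ((n : ℝ) + 1) ≤ 1 := by
      rw [div_le_one (by positivity)]
      linarith [n.cast_nonneg (α := ℝ)]
    generalize 1 / ((n : ℝ) + 1) = ε at hε hε1 ⊢
    obtain ⟨u, hu, hu1, hux, hxu, huy, hyu⟩ := exists_isSelfAdjoint_approximateUnit x y hε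
    obtain ⟨e, w, he, he1, hw, hwu, hew, hwe⟩ := hu.exists_localUnit hε
    have hw2 : ‖w‖ ≤ 2 := by linarith [norm_sub_norm_le w u]
    have bound (z : A) (h1 : ‖u * z - z‖ ≤ ε) (h2 : ‖z * u - z‖ ≤ ε) :
        ‖w * z * w - z‖ ≤ 3 * (‖z‖ + 1) * ε := by
      have e1 : ‖w * z - z‖ ≤ ε * ‖z‖ + ε := by
        rw [show w * z - z = (w - u) * z + (u * z - z) by noncomm_ring]
        exact (norm_add_le _ _).trans (add_le_add ((norm_mul_le _ _).trans (by gcongr)) h1)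
      have e2 : ‖z * w - z‖ ≤ ‖z‖ * ε + ε := by
        rw [show z * w - z = z * (w - u) + (z * u - z) by noncomm_ring]
        exact (norm_add_le _ _).trans (add_le_add ((norm_mul_le _ _).trans (by gcongr)) h2)
      calc ‖w * z * w - z‖ = ‖(w * z - z) * w + (z * w - z)‖ := by
            congr 1; noncomm_ring
        _ ≤ ‖w * z - z‖ * ‖w‖ + ‖z * w - z‖ :=
            (norm_add_le _ _).trans (add_le_add_left (norm_mul_le _ _) _)
        _ ≤ (ε * ‖z‖ + ε) * 2 + (‖z‖ * ε + ε) := by gcongr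
        _ = _ := by ring
    exact ⟨e, w, he, he1, hw, hew, hwe, bound x hux hxu, bound y huy hyu⟩
  choose e w he he1 hw hew hwe hx hy using step
  have lim (z : A) (h : ∀ n, ‖w n * z * w n - z‖ ≤ 3 * (‖z‖ + 1) * (1 / ((n : ℝ) + 1))) :
      Tendsto (fun n ↦ w n * z * w n) atTop (𝓝 z) := by
    rw [tendsto_iff_norm_sub_tendsto_zero]
    refine squeeze_zero (fun _ ↦ norm_nonneg _) h ?_
    simpa using (tendsto_one_div_add_atTop_nhds_zero_nat (𝕜 := ℝ)).const_mul (3 * (‖z‖ + 1))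
  exact ⟨e, w, he, he1, hw, hew, hwe, lim x hx, lim y hy⟩

end LocalUnits

section OrthogonalityPreserving

open Filter Topology

variable {A B : Type*} [NonUnitalCStarAlgebra A] [NonUnitalCStarAlgebra B]

namespace ContinuousLinearMap

/-- The bilinear map `(x, y) ↦ T x * star (T (star y))`. -/
def mulStarBilin (T : A →L[ℂ] B) : A →ₗ[ℂ] A →ₗ[ℂ] B :=
  LinearMap.mk₂ ℂ (fun x y ↦ T x * star (T (star y))) (by simp [add_mul])
    (by simp [smul_mul_assoc]) (by simp [mul_add]) (by simp [mul_smul_comm])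

/-- The bilinear map `(x, y) ↦ star (T (star y)) * T x`. -/
def starMulBilin (T : A →L[ℂ] B) : A →ₗ[ℂ] A →ₗ[ℂ] B :=
  LinearMap.mk₂ ℂ (fun x y ↦ star (T (star y)) * T x) (by simp [mul_add])
    (by simp [mul_smul_comm]) (by simp [add_mul]) (by simp [smul_mul_assoc])

theorem norm_mulStarBilin_le (T : A →L[ℂ] B) (x y : A) :
    ‖T.mulStarBilin x y‖ ≤ ‖T‖ * ‖T‖ * ‖x‖ * ‖y‖ := by
  calc ‖T x * star (T (star y))‖ ≤ ‖T x‖ * ‖T (star y)‖ := by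
        simpa only [norm_star] using norm_mul_le (T x) (star (T (star y)))
    _ ≤ (‖T‖ * ‖x‖) * (‖T‖ * ‖star y‖) := by gcongr <;> exact T.le_opNorm _
    _ = _ := by rw [norm_star]; ring

theorem norm_starMulBilin_le (T : A →L[ℂ] B) (x y : A) :
    ‖T.starMulBilin x y‖ ≤ ‖T‖ * ‖T‖ * ‖x‖ * ‖y‖ := by
  calc ‖star (T (star y)) * T x‖ ≤ ‖T (star y)‖ * ‖T x‖ := by
        simpa only [norm_star] using norm_mul_le (star (T (star y))) (T x)
    _ ≤ (‖T‖ * ‖star y‖) * (‖T‖ * ‖x‖) := by gcongr <;> exact T.le_opNorm _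
    _ = _ := by rw [norm_star]; ring

theorem mulStarBilin_eq_zero {T : A →L[ℂ] B} (hop : ∀ a b : A, orth a b → orth (T a) (T b))
    (x y : A) (h1 : x * y = 0) (h2 : y * x = 0) : T.mulStarBilin x y = 0 :=
  (hop x (star y) (by simp [orth, h1, h2])).1

theorem starMulBilin_eq_zero {T : A →L[ℂ] B} (hop : ∀ a b : A, orth a b → orth (T a) (T b))
    (x y : A) (h1 : x * y = 0) (h2 : y * x = 0) : T.starMulBilin x y = 0 :=
  (hop x (star y) (by simp [orth, h1, h2])).2

theorem star_apply_star_mul_apply_localUnit {T : A →L[ℂ] B}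
    (hop : ∀ a b : A, orth a b → orth (T a) (T b)) {e z : A} (he : IsSelfAdjoint e)
    (h1 : e * z = z) (h2 : z * e = z) :
    star (T (star z)) * T e = star (T e) * T z := by
  simpa [starMulBilin, he.star_eq] using T.starMulBilin.apply_localUnit_comm
    (starMulBilin_eq_zero hop) (by positivity) T.norm_starMulBilin_le he h1 h2

theorem star_apply_mul_apply_add_swap {T : A →L[ℂ] B}
    (hop : ∀ a b : A, orth a b → orth (T a) (T b)) {e z w : A} (he : IsSelfAdjoint e)
    (h1 : e * z = z) (h2 : z * e = z) (h3 : e * w = w) (h4 : w * e = w) :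
    star (T (star w)) * T z + star (T (star z)) * T w = star (T e) * T (z * w + w * z) := by
  simpa [starMulBilin, he.star_eq, mul_add] using T.starMulBilin.apply_add_apply_swap
    (starMulBilin_eq_zero hop) (by positivity) T.norm_starMulBilin_le he h1 h2 h3 h4

theorem apply_mul_star_apply_add_swap {T : A →L[ℂ] B}
    (hop : ∀ a b : A, orth a b → orth (T a) (T b)) {e z w : A} (he : IsSelfAdjoint e)
    (h1 : e * z = z) (h2 : z * e = z) (h3 : e * w = w) (h4 : w * e = w) :
    T z * star (T (star w)) + T w * star (T (star z)) = T (z * w + w * z) * star (T e) := by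
  simpa [mulStarBilin, he.star_eq, add_mul] using T.mulStarBilin.apply_add_apply_swap
    (mulStarBilin_eq_zero hop) (by positivity) T.norm_mulStarBilin_le he h1 h2 h3 h4

theorem _root_.eq_zero_of_mul_star_add_mul_star_eq_zero {b c : B}
    (h : b * star b + c * star c = 0) : b = 0 := by
  let _ := CStarAlgebra.spectralOrder B
  have := CStarAlgebra.spectralOrderedRing B
  have h0 := (add_eq_zero_iff_of_nonneg (mul_star_self_nonneg b) (mul_star_self_nonneg c)).1 h
  exact CStarRing.mul_star_self_eq_zero_iff b |>.1 h0.1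

theorem apply_eq_zero_of_tendsto {T : A →L[ℂ] B}
    (hop : ∀ a b : A, orth a b → orth (T a) (T b)) {e z : ℕ → A} {z₀ : A}
    (he : ∀ n, IsSelfAdjoint (e n)) (h1 : ∀ n, e n * z n = z n)
    (h2 : ∀ n, z n * e n = z n) (hz : Tendsto z atTop (𝓝 z₀))
    (h : Tendsto (fun n ↦ star (T (e n)) * T (z n)) atTop (𝓝 0)) :
    T z₀ = 0 ∧ T (star z₀) = 0 := by
  have h1' (n) : e n * star (z n) = star (z n) := by
    simpa [(he n).star_eq] using congrArg star (h2 n)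
  have h2' (n) : star (z n) * e n = star (z n) := by
    simpa [(he n).star_eq] using congrArg star (h1 n)
  set P : A → B := fun z ↦ T z * star (T z) + T (star z) * star (T (star z)) with hP
  have hTz : Tendsto (fun n ↦ T (z n)) atTop (𝓝 (T z₀)) := (T.continuous.tendsto _).comp hz
  have hTz' : Tendsto (fun n ↦ T (star (z n))) atTop (𝓝 (T (star z₀))) :=
    (T.continuous.tendsto _).comp hz.star
  have hPlim : Tendsto (fun n ↦ P (z n)) atTop (𝓝 (P z₀)) :=
    (hTz.mul hTz.star).add (hTz'.mul hTz'.star)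
  have hPe (n) : P (z n) = T (z n * star (z n) + star (z n) * z n) * star (T (e n)) := by
    simpa [hP] using apply_mul_star_apply_add_swap hop (he n) (h1 n) (h2 n) (h1' n) (h2' n)
  have hstar : Tendsto (fun n ↦ star (T (e n)) * T (star (z n))) atTop (𝓝 0) := by
    have := h.star
    rw [star_zero] at this
    refine this.congr fun n ↦ ?_
    rw [star_mul, star_star]
    simpa using star_apply_star_mul_apply_localUnit hop (he n) (h1' n) (h2' n)
  have hinner : Tendsto (fun n ↦ star (T (e n)) * P (z n)) atTop (𝓝 0) := by
    simpa [hP, mul_add, mul_assoc] using (h.mul hTz.star).add (hstar.mul hTz'.star)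
  have hPP : P z₀ * P z₀ = 0 := by
    refine tendsto_nhds_unique (hPlim.mul hPlim) ?_
    have hlim : Tendsto (fun n ↦ T (z n * star (z n) + star (z n) * z n)) atTop
        (𝓝 (T (z₀ * star z₀ + star z₀ * z₀))) :=
      (T.continuous.tendsto _).comp ((hz.mul hz.star).add (hz.star.mul hz))
    have := hlim.mul hinner
    rw [mul_zero] at this
    refine this.congr fun n ↦ ?_
    nth_rewrite 2 [hPe n]
    rw [mul_assoc]
  have hP0 : P z₀ = 0 := by
    have hsa : star (P z₀) = P z₀ := by simp [hP]
    exact CStarRing.star_mul_self_eq_zero_iff (P z₀) |>.1 (by rw [hsa, hPP])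
  exact ⟨eq_zero_of_mul_star_add_mul_star_eq_zero hP0,
    eq_zero_of_mul_star_add_mul_star_eq_zero ((add_comm _ _).trans hP0)⟩

theorem apply_star_eq_zero {T : A →L[ℂ] B}
    (hop : ∀ a b : A, orth a b → orth (T a) (T b)) {x : A} (hx : T x = 0) : T (star x) = 0 := by
  obtain ⟨e, w, he, he1, hw, hew, hwe, hlim, -⟩ := exists_seq_localUnit x x
  refine (apply_eq_zero_of_tendsto hop he (fun n ↦ ?_) (fun n ↦ ?_) hlim ?_).2
  · rw [← mul_assoc, ← mul_assoc, hew]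
  · rw [mul_assoc, hwe]
  · have hT : Tendsto (fun n ↦ T (w n * x * w n)) atTop (𝓝 0) := by
      simpa [hx, Function.comp_def] using (T.continuous.tendsto x).comp hlim
    refine squeeze_zero_norm (a := fun n ↦ ‖T‖ * ‖T (w n * x * w n)‖) (fun n ↦ ?_)
      (by simpa using hT.norm.const_mul ‖T‖)
    refine (norm_mul_le _ _).trans ?_
    rw [norm_star]
    gcongr
    exact T.unit_le_opNorm _ (he1 n)

theorem apply_mul_add_mul_swap_eq_zero {T : A →L[ℂ] B}
    (hop : ∀ a b : A, orth a b → orth (T a) (T b)) {x : A} (hx : T x = 0) (y : A) :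
    T (x * y + y * x) = 0 := by
  obtain ⟨e, w, he, he1, hw, hew, hwe, hlx, hly⟩ := exists_seq_localUnit x y
  have hl (n) (z : A) : e n * (w n * z * w n) = w n * z * w n := by
    rw [← mul_assoc, ← mul_assoc, hew]
  have hr (n) (z : A) : w n * z * w n * e n = w n * z * w n := by rw [mul_assoc, hwe]
  refine (apply_eq_zero_of_tendsto hop he (fun n ↦ ?_) (fun n ↦ ?_)
    ((hlx.mul hly).add (hly.mul hlx)) ?_).1
  · rw [mul_add, ← mul_assoc (e n), hl, ← mul_assoc (e n), hl]
  · rw [add_mul, mul_assoc _ _ (e n), hr, mul_assoc _ _ (e n), hr]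
  · simp only [← star_apply_mul_apply_add_swap hop (he _) (hl _ x) (hr _ x) (hl _ y) (hr _ y)]
    have hT {f : ℕ → A} {z : A} (hf : Tendsto f atTop (𝓝 z)) :
        Tendsto (fun n ↦ T (f n)) atTop (𝓝 (T z)) := (T.continuous.tendsto z).comp hf
    simpa [hx, apply_star_eq_zero hop hx] using
      ((hT hly.star).star.mul (hT hlx)).add ((hT hlx.star).star.mul (hT hly))

end ContinuousLinearMap

end OrthogonalityPreserving

section JordanIdeal

open Filter Topology

variable {A : Type*} [NonUnitalCStarAlgebra A]

theorem IsSelfAdjoint.exists_norm_mul_self_mul_sub_le {a : A} (ha : IsSelfAdjoint a) {ε : ℝ}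
    (hε : 0 < ε) : ∃ c : A, ‖a * a * c - a‖ ≤ ε := by
  have hpos (t : ℝ) : 0 < t ^ 2 + ε ^ 2 := by positivity
  have hc : Continuous fun t : ℝ ↦ t / (t ^ 2 + ε ^ 2) := by
    fun_prop (disch := exact fun t ↦ (hpos t).ne')
  refine ⟨cfcₙ (fun t : ℝ ↦ t / (t ^ 2 + ε ^ 2)) a, ?_⟩
  have key : a * a * cfcₙ (fun t : ℝ ↦ t / (t ^ 2 + ε ^ 2)) a - a =
      cfcₙ (fun t : ℝ ↦ t * t * (t / (t ^ 2 + ε ^ 2)) - t) a := by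
    rw [cfcₙ_sub _ _ a (by fun_prop) (by simp), cfcₙ_mul _ _ a (by fun_prop) (by simp)
      hc.continuousOn (by simp), cfcₙ_mul _ _ a, cfcₙ_id' ℝ a]
  rw [key]
  refine norm_cfcₙ_le fun t _ ↦ ?_
  have : t * t * (t / (t ^ 2 + ε ^ 2)) - t = -(t * ε ^ 2) / (t ^ 2 + ε ^ 2) := by
    field_simp [(hpos t).ne']
    ring
  rw [this, norm_div, norm_neg, Real.norm_of_nonneg (hpos t).le, div_le_iff₀ (hpos t), norm_mul,
    Real.norm_of_nonneg (sq_nonneg ε), Real.norm_eq_abs, ← sq_abs t]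
  nlinarith [mul_nonneg hε.le (sq_nonneg (|t| - ε)), mul_nonneg hε.le (sq_nonneg (|t| + ε)),
    abs_nonneg t]

/-- A closed selfadjoint Jordan ideal of a C*-algebra is a right ideal. -/
theorem Submodule.mul_mem_of_jordan {J : Submodule ℂ A} (hJ : IsClosed (J : Set A))
    (hstar : ∀ a ∈ J, star a ∈ J) (hjordan : ∀ a ∈ J, ∀ b, a * b + b * a ∈ J) {a : A}
    (ha : a ∈ J) (b : A) : a * b ∈ J := by
  have half {x : A} (hx : x + x ∈ J) : x ∈ J := by
    have := J.smul_mem (2⁻¹ : ℂ) hx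
    rwa [← two_smul ℂ x, inv_smul_smul₀ two_ne_zero] at this
  have sq {a : A} (ha : a ∈ J) (b : A) : a * a * b ∈ J := by
    refine half ?_
    have h := J.add_mem (hjordan a ha (a * b - b * a)) (hjordan _ (half (hjordan a ha a)) b)
    convert h using 1
    noncomm_ring
  have sa {a : A} (h : IsSelfAdjoint a) (ha : a ∈ J) : a * b ∈ J := by
    rw [← SetLike.mem_coe, ← hJ.closure_eq, Metric.mem_closure_iff]
    intro ε hε
    obtain ⟨c, hc⟩ := h.exists_norm_mul_self_mul_sub_le (ε := ε / (‖b‖ + 1)) (by positivity)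
    refine ⟨a * a * (c * b), sq ha _, ?_⟩
    rw [dist_comm, dist_eq_norm, ← mul_assoc, ← sub_mul]
    calc _ ≤ ε / (‖b‖ + 1) * ‖b‖ := (norm_mul_le _ _).trans (by gcongr)
      _ < ε / (‖b‖ + 1) * (‖b‖ + 1) := by gcongr; linarith
      _ = ε := by field_simp
  have hre : (realPart a : A) ∈ J := by
    rw [realPart_apply_coe]
    exact J.smul_of_tower_mem _ (J.add_mem ha (hstar a ha))
  have him : (imaginaryPart a : A) ∈ J := by
    rw [imaginaryPart_apply_coe]
    exact J.smul_mem _ (J.smul_of_tower_mem _ (J.sub_mem ha (hstar a ha)))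
  rw [← realPart_add_I_smul_imaginaryPart a, add_mul, smul_mul_assoc]
  exact J.add_mem (sa (realPart a).2 hre) (J.smul_mem _ (sa (imaginaryPart a).2 him))

end JordanIdeal

/-- The kernel of a surjective orthogonality preserving bounded linear operator between
C*-algebras is a closed two-sided (ring) ideal. -/
theorem ker_of_surjective_op_isTwoSidedIdeal {A B : Type*} [NonUnitalCStarAlgebra A]
    [NonUnitalCStarAlgebra B] (T : A →L[ℂ] B) (hT : Function.Surjective T)
    (hop : ∀ a b : A, orth a b → orth (T a) (T b)) :
    ∃ I : TwoSidedIdeal A, IsClosed (I : Set A) ∧ ∀ a : A, a ∈ I ↔ T a = 0 := by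
  have hclosed : IsClosed (T ⁻¹' {0}) := isClosed_singleton.preimage T.continuous
  have hright (a b : A) (ha : T a = 0) : T (a * b) = 0 :=
    Submodule.mul_mem_of_jordan (J := T.ker) hclosed (fun _ h ↦ T.apply_star_eq_zero hop h)
      (fun _ h b ↦ T.apply_mul_add_mul_swap_eq_zero hop h b) ha b
  have hleft (a b : A) (hb : T b = 0) : T (a * b) = 0 := by
    simpa using T.apply_star_eq_zero hop (hright (star b) (star a) (T.apply_star_eq_zero hop hb))
  let I : TwoSidedIdeal A := .mk' (T.ker : Set A) T.ker.zero_mem T.ker.add_mem T.ker.neg_mem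
    (hleft _ _) (hright _ _)
  have hI (a : A) : a ∈ I ↔ T a = 0 := TwoSidedIdeal.mem_mk' ..
  exact ⟨I, by rwa [show (I : Set A) = T ⁻¹' {0} from Set.ext hI], hI⟩
end
end

section
/- Let A be a unital C*-algebra, let u ∈ A be a unitary, and let h ∈ A be an element which is central for the u-isotope Jordan product, in the sense that h ∘_u (x ∘_u y) = (h ∘_u x) ∘_u y for all x, y ∈ A. Then {h ∘_u x, y, z} = h ∘_u {x, y, z} for all x, y, z ∈ A, where {x,y,z} = (1/2)(x y* z + z y* x). -/
noncomputable section

open CStar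

/-- Left multiplication by a unitary `u` carries the Jordan product to the `u`-isotope product. -/
lemma CStar.jmulIso_mul_mul {A : Type*} [CStarAlgebra A] {u : A} (hu : u ∈ unitary A) (a b : A) :
    jmulIso u (u * a) (u * b) = u * ((2 : ℂ)⁻¹ • (a * b + b * a)) := by
  have h1 (c d : A) : u * c * star u * (u * d) = u * (c * d) := by
    rw [mul_assoc (u * c), ← mul_assoc (star u), Unitary.star_mul_self_of_mem hu, one_mul, mul_assoc]
  rw [jmulIso, h1, h1, mul_smul_comm, mul_add]

/-- If all commutators with `k` are central in a C*-algebra, then `k` is central. -/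
lemma CStar.commute_of_commute_commutator {A : Type*} [CStarAlgebra A] {k : A}
    (hk : ∀ x y : A, Commute (k * y - y * k) x) (y : A) : Commute k y := by
  set c := k * y - y * k with hc
  have hcc : ∀ x, c * x = x * c := fun x ↦ hk x y
  have hsq : c * c = 0 := by
    have h1 : k * (y * k) - y * k * k = c * k := by rw [hc]; noncomm_ring
    have h2 : c * k * y = y * (c * k) := by
      rw [← h1]; exact hk y (y * k)
    calc c * c = c * k * y - c * y * k := by nth_rw 2 [hc]; noncomm_ring
      _ = 0 := by rw [h2, hcc y, mul_assoc, sub_self]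
  have h0 : star c * c = 0 := by
    refine (CStarRing.star_mul_self_eq_zero_iff (star c * c)).1 ?_
    rw [star_mul, star_star, mul_assoc, ← mul_assoc c, hcc (star c), mul_assoc (star c) c c, hsq,
      mul_zero, mul_zero]
  exact sub_eq_zero.1 ((CStarRing.star_mul_self_eq_zero_iff c).1 h0)

/-- An element that associates with all pairs for the Jordan product of a C*-algebra is central. -/
lemma CStar.commute_of_jordan_central {A : Type*} [CStarAlgebra A] {k : A}
    (hk : ∀ x y : A, k * (x * y + y * x) + (x * y + y * x) * k =
      (k * x + x * k) * y + y * (k * x + x * k)) (y : A) : Commute k y := by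
  refine commute_of_commute_commutator (fun x y ↦ ?_) y
  have h := sub_eq_zero.2 (hk x y)
  refine sub_eq_zero.1 (Eq.trans ?_ h)
  noncomm_ring

/-- If `h` is central for the `u`-isotope Jordan product on a unital C*-algebra, then Jordan
multiplication by `h` in the isotope lies in the centroid of the triple product. -/
theorem isotope_central_mul_mem_centroid {A : Type*} [CStarAlgebra A] (u : A)
    (hu : u ∈ unitary A) (h : A)
    (hc : ∀ x y : A, jmulIso u h (jmulIso u x y) = jmulIso u (jmulIso u h x) y) :
    ∀ x y z : A, tp (jmulIso u h x) y z = jmulIso u h (tp x y z) := by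
  obtain ⟨k, rfl⟩ : ∃ k, u * k = h :=
    ⟨star u * h, by rw [← mul_assoc, Unitary.mul_star_self_of_mem hu, one_mul]⟩
  have hk : ∀ y, Commute k y := by
    refine commute_of_jordan_central fun x y ↦ ?_
    have h1 := hc (u * x) (u * y)
    simp only [jmulIso_mul_mul hu] at h1
    have h2 := congrArg (star u * ·) h1
    simp only [← mul_assoc, Unitary.star_mul_self_of_mem hu, one_mul] at h2
    simp only [mul_smul_comm, smul_mul_assoc, ← smul_add] at h2
    have two_inv_ne : (2 : ℂ)⁻¹ ≠ 0 := by norm_num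
    exact smul_right_injective A two_inv_ne (smul_right_injective A two_inv_ne h2)
  have hj (x : A) : jmulIso u (u * k) x = k * x := by
    rw [jmulIso, ← (hk u).eq, mul_assoc k, Unitary.mul_star_self_of_mem hu, mul_one, (hk u).eq,
      ← mul_assoc, mul_assoc x, Unitary.star_mul_self_of_mem hu, mul_one, ← (hk x).eq, ← two_smul ℂ,
      inv_smul_smul₀ two_ne_zero]
  intro x y z
  rw [hj, hj, tp, tp, mul_smul_comm, mul_add, ← mul_assoc (z * star y), ← (hk (z * star y)).eq]
  simp only [mul_assoc]
end
end

section
/- Let A be a C*-algebra and let d : A → A be a continuous linear map satisfying d(a ∘ b) = d(a) ∘ b + a ∘ d(b) and d(a*) = d(a)* for all a, b ∈ A (a continuous Jordan *-derivation). Then d(z) = 0 for every element z in the center of A (i.e., every z commuting with all elements of A), and consequently d(z ∘ x) = z ∘ d(x) for every central z and every x ∈ A. -/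
noncomputable section

open CStar

namespace CStar

variable {A : Type*} [NonUnitalCStarAlgebra A]

lemma map_mul_add_mul_of_map_jmul {d : A →L[ℂ] A}
    (hder : ∀ a b : A, d (jmul a b) = jmul (d a) b + jmul a (d b)) (a b : A) :
    d (a * b + b * a) = d a * b + b * d a + (a * d b + d b * a) := by
  have h := hder a b
  simp only [jmul, map_smul, ← smul_add] at h
  exact smul_right_injective A (inv_ne_zero two_ne_zero) h

lemma eq_zero_of_mul_self_eq_zero_of_commute_star {u : A} (hc : u * star u = star u * u)
    (hu : u * u = 0) : u = 0 := by
  have h : star (star u * u) * (star u * u) = 0 := by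
    rw [star_mul, star_star, mul_assoc, ← mul_assoc u, hc, mul_assoc, hu, mul_zero, mul_zero]
  exact (CStarRing.star_mul_self_eq_zero_iff u).1 ((CStarRing.star_mul_self_eq_zero_iff _).1 h)

/-- If all commutators with `w` are central, then `w` is central. -/
lemma commute_of_commutator_central {w : A}
    (hw : ∀ b c : A, (w * b - b * w) * c = c * (w * b - b * w)) (b : A) : w * b = b * w := by
  rw [← sub_eq_zero]
  apply eq_zero_of_mul_self_eq_zero_of_commute_star (hw b _)
  have h := hw (b * w) b
  have e : w * (b * w) - b * w * w = (w * b - b * w) * w := by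
    rw [sub_mul, mul_assoc, mul_assoc]
  rw [e, ← mul_assoc b, ← hw b b, mul_assoc, mul_assoc, ← sub_eq_zero, ← mul_sub] at h
  exact h

lemma map_central_of_map_jmul {d : A →L[ℂ] A}
    (hder : ∀ a b : A, d (jmul a b) = jmul (d a) b + jmul a (d b))
    {z : A} (hz : ∀ a : A, z * a = a * z) (a : A) : d z * a = a * d z := by
  have h2 := map_mul_add_mul_of_map_jmul hder
  have hz2 (b c : A) :
      z * (b * c + c * b) + (b * c + c * b) * z = b * (z * c + c * z) + (z * c + c * z) * b := by
    simp only [← hz, mul_add, add_mul, ← mul_assoc]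
    abel
  refine commute_of_commutator_central (fun b c => ?_) a
  have h := congrArg d (hz2 b c)
  rw [h2 z, h2 b c, h2 b (_ + _), h2 z c] at h
  have h3 := hz2 (d b) c
  have h4 := hz2 b (d c)
  rw [← sub_eq_zero] at h h3 h4 ⊢
  refine Eq.trans ?_ ((congrArg₂ (· - ·) (congrArg₂ (· - ·) h h3) h4).trans (by simp))
  noncomm_ring

open Unitization in
/-- The extension of a continuous linear map to the unitization, sending the unit to `0`. -/
def unitizationExtension (d : A →L[ℂ] A) : Unitization ℂ A →L[ℂ] Unitization ℂ A where
  toFun x := inr (d x.snd)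
  map_add' x y := by simp
  map_smul' c x := by simp
  cont := by
    exact Unitization.continuous_inr.comp (d.continuous.comp Unitization.continuous_snd)

lemma unitizationExtension_mul_add_mul {d : A →L[ℂ] A}
    (hder : ∀ a b : A, d (jmul a b) = jmul (d a) b + jmul a (d b)) (x y : Unitization ℂ A) :
    unitizationExtension d (x * y + y * x) =
      unitizationExtension d x * y + y * unitizationExtension d x +
        (x * unitizationExtension d y + unitizationExtension d y * x) := by
  have h := map_mul_add_mul_of_map_jmul hder x.snd y.snd
  ext
  · simp [unitizationExtension]
  · simp only [map_add] at h
    simp only [unitizationExtension, ContinuousLinearMap.coe_mk', LinearMap.coe_mk, AddHom.coe_mk,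
      Unitization.snd_add, Unitization.snd_mul, Unitization.snd_inr, Unitization.fst_inr,
      map_add, map_smul, zero_smul]
    rw [add_add_add_comm, h]
    abel

lemma unitizationExtension_pow_succ {d : A →L[ℂ] A}
    (hder : ∀ a b : A, d (jmul a b) = jmul (d a) b + jmul a (d b)) {x : Unitization ℂ A}
    (hx : Commute x (unitizationExtension d x)) (n : ℕ) :
    unitizationExtension d (x ^ (n + 1)) =
      ((n : ℂ) + 1) • (x ^ n * unitizationExtension d x) := by
  induction n with
  | zero => simp
  | succ n ih =>
    have h := unitizationExtension_mul_add_mul hder x (x ^ (n + 1))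
    have hc : x ^ n * unitizationExtension d x * x = x ^ (n + 1) * unitizationExtension d x := by
      rw [mul_assoc, ← hx.eq, ← mul_assoc, pow_succ]
    rw [← pow_succ, ← pow_succ', ih, smul_mul_assoc, mul_smul_comm, hc, ← mul_assoc, ← pow_succ',
      ← (hx.pow_left (n + 1)).eq, ← two_smul ℂ, ← two_smul ℂ, ← two_smul ℂ, map_smul,
      ← smul_add] at h
    rw [smul_right_injective _ (two_ne_zero (α := ℂ)) h]
    push_cast
    module

open NormedSpace in
lemma unitizationExtension_exp {d : A →L[ℂ] A}
    (hder : ∀ a b : A, d (jmul a b) = jmul (d a) b + jmul a (d b)) {x : Unitization ℂ A}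
    (hx : Commute x (unitizationExtension d x)) :
    unitizationExtension d (exp x) = exp x * unitizationExtension d x := by
  have h1 := (exp_series_hasSum_exp' (𝕂 := ℂ) x).mapL (unitizationExtension d)
  have h2 := (exp_series_hasSum_exp' (𝕂 := ℂ) x).mul_right (unitizationExtension d x)
  rw [← hasSum_nat_add_iff' 1] at h1
  have h0 : unitizationExtension d (1 : Unitization ℂ A) = 0 := by
    simp [unitizationExtension]
  simp only [Finset.range_one, Finset.sum_singleton, pow_zero, map_smul, h0, smul_zero,
    sub_zero] at h1
  have hterm (n : ℕ) : ((n + 1).factorial⁻¹ : ℂ) • unitizationExtension d (x ^ (n + 1)) =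
      (n.factorial⁻¹ : ℂ) • x ^ n * unitizationExtension d x := by
    rw [unitizationExtension_pow_succ hder hx, smul_smul, smul_mul_assoc, Nat.factorial_succ]
    congr 1
    push_cast
    field_simp
  simp only [hterm] at h1
  exact h1.unique h2

/-- A continuous Jordan derivation kills every self-adjoint element that commutes with its
image. -/
lemma map_eq_zero_of_isSelfAdjoint_of_commute {d : A →L[ℂ] A}
    (hder : ∀ a b : A, d (jmul a b) = jmul (d a) b + jmul a (d b)) {a : A}
    (ha : IsSelfAdjoint a) (hc : Commute a (d a)) : d a = 0 := by
  have hbound (n : ℕ) : (n : ℝ) * ‖d a‖ ≤ ‖unitizationExtension d‖ := by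
    let s : selfAdjoint (Unitization ℂ A) :=
      ⟨(((n : ℝ) • a : A) : Unitization ℂ A), by
        rw [selfAdjoint.mem_iff, ← Unitization.inr_star, star_smul, star_trivial, ha.star_eq]⟩
    have hD : unitizationExtension d (Complex.I • (s : Unitization ℂ A)) =
        (Complex.I * n) • ((d a : A) : Unitization ℂ A) := by
      simp [s, unitizationExtension, mul_smul, ← Complex.coe_smul]
    have hcomm : Commute (Complex.I • (s : Unitization ℂ A))
        (unitizationExtension d (Complex.I • (s : Unitization ℂ A))) := by
      rw [hD]
      refine (Commute.smul_left ?_ _).smul_right _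
      change _ * _ = _ * _
      rw [← Unitization.inr_mul, ← Unitization.inr_mul, (hc.smul_left (n : ℝ)).eq]
    have he := unitizationExtension_exp hder hcomm
    rw [← selfAdjoint.expUnitary_coe, hD] at he
    have hle := (unitizationExtension d).le_opNorm (selfAdjoint.expUnitary s : Unitization ℂ A)
    rw [he, CStarRing.norm_coe_unitary_mul, norm_smul, Unitization.norm_inr,
      CStarRing.norm_coe_unitary, mul_one] at hle
    simpa using hle
  by_contra hne
  obtain ⟨n, hn⟩ := exists_nat_gt (‖unitizationExtension d‖ / ‖d a‖)
  rw [div_lt_iff₀ (norm_pos_iff.2 hne)] at hn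
  exact (hbound n).not_gt hn

lemma map_eq_zero_of_central {d : A →L[ℂ] A}
    (hder : ∀ a b : A, d (jmul a b) = jmul (d a) b + jmul a (d b))
    {z : A} (hz : ∀ a : A, z * a = a * z) : d z = 0 := by
  have hz' (a : A) : star z * a = a * star z := by
    simpa using (congrArg star (hz (star a))).symm
  have hsa {s : A} (hs : IsSelfAdjoint s) (hcs : ∀ a : A, s * a = a * s) : d s = 0 :=
    map_eq_zero_of_isSelfAdjoint_of_commute hder hs (hcs _)
  have hre : d (realPart z : A) = 0 := hsa (realPart z).2 fun a => by
    simp [realPart_apply_coe, smul_mul_assoc, mul_smul_comm, add_mul, mul_add, hz, hz']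
  have him : d (imaginaryPart z : A) = 0 := hsa (imaginaryPart z).2 fun a => by
    simp [imaginaryPart_apply_coe, smul_mul_assoc, mul_smul_comm, sub_mul, mul_sub, hz, hz']
  rw [← realPart_add_I_smul_imaginaryPart z, map_add, map_smul, hre, him, smul_zero, add_zero]

end CStar

/-- A continuous Jordan `*`-derivation on a C*-algebra vanishes on the center, and hence
commutes with Jordan multiplication by any central element. -/
theorem jordan_star_derivation_eq_zero_on_center {A : Type*} [NonUnitalCStarAlgebra A]
    (d : A →L[ℂ] A) (hder : ∀ a b : A, d (jmul a b) = jmul (d a) b + jmul a (d b))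
    (hstar : ∀ a : A, d (star a) = star (d a)) :
    ∀ z : A, (∀ a : A, z * a = a * z) →
      d z = 0 ∧ ∀ x : A, d (jmul z x) = jmul z (d x) := by
  intro z hz
  have h0 := map_eq_zero_of_central hder hz
  refine ⟨h0, fun x => ?_⟩
  rw [hder, h0]
  simp [jmul]
end
end
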